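/- arXiv:1912.05115 — 14 statements merged into one kernel-verified Lean document; each statement's English description precedes it below -/
import Mathlib

section
/- Let X be a finite indecomposable rack and let Y be a subrack of X with Y ≠ X. Then X is generated as a rack by the complement Y^c = X \ Y; that is, the smallest subrack of X containing Y^c is X itself. Concretely, X = { y₁ ◃ (y₂ ◃ ( ⋯ ◃ (y_{n−1} ◃ y_n))) : n ≥ 1, y₁, …, y_n ∈ Y^c }. -/
theorem Equiv.Perm.apply_mem_iff_of_mapsTo {α : Type*} [Finite α] (f : Equiv.Perm α) {s : Set α}
    (h : ∀ x ∈ s, f x ∈ s) (x : α) : f x ∈ s ↔ x ∈ s := by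
  refine ⟨fun hx => ?_, h x⟩
  have hinv := Equiv.Perm.perm_symm_mapsTo_of_mapsTo f (s := s) (fun y hy => h y hy) hx
  simpa using hinv

theorem foldr_op_of_selfDistrib {α : Type*} (op : α → α → α)
    (hsd : ∀ x y z : α, op x (op y z) = op (op x y) (op x z)) (x a : α) (l : List α) :
    op x (l.foldr op a) = (l.map (op x)).foldr op (op x a) := by
  induction l with
  | nil => rfl
  | cons b l ih => rw [List.foldr_cons, hsd, ih, List.map_cons, List.foldr_cons]

theorem foldr_op_mem {α : Type*} {op : α → α → α} {s : Set α}
    (h : ∀ a ∈ s, ∀ b ∈ s, op a b ∈ s) {a : α} (ha : a ∈ s) (l : List α) (hl : ∀ b ∈ l, b ∈ s) :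
    l.foldr op a ∈ s := by
  induction l with
  | nil => exact ha
  | cons b l ih => exact h _ (hl _ (by simp)) _ (ih fun c hc => hl _ (by simp [hc]))

/-- A nonempty subset of a finite type stable under a set of permutations generating a transitive
group is everything. -/
theorem Set.eq_univ_of_transitive_closure {α : Type*} [Finite α] {T : Set (Equiv.Perm α)}
    (htrans : ∀ u v : α, ∃ g ∈ Subgroup.closure T, g u = v) {s : Set α} (hs : s.Nonempty)
    (h : ∀ f ∈ T, ∀ x ∈ s, f x ∈ s) : s = Set.univ := by
  have key : ∀ g ∈ Subgroup.closure T, ∀ x, g x ∈ s ↔ x ∈ s := by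
    intro g hg
    induction hg using Subgroup.closure_induction with
    | mem f hf => exact f.apply_mem_iff_of_mapsTo (h f hf)
    | one => simp
    | mul f g _ _ hf hg => intro x; rw [Equiv.Perm.mul_apply, hf, hg]
    | inv f _ hf => intro x; rw [← hf]; simp
  obtain ⟨u, hu⟩ := hs
  refine Set.eq_univ_of_forall fun v => ?_
  obtain ⟨g, hg, rfl⟩ := htrans u v
  exact (key g hg u).2 hu

/-- If `Y` is a proper subrack of a finite indecomposable rack `X`,
then `X` is generated as a rack by the complement `Yᶜ`: the smallest subrack
containing `Yᶜ` is `X`, and concretely `X` is the set of iterated products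
`y₁ ◃ (y₂ ◃ (⋯ ◃ (y_{n-1} ◃ y_n)))` of elements of `Yᶜ`. -/
theorem stmt_1 (X : Type) [Fintype X] [DecidableEq X]
    (op : X → X → X)
    (φ : X → Equiv.Perm X)
    (hφ : ∀ x y : X, φ x y = op x y)
    (hsd : ∀ x y z : X, op x (op y z) = op (op x y) (op x z))
    (hind : ∀ u v : X, ∃ g ∈ Subgroup.closure (Set.range φ), g u = v)
    (Y : Set X)
    (hYsub : Y.Nonempty ∧ ∀ a ∈ Y, ∀ b ∈ Y, op a b ∈ Y)
    (hYne : Y ≠ Set.univ) :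
    (∀ S : Set X, (S.Nonempty ∧ ∀ a ∈ S, ∀ b ∈ S, op a b ∈ S) → Yᶜ ⊆ S → S = Set.univ) ∧
    Set.univ = {w : X | ∃ (l : List X) (a : X),
      (∀ b ∈ l, b ∈ Yᶜ) ∧ a ∈ Yᶜ ∧ l.foldr op a = w} := by
  have hYc : ∀ y ∈ Y, ∀ b ∈ Yᶜ, op y b ∈ Yᶜ := by
    intro y hy b hb hmem
    rw [← hφ] at hmem
    refine hb (((φ y).apply_mem_iff_of_mapsTo (fun x hx => ?_) b).1 hmem)
    rw [hφ]
    exact hYsub.2 y hy x hx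
  have hW : {w : X | ∃ (l : List X) (a : X),
      (∀ b ∈ l, b ∈ Yᶜ) ∧ a ∈ Yᶜ ∧ l.foldr op a = w} = Set.univ := by
    refine Set.eq_univ_of_transitive_closure hind ?_ ?_
    · obtain ⟨a, ha⟩ := (Set.ne_univ_iff_exists_notMem Y).1 hYne
      exact ⟨a, [], a, by simp, ha, rfl⟩
    · rintro _ ⟨x, rfl⟩ _ ⟨l, a, hl, ha, rfl⟩
      rw [hφ]
      by_cases hx : x ∈ Y
      · refine ⟨l.map (op x), op x a, ?_, hYc x hx a ha, (foldr_op_of_selfDistrib op hsd x a l).symm⟩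
        intro b hb
        obtain ⟨c, hc, rfl⟩ := List.mem_map.1 hb
        exact hYc x hx c (hl c hc)
      · exact ⟨x :: l, a, List.forall_mem_cons.2 ⟨hx, hl⟩, ha, rfl⟩
  refine ⟨fun S hS hYS => Set.eq_univ_of_forall fun w => ?_, hW.symm⟩
  obtain ⟨l, a, hl, ha, rfl⟩ := hW.symm.subset (Set.mem_univ w)
  exact foldr_op_mem hS.2 (hYS ha) l fun b hb => hYS (hl b hb)
end

section
/- Let X be a finite indecomposable rack such that X = Y ∪ Z for two subracks Y and Z of X. Then X = Y or X = Z. -/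
/-- On a finite type, a set mapped into itself by a family of permutations is mapped into itself
by the subgroup they generate. -/
theorem mapsTo_of_mem_closure {X : Type*} [Finite X] {P : Set (Equiv.Perm X)} {S : Set X}
    (hP : ∀ f ∈ P, Set.MapsTo f S S) {g : Equiv.Perm X} (hg : g ∈ Subgroup.closure P) :
    Set.MapsTo g S S := by
  induction hg using Subgroup.closure_induction with
  | mem f hf => exact hP f hf
  | one => exact fun x hx => hx
  | mul f g _ _ hf hg => exact fun x hx => hf (hg hx)
  | inv f _ hf => exact Equiv.Perm.perm_symm_mapsTo_of_mapsTo _ hf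

/-- Inner permutations of a rack are rack automorphisms. -/
theorem map_leftTranslation_of_mem_closure {X : Type*} {φ : X → Equiv.Perm X}
    (hφ : ∀ x y z, φ x (φ y z) = φ (φ x y) (φ x z)) {g : Equiv.Perm X}
    (hg : g ∈ Subgroup.closure (Set.range φ)) (x y : X) : g (φ x y) = φ (g x) (g y) := by
  induction hg using Subgroup.closure_induction generalizing x y with
  | mem f hf =>
    obtain ⟨w, rfl⟩ := hf
    exact hφ w x y
  | one => rfl
  | mul f g _ _ hf hg => rw [Equiv.Perm.mul_apply, hg, hf]; rfl
  | inv f _ hf =>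
    apply f.injective
    rw [hf]
    simp

/-- If a finite indecomposable rack `X` is the union of two
subracks `Y` and `Z`, then `X = Y` or `X = Z`. -/
theorem stmt_2 (X : Type) [Fintype X] [DecidableEq X]
    (op : X → X → X)
    (φ : X → Equiv.Perm X)
    (hφ : ∀ x y : X, φ x y = op x y)
    (hsd : ∀ x y z : X, op x (op y z) = op (op x y) (op x z))
    (hind : ∀ u v : X, ∃ g ∈ Subgroup.closure (Set.range φ), g u = v)
    (Y Z : Set X)
    (hYsub : Y.Nonempty ∧ ∀ a ∈ Y, ∀ b ∈ Y, op a b ∈ Y)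
    (hZsub : Z.Nonempty ∧ ∀ a ∈ Z, ∀ b ∈ Z, op a b ∈ Z)
    (hunion : Y ∪ Z = Set.univ) :
    Y = Set.univ ∨ Z = Set.univ := by
  have hdist : ∀ x y z, φ x (φ y z) = φ (φ x y) (φ x z) := by
    intro x y z
    simp only [hφ]
    exact hsd x y z
  have hcover : ∀ x, x ∉ Y → x ∈ Z := fun x hx =>
    ((Set.ext_iff.mp hunion x).mpr trivial).resolve_left hx
  have hcover' : ∀ x, x ∉ Z → x ∈ Y := fun x hx => by_contra fun h => hx (hcover x h)
  rw [or_iff_not_imp_right, ← ne_eq, Set.ne_univ_iff_exists_notMem]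
  rintro ⟨a, ha⟩
  have hHY : ∀ h ∈ Subgroup.closure (φ '' Y), Set.MapsTo h Y Y := fun h hh =>
    mapsTo_of_mem_closure (by
      rintro _ ⟨y, hy, rfl⟩ b hb
      rw [hφ]
      exact hYsub.2 y hy b hb) hh
  have hZ : ∀ z ∈ Z, ∀ x, φ z x ∈ Z → x ∈ Z := by
    intro z hz x hx
    have hmaps : Set.MapsTo (φ z) Z Z := fun b hb => by
      rw [hφ]
      exact hZsub.2 z hz b hb
    simpa using Equiv.Perm.perm_symm_mapsTo_of_mapsTo _ hmaps hx
  -- The translates of `Zᶜ` under the group generated by `Y` form an invariant subset of `Y`.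
  let S : Set X := {x | ∃ h ∈ Subgroup.closure (φ '' Y), ∃ b, b ∉ Z ∧ h b = x}
  have hS : ∀ f ∈ Set.range φ, Set.MapsTo f S S := by
    rintro _ ⟨x, rfl⟩ _ ⟨h, hh, b, hb, rfl⟩
    by_cases hx : x ∈ Y
    · exact ⟨φ x * h, mul_mem (Subgroup.subset_closure ⟨x, hx, rfl⟩) hh, b, hb, rfl⟩
    · have hx' : h⁻¹ x ∉ Y := fun hmem => hx (by simpa using hHY h hh hmem)
      refine ⟨h, hh, φ (h⁻¹ x) b, fun hmem => hb (hZ _ (hcover _ hx') b hmem), ?_⟩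
      rw [map_leftTranslation_of_mem_closure hdist
        (Subgroup.closure_mono (Set.image_subset_range φ Y) hh)]
      simp
  refine Set.eq_univ_of_forall fun v => ?_
  obtain ⟨g, hg, rfl⟩ := hind a v
  obtain ⟨h, hh, b, hb, hbv⟩ := mapsTo_of_mem_closure hS hg
    (show a ∈ S from ⟨1, one_mem _, a, ha, rfl⟩)
  rw [← hbv]
  exact hHY h hh (hcover' b hb)
end

section
/- Let p, q be integers with p, q ≥ 2. Let X be a finite indecomposable rack, x ∈ X, and set Y = { y ∈ X : φ_x^p(y) = y } and Z = { z ∈ X : φ_x^q(z) = z }, where φ_x(y) = x ◃ y. If X = Y ∪ Z, then X = Y or X = Z. -/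
section InnerGroup

variable {X : Type} {φ : X → Equiv.Perm X}

/-- In a rack, `φ_{g u} = g φ_u g⁻¹` for every inner automorphism `g`. -/
theorem translation_apply_of_mem_closure
    (hconj : ∀ y u, φ (φ y u) = φ y * φ u * (φ y)⁻¹)
    {g : Equiv.Perm X} (hg : g ∈ Subgroup.closure (Set.range φ)) (u : X) :
    φ (g u) = g * φ u * g⁻¹ := by
  induction hg using Subgroup.closure_induction generalizing u with
  | mem g hg =>
    obtain ⟨y, rfl⟩ := hg
    exact hconj y u
  | one => simp
  | mul g h _ _ ihg ihh => rw [Equiv.Perm.mul_apply, ihg, ihh]; group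
  | inv g _ ih =>
    have h := ih (g⁻¹ u)
    rw [← Equiv.Perm.mul_apply, mul_inv_cancel, Equiv.Perm.one_apply] at h
    rw [h]; group

/-- If an inner automorphism `g` fixes `y`, then `φ_y` preserves the fixed points of `g`. -/
theorem fixed_translation_iff
    (hconj : ∀ y u, φ (φ y u) = φ y * φ u * (φ y)⁻¹)
    {g : Equiv.Perm X} (hg : g ∈ Subgroup.closure (Set.range φ)) {y : X} (hy : g y = y)
    (u : X) : g (φ y u) = φ y u ↔ g u = u := by
  have h := translation_apply_of_mem_closure hconj hg y
  rw [hy, eq_mul_inv_iff_mul_eq] at h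
  rw [← Equiv.Perm.mul_apply, ← h, Equiv.Perm.mul_apply, EmbeddingLike.apply_eq_iff_eq]

/-- An inner automorphism mapping `A` into itself conjugates the subgroup generated by the
translations of `A` into itself. -/
theorem conj_mem_closure_image
    (hconj : ∀ y u, φ (φ y u) = φ y * φ u * (φ y)⁻¹)
    {g : Equiv.Perm X} (hg : g ∈ Subgroup.closure (Set.range φ)) {A : Set X}
    (hA : ∀ u ∈ A, g u ∈ A) {h : Equiv.Perm X} (hh : h ∈ Subgroup.closure (φ '' A)) :
    g * h * g⁻¹ ∈ Subgroup.closure (φ '' A) := by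
  induction hh using Subgroup.closure_induction with
  | mem h hh =>
    obtain ⟨u, hu, rfl⟩ := hh
    rw [← translation_apply_of_mem_closure hconj hg]
    exact Subgroup.subset_closure ⟨_, hA u hu, rfl⟩
  | one => simp
  | mul h k _ _ ihh ihk => rw [← conj_mul]; exact mul_mem ihh ihk
  | inv h _ ih => rw [← conj_inv]; exact inv_mem ih

/-- In an indecomposable rack, if every translation by a point outside `A` preserves `A`,
and `A` is nonempty, then the translations of `A` generate the inner group. -/
theorem closure_range_le_closure_image
    (hconj : ∀ y u, φ (φ y u) = φ y * φ u * (φ y)⁻¹)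
    (hind : ∀ u v : X, ∃ g ∈ Subgroup.closure (Set.range φ), g u = v)
    {A : Set X} (hne : A.Nonempty) (hA : ∀ y ∉ A, ∀ u, φ y u ∈ A ↔ u ∈ A) :
    Subgroup.closure (Set.range φ) ≤ Subgroup.closure (φ '' A) := by
  have hnorm : Subgroup.closure (Set.range φ) ≤
      Subgroup.normalizer (Subgroup.closure (φ '' A) : Set (Equiv.Perm X)) := by
    rw [Subgroup.closure_le]
    rintro _ ⟨y, rfl⟩
    by_cases hy : y ∈ A
    · exact Subgroup.le_normalizer (Subgroup.subset_closure ⟨y, hy, rfl⟩)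
    have hmem : φ y ∈ Subgroup.closure (Set.range φ) := Subgroup.subset_closure ⟨y, rfl⟩
    refine Subgroup.mem_normalizer_iff.2 fun h =>
      ⟨conj_mem_closure_image hconj hmem fun u => (hA y hy u).2, fun hh => ?_⟩
    have := conj_mem_closure_image hconj (inv_mem hmem)
      (fun u hu => (hA y hy _).1 (by simpa using hu)) hh
    simpa [mul_assoc] using this
  rw [Subgroup.closure_le]
  rintro _ ⟨v, rfl⟩
  obtain ⟨a, ha⟩ := hne
  obtain ⟨g, hg, rfl⟩ := hind a v
  rw [translation_apply_of_mem_closure hconj hg]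
  exact (Subgroup.mem_normalizer_iff.1 (hnorm hg) _).1 (Subgroup.subset_closure ⟨a, ha, rfl⟩)

/-- If every point of an indecomposable rack is fixed by one of two inner automorphisms, then one
of the two is the identity. -/
theorem fixed_eq_univ_or_fixed_eq_univ
    (hconj : ∀ y u, φ (φ y u) = φ y * φ u * (φ y)⁻¹)
    (hind : ∀ u v : X, ∃ g ∈ Subgroup.closure (Set.range φ), g u = v)
    {a b : Equiv.Perm X} (ha : a ∈ Subgroup.closure (Set.range φ))
    (hb : b ∈ Subgroup.closure (Set.range φ))
    (hunion : {y : X | a y = y} ∪ {z : X | b z = z} = Set.univ) :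
    {y : X | a y = y} = Set.univ ∨ {z : X | b z = z} = Set.univ := by
  by_contra! hcon
  obtain ⟨v, hv⟩ := (Set.ne_univ_iff_exists_notMem _).1 hcon.1
  obtain ⟨u, hu⟩ := (Set.ne_univ_iff_exists_notMem _).1 hcon.2
  have hcover : ∀ y, b y ≠ y → a y = y := fun y hy =>
    (hunion.ge (Set.mem_univ y)).resolve_right hy
  have hle := closure_range_le_closure_image hconj hind (A := {z | b z ≠ z}) ⟨u, hu⟩
    fun y hy w => (fixed_translation_iff hconj hb (not_not.1 hy) w).not
  have hinv : ∀ g ∈ Subgroup.closure (φ '' {z | b z ≠ z}), ∀ w, a (g w) = g w ↔ a w = w := by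
    intro g hg
    induction hg using Subgroup.closure_induction with
    | mem g hg =>
      obtain ⟨y, hy, rfl⟩ := hg
      exact fixed_translation_iff hconj ha (hcover y hy)
    | one => simp
    | mul g h _ _ ihg ihh => exact fun w => (ihg (h w)).trans (ihh w)
    | inv g _ ih => exact fun w => by simpa using (ih (g⁻¹ w)).symm
  obtain ⟨g, hg, rfl⟩ := hind u v
  exact hv ((hinv g (hle hg) u).2 (hcover u hu))

end InnerGroup


/-- Let `p, q ≥ 2`, `X` a finite indecomposable rack, `x ∈ X`,
`Y = {y : φ_x^p y = y}` and `Z = {z : φ_x^q z = z}`. If `X = Y ∪ Z` then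
`X = Y` or `X = Z`. -/
theorem stmt_3 (X : Type) [Fintype X] [DecidableEq X]
    (op : X → X → X)
    (φ : X → Equiv.Perm X)
    (hφ : ∀ x y : X, φ x y = op x y)
    (hsd : ∀ x y z : X, op x (op y z) = op (op x y) (op x z))
    (hind : ∀ u v : X, ∃ g ∈ Subgroup.closure (Set.range φ), g u = v)
    (p q : ℕ) (hp : 2 ≤ p) (hq : 2 ≤ q) (x : X)
    (hunion : {y : X | (φ x ^ p) y = y} ∪ {z : X | (φ x ^ q) z = z} = Set.univ) :
    {y : X | (φ x ^ p) y = y} = Set.univ ∨ {z : X | (φ x ^ q) z = z} = Set.univ := by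
  have hconj : ∀ y u, φ (φ y u) = φ y * φ u * (φ y)⁻¹ := by
    intro y u
    rw [eq_mul_inv_iff_mul_eq]
    ext w
    rw [Equiv.Perm.mul_apply, Equiv.Perm.mul_apply, hφ, hφ, hφ, hφ, hφ, hsd y u w]
  have hx : φ x ∈ Subgroup.closure (Set.range φ) := Subgroup.subset_closure ⟨x, rfl⟩
  exact fixed_eq_univ_or_fixed_eq_univ hconj hind (pow_mem hx p) (pow_mem hx q) hunion
end

section
/- There is no finite indecomposable rack X with profile 1^{m₀} l₁^{m₁} l₂^{m₂} ⋯ l_k^{m_k} such that for some i with 1 ≤ i < k, the numbers lcm(l₁, l₂, …, l_i) and lcm(l_{i+1}, l_{i+2}, …, l_k) do not divide each other. Equivalently: if X is a finite indecomposable rack, x ∈ X, and the nontrivial cycle lengths of the permutation φ_x are 1 < l₁ < l₂ < ⋯ < l_k, then for every i with 1 ≤ i < k, either lcm(l₁, …, l_i) divides lcm(l_{i+1}, …, l_k) or lcm(l_{i+1}, …, l_k) divides lcm(l₁, …, l_i). -/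
namespace Equiv.Perm

/-- A permutation commuting with a transitive group and fixing a point is trivial. -/
lemma eq_one_of_commute_of_fixed {X : Type*} {G : Subgroup (Equiv.Perm X)}
    (hG : ∀ u v : X, ∃ g ∈ G, g u = v) {c : Equiv.Perm X}
    (hc : ∀ g ∈ G, Commute c g) {y : X} (hy : c y = y) : c = 1 := by
  ext v
  obtain ⟨g, hg, rfl⟩ := hG y v
  have h := congrArg (fun f : Equiv.Perm X => f y) (hc g hg).eq
  simpa [hy] using h

/-- A power of `f` divisible by the length of the cycle through `y` fixes `y`. -/
lemma pow_apply_eq_self_of_card_support_cycleOf_dvd {X : Type*} [Fintype X] [DecidableEq X]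
    (f : Equiv.Perm X) {y : X} {n : ℕ} (h : (f.cycleOf y).support.card ∣ n) :
    (f ^ n) y = y := by
  rw [← f.pow_mod_card_support_cycleOf_self_apply n y, Nat.mod_eq_zero_of_dvd h, pow_zero, one_apply]

end Equiv.Perm

section Rack

variable {X : Type*} {φ : X → Equiv.Perm X}

/-- Inner automorphisms of a rack conjugate left translations to left translations. -/
lemma apply_inner_eq_conj (hconj : ∀ x y : X, φ (φ x y) = φ x * φ y * (φ x)⁻¹)
    {g : Equiv.Perm X} (hg : g ∈ Subgroup.closure (Set.range φ)) (y : X) :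
    φ (g y) = g * φ y * g⁻¹ := by
  induction hg using Subgroup.closure_induction generalizing y with
  | mem g hg =>
    obtain ⟨x, rfl⟩ := hg
    exact hconj x y
  | one => simp
  | mul g h _ _ ihg ihh => simp [ihg, ihh, mul_assoc]
  | inv g _ ih =>
    have h := ih (g⁻¹ y)
    rw [← Equiv.Perm.mul_apply, mul_inv_cancel, Equiv.Perm.one_apply] at h
    rw [h]
    group

/-- In an indecomposable rack, two nontrivial inner automorphisms cannot have disjoint supports. -/
lemma eq_one_or_eq_one_of_disjoint_of_indecomposable
    (hconj : ∀ x y : X, φ (φ x y) = φ x * φ y * (φ x)⁻¹)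
    (hind : ∀ u v : X, ∃ g ∈ Subgroup.closure (Set.range φ), g u = v)
    {a b : Equiv.Perm X} (ha : a ∈ Subgroup.closure (Set.range φ))
    (hb : b ∈ Subgroup.closure (Set.range φ)) (hab : a.Disjoint b) : a = 1 ∨ b = 1 := by
  by_contra! hne
  obtain ⟨ha1, hb1⟩ := hne
  have fixed_commute : ∀ c ∈ Subgroup.closure (Set.range φ), ∀ y, c y = y → Commute c (φ y) := by
    intro c hc y hy
    have h := apply_inner_eq_conj hconj hc y
    rw [hy, eq_mul_inv_iff_mul_eq] at h
    exact h.symm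
  have moved : ∀ c : Equiv.Perm X, c ≠ 1 → ∃ y, c y ≠ y := by
    intro c hc
    by_contra! h
    exact hc (Equiv.ext h)
  have extend : ∀ c : Equiv.Perm X, (∀ y, Commute c (φ y)) →
      ∀ g ∈ Subgroup.closure (Set.range φ), Commute c g := by
    intro c hc g hg
    have hle : Subgroup.closure (Set.range φ) ≤ Subgroup.centralizer {c} := by
      rw [Subgroup.closure_le]
      rintro _ ⟨y, rfl⟩
      exact Subgroup.mem_centralizer_singleton_iff.2 (hc y).symm
    exact (Subgroup.mem_centralizer_singleton_iff.1 (hle hg)).symm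
  obtain ⟨u, hu⟩ := moved a ha1
  obtain ⟨v, hv⟩ := moved b hb1
  obtain ⟨z, hz⟩ : ∃ z, ¬ Commute a (φ z) := by
    by_contra! h
    exact ha1 (Equiv.Perm.eq_one_of_commute_of_fixed hind (extend a h) ((hab v).resolve_right hv))
  -- The translations not commuting with `a` generate a normal subgroup centralizing `b`.
  let K : Subgroup (Equiv.Perm X) := Subgroup.closure {f | ∃ y, f = φ y ∧ ¬ Commute a (φ y)}
  have hKb : K ≤ Subgroup.centralizer {b} := by
    rw [Subgroup.closure_le]
    rintro _ ⟨y, rfl, hy⟩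
    refine Subgroup.mem_centralizer_singleton_iff.2 (fixed_commute b hb y ?_).symm
    exact (hab y).resolve_left fun h => hy (fixed_commute a ha y h)
  have hKconj : ∀ g ∈ Subgroup.closure (Set.range φ), Commute a g →
      ∀ f ∈ K, g * f * g⁻¹ ∈ K := by
    intro g hg hag f hf
    have hle : K ≤ K.comap (MulAut.conj g).toMonoidHom := by
      refine (Subgroup.closure_le _).2 ?_
      rintro _ ⟨y, rfl, hy⟩
      refine Subgroup.subset_closure ⟨g y, (apply_inner_eq_conj hconj hg y).symm, fun h => hy ?_⟩
      rw [apply_inner_eq_conj hconj hg y] at h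
      have h' := (hag.inv_right.mul_right h).mul_right hag
      simpa [mul_assoc] using h'
    exact hle hf
  have hnorm : Subgroup.closure (Set.range φ) ≤ Subgroup.normalizer (K : Set (Equiv.Perm X)) := by
    rw [Subgroup.closure_le]
    rintro _ ⟨y, rfl⟩
    by_cases hy : Commute a (φ y)
    · have hmem : φ y ∈ Subgroup.closure (Set.range φ) := Subgroup.subset_closure ⟨y, rfl⟩
      refine Subgroup.mem_normalizer_iff.2 fun f => ⟨hKconj _ hmem hy f, fun hf => ?_⟩
      have h := hKconj _ (inv_mem hmem) hy.inv_right _ hf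
      simpa [mul_assoc] using h
    · exact Subgroup.le_normalizer (Subgroup.subset_closure ⟨y, rfl, hy⟩)
  have hall : ∀ y, φ y ∈ K := by
    intro y
    obtain ⟨g, hg, rfl⟩ := hind z y
    rw [apply_inner_eq_conj hconj hg]
    exact (Subgroup.mem_normalizer_iff.1 (hnorm hg) _).1 (Subgroup.subset_closure ⟨z, rfl, hz⟩)
  have hbφ : ∀ y, Commute b (φ y) := fun y =>
    (Subgroup.mem_centralizer_singleton_iff.1 (hKb (hall y))).symm
  exact hb1 (Equiv.Perm.eq_one_of_commute_of_fixed hind (extend b hbφ) ((hab u).resolve_left hu))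

end Rack

/-- If `X` is a finite indecomposable rack, `x ∈ X`, and the
nontrivial cycle lengths of `φ_x` are `1 < l₁ < l₂ < ⋯ < l_k`, then for every
`1 ≤ i < k` either `lcm(l₁,…,l_i)` divides `lcm(l_{i+1},…,l_k)` or conversely. -/
theorem stmt_4 (X : Type) [Fintype X] [DecidableEq X]
    (op : X → X → X)
    (φ : X → Equiv.Perm X)
    (hφ : ∀ x y : X, φ x y = op x y)
    (hsd : ∀ x y z : X, op x (op y z) = op (op x y) (op x z))
    (hind : ∀ u v : X, ∃ g ∈ Subgroup.closure (Set.range φ), g u = v)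
    (x : X) (k : ℕ) (l : Fin k → ℕ)
    (hmono : StrictMono l)
    (hl1 : ∀ j : Fin k, 1 < l j)
    (hcyc : (φ x).cycleType.toFinset = Finset.image l Finset.univ) :
    ∀ i : ℕ, 1 ≤ i → i < k →
      ((Finset.univ.filter fun j : Fin k => (j : ℕ) < i).lcm l ∣
        (Finset.univ.filter fun j : Fin k => i ≤ (j : ℕ)).lcm l) ∨
      ((Finset.univ.filter fun j : Fin k => i ≤ (j : ℕ)).lcm l ∣
        (Finset.univ.filter fun j : Fin k => (j : ℕ) < i).lcm l) := by
  intro i _ _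
  set A := (Finset.univ.filter fun j : Fin k => (j : ℕ) < i).lcm l
  set B := (Finset.univ.filter fun j : Fin k => i ≤ (j : ℕ)).lcm l
  have hconj : ∀ u v : X, φ (φ u v) = φ u * φ v * (φ u)⁻¹ := by
    intro u v
    rw [eq_mul_inv_iff_mul_eq]
    ext w
    simp only [Equiv.Perm.mul_apply, hφ]
    exact (hsd u v w).symm
  have hmem : ∀ n : ℕ, φ x ^ n ∈ Subgroup.closure (Set.range φ) := fun n =>
    pow_mem (Subgroup.subset_closure (Set.mem_range_self x)) n
  have hdvd : ∀ s : Finset (Fin k), ∀ n : ℕ, φ x ^ n = 1 → s.lcm l ∣ n := by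
    intro s n hn
    refine Finset.lcm_dvd fun j _ => ?_
    have hj : l j ∈ (φ x).cycleType := by
      rw [← Multiset.mem_toFinset, hcyc]
      exact Finset.mem_image_of_mem l (Finset.mem_univ j)
    exact (Equiv.Perm.dvd_of_mem_cycleType hj).trans (orderOf_dvd_of_pow_eq_one hn)
  have hdisj : (φ x ^ A).Disjoint (φ x ^ B) := by
    intro y
    by_cases hy : φ x y = y
    · exact Or.inl (Equiv.Perm.pow_apply_eq_self_of_apply_eq_self hy A)
    have hlen : ((φ x).cycleOf y).support.card ∈ (φ x).cycleType.toFinset := by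
      rw [Multiset.mem_toFinset, Equiv.Perm.cycleType_def]
      exact Multiset.mem_map_of_mem (Finset.card ∘ Equiv.Perm.support)
        (Equiv.Perm.cycleOf_mem_cycleFactorsFinset_iff.2 (Equiv.Perm.mem_support.2 hy))
    rw [hcyc] at hlen
    obtain ⟨j, -, hj⟩ := Finset.mem_image.1 hlen
    rcases lt_or_ge (j : ℕ) i with hji | hji
    · left
      apply Equiv.Perm.pow_apply_eq_self_of_card_support_cycleOf_dvd
      rw [← hj]
      exact Finset.dvd_lcm (by simpa using hji)
    · right
      apply Equiv.Perm.pow_apply_eq_self_of_card_support_cycleOf_dvd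
      rw [← hj]
      exact Finset.dvd_lcm (by simpa using hji)
  rcases eq_one_or_eq_one_of_disjoint_of_indecomposable hconj hind (hmem A) (hmem B) hdisj
    with h | h
  · exact Or.inr (hdvd _ A h)
  · exact Or.inl (hdvd _ B h)
end

section
/- There is no finite indecomposable rack X with profile 1^{m₀} l₁^{m₁} l₂^{m₂} such that l₁ does not divide l₂. Equivalently: if X is a finite indecomposable rack, x ∈ X, and the permutation φ_x has exactly two distinct nontrivial cycle lengths l₁ < l₂, then l₁ divides l₂ (so Hayashi's conjecture holds for profiles with two nontrivial cycle lengths). -/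
/-- A permutation raised to a power divisible by the length of the cycle through `y` fixes `y`. -/
theorem Equiv.Perm.pow_apply_eq_self_of_card_cycleOf_dvd {X : Type*} [Fintype X] [DecidableEq X]
    (f : Equiv.Perm X) (y : X) (hy : f y ≠ y) (n : ℕ)
    (hn : (f.cycleOf y).support.card ∣ n) : (f ^ n) y = y := by
  have hc : (f.cycleOf y).IsCycle := f.isCycle_cycleOf hy
  rw [← hc.orderOf] at hn
  rw [← Equiv.Perm.cycleOf_pow_apply_self, orderOf_dvd_iff_pow_eq_one.mp hn, Equiv.Perm.one_apply]

/-- If the only nontrivial cycle lengths of `f` are `a` and `b`, then every point is fixed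
by `f ^ a` or by `f ^ b`. -/
theorem Equiv.Perm.pow_apply_eq_self_or_of_cycleType {X : Type*} [Fintype X] [DecidableEq X]
    (f : Equiv.Perm X) {a b : ℕ} (hf : f.cycleType.toFinset = {a, b}) (y : X) :
    (f ^ a) y = y ∨ (f ^ b) y = y := by
  by_cases hy : f y = y
  · exact Or.inl (Equiv.Perm.pow_apply_eq_self_of_apply_eq_self hy a)
  have hc : (f.cycleOf y).support.card ∈ f.cycleType.toFinset := by
    rw [Multiset.mem_toFinset, Equiv.Perm.cycleType_def, Multiset.mem_map]
    exact ⟨f.cycleOf y, Equiv.Perm.cycleOf_mem_cycleFactorsFinset_iff.mpr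
      (Equiv.Perm.mem_support.mpr hy), rfl⟩
  rw [hf, Finset.mem_insert, Finset.mem_singleton] at hc
  exact hc.imp (fun h => f.pow_apply_eq_self_of_card_cycleOf_dvd y hy a h.dvd)
    (fun h => f.pow_apply_eq_self_of_card_cycleOf_dvd y hy b h.dvd)

/-- A map `φ` that is equivariant for the conjugation action of its own values is equivariant for
the group they generate. -/
theorem apply_eq_conj_of_mem_closure_range {X : Type*} {φ : X → Equiv.Perm X}
    (hφ : ∀ w y, φ (φ w y) = φ w * φ y * (φ w)⁻¹) {g : Equiv.Perm X}
    (hg : g ∈ Subgroup.closure (Set.range φ)) (y : X) : φ (g y) = g * φ y * g⁻¹ := by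
  induction hg using Subgroup.closure_induction generalizing y with
  | mem g hg => obtain ⟨w, rfl⟩ := hg; exact hφ w y
  | one => simp
  | mul g h _ _ ihg ihh => rw [Equiv.Perm.mul_apply, ihg, ihh]; group
  | inv g _ ih =>
    have h := ih (g⁻¹ y)
    rw [← Equiv.Perm.mul_apply, mul_inv_cancel, Equiv.Perm.one_apply] at h
    rw [h]; group

/-- If `g` commutes with `s`, conjugation by `g` preserves the subgroup generated by the
translations of the points moved by `s`. -/
theorem conj_mem_closure_image_of_commute {X : Type*} {φ : X → Equiv.Perm X}
    {g s : Equiv.Perm X} (hg : ∀ y, φ (g y) = g * φ y * g⁻¹) (hgs : Commute g s)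
    {k : Equiv.Perm X} (hk : k ∈ Subgroup.closure (φ '' {y | s y ≠ y})) :
    g * k * g⁻¹ ∈ Subgroup.closure (φ '' {y | s y ≠ y}) := by
  induction hk using Subgroup.closure_induction with
  | mem k hk =>
    obtain ⟨y, hy, rfl⟩ := hk
    rw [← hg]
    refine Subgroup.subset_closure ⟨g y, fun h => hy (g.injective ?_), rfl⟩
    rw [← Equiv.Perm.mul_apply, hgs.eq, Equiv.Perm.mul_apply, h]
  | one => simp
  | mul h k _ _ ihh ihk => simpa [mul_assoc] using mul_mem ihh ihk
  | inv k _ ih => simpa [mul_assoc] using inv_mem ih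

/-- If `X` is a finite indecomposable rack, `x ∈ X`, and `φ_x`
has exactly two distinct nontrivial cycle lengths `l₁ < l₂`, then `l₁ ∣ l₂`. -/
theorem stmt_5 (X : Type) [Fintype X] [DecidableEq X]
    (op : X → X → X)
    (φ : X → Equiv.Perm X)
    (hφ : ∀ x y : X, φ x y = op x y)
    (hsd : ∀ x y z : X, op x (op y z) = op (op x y) (op x z))
    (hind : ∀ u v : X, ∃ g ∈ Subgroup.closure (Set.range φ), g u = v)
    (x : X) (l₁ l₂ : ℕ) (h1 : 1 < l₁) (h12 : l₁ < l₂)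
    (hcyc : (φ x).cycleType.toFinset = {l₁, l₂}) :
    l₁ ∣ l₂ := by
  have hconj (w y : X) : φ (φ w y) = φ w * φ y * (φ w)⁻¹ := by
    rw [eq_mul_inv_iff_mul_eq]
    ext z
    simp only [Equiv.Perm.mul_apply, hφ]
    exact (hsd w y z).symm
  have hequiv {g : Equiv.Perm X} (hg : g ∈ Subgroup.closure (Set.range φ)) (y : X) :
      φ (g y) = g * φ y * g⁻¹ := apply_eq_conj_of_mem_closure_range hconj hg y
  have hmem (w : X) : φ w ∈ Subgroup.closure (Set.range φ) := Subgroup.subset_closure ⟨w, rfl⟩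
  have hcomm {n : ℕ} {y : X} (hy : (φ x ^ n) y = y) : Commute (φ y) (φ x ^ n) := by
    have h := hequiv (pow_mem (hmem x) n) y
    rw [hy, eq_mul_inv_iff_mul_eq] at h
    exact h
  have hdvd {l n : ℕ} (hl : l ∈ ({l₁, l₂} : Finset ℕ)) (hn : φ x ^ n = 1) : l ∣ n := by
    rw [← hcyc, Multiset.mem_toFinset] at hl
    exact (Equiv.Perm.dvd_of_mem_cycleType hl).trans (orderOf_dvd_of_pow_eq_one hn)
  obtain ⟨y₀, hy₀⟩ : ∃ y, (φ x ^ l₁) y ≠ y := by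
    by_contra! h
    have : l₂ ∣ l₁ := hdvd (by simp) (Equiv.ext h)
    exact absurd (Nat.le_of_dvd (by omega) this) (by omega)
  have hfix {y : X} (hy : (φ x ^ l₁) y ≠ y) : (φ x ^ l₂) y = y :=
    ((φ x).pow_apply_eq_self_or_of_cycleType hcyc y).resolve_left hy
  set K := Subgroup.closure (φ '' {y | (φ x ^ l₁) y ≠ y}) with hK
  have hnormal : Subgroup.closure (Set.range φ) ≤ Subgroup.normalizer (K : Set (Equiv.Perm X)) := by
    rw [Subgroup.closure_le]
    rintro _ ⟨w, rfl⟩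
    by_cases hw : (φ x ^ l₁) w = w
    · refine Subgroup.mem_normalizer_iff.mpr fun k => ⟨fun hk =>
        conj_mem_closure_image_of_commute (hequiv (hmem w)) (hcomm hw) hk, fun hk => ?_⟩
      have h := conj_mem_closure_image_of_commute (hequiv (inv_mem (hmem w)))
        (hcomm hw).inv_left hk
      simpa [mul_assoc] using h
    · exact Subgroup.le_normalizer (Subgroup.subset_closure ⟨w, hw, rfl⟩)
  have hKtop (z : X) : φ z ∈ K := by
    obtain ⟨g, hg, rfl⟩ := hind y₀ z
    rw [hequiv hg]
    exact (Subgroup.mem_normalizer_iff.mp (hnormal hg) _).mp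
      (Subgroup.subset_closure ⟨y₀, hy₀, rfl⟩)
  have hKcent : K ≤ Subgroup.centralizer {φ x ^ l₂} := by
    rw [hK, Subgroup.closure_le]
    rintro _ ⟨y, hy, rfl⟩
    exact Subgroup.mem_centralizer_singleton_iff.mpr (hcomm (hfix hy)).eq
  have hcent : Subgroup.closure (Set.range φ) ≤ Subgroup.centralizer {φ x ^ l₂} := by
    rw [Subgroup.closure_le]
    rintro _ ⟨z, rfl⟩
    exact hKcent (hKtop z)
  refine hdvd (by simp) (Equiv.ext fun z => ?_)
  obtain ⟨g, hg, rfl⟩ := hind y₀ z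
  have h := Subgroup.mem_centralizer_singleton_iff.mp (hcent hg)
  rw [← Equiv.Perm.mul_apply, ← h, Equiv.Perm.mul_apply, hfix hy₀, Equiv.Perm.one_apply]
end

section
/- Let X be a finite crossed set, x ∈ X, and for an integer t ≥ 1 let X_t = { y ∈ X : φ_x^t(y) = y }, where φ_x(y) = x ◃ y. Then X_t is a subrack of X (in particular x ∈ X_t, so X_t is nonempty), and for every y ∈ X_t one has y ◃ (X \ X_t) = X \ X_t. -/
/-- Powers of a left translation of a left self-distributive operation are endomorphisms. -/
theorem leftTranslation_pow_op {X : Type*} {op : X → X → X} {φ : X → Equiv.Perm X}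
    (hφ : ∀ x y : X, φ x y = op x y)
    (hsd : ∀ x y z : X, op x (op y z) = op (op x y) (op x z)) (x : X) (t : ℕ) (a b : X) :
    (φ x ^ t) (op a b) = op ((φ x ^ t) a) ((φ x ^ t) b) := by
  induction t with
  | zero => simp
  | succ n ih => rw [pow_succ', Equiv.Perm.mul_apply, ih, hφ, hsd, ← hφ x, ← hφ x]; rfl

/-- In a finite crossed set `X`, for `x ∈ X` and `t ≥ 1`, the set
`X_t = {y : φ_x^t y = y}` is a subrack (in particular `x ∈ X_t`), and for every
`y ∈ X_t` one has `y ◃ (X \ X_t) = X \ X_t`. -/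
theorem stmt_6 (X : Type) [Fintype X] [DecidableEq X]
    (op : X → X → X)
    (φ : X → Equiv.Perm X)
    (hφ : ∀ x y : X, φ x y = op x y)
    (hsd : ∀ x y z : X, op x (op y z) = op (op x y) (op x z))
    (hq : ∀ x : X, op x x = x)
    (hcr : ∀ x y : X, op y x = x → op x y = y)
    (x : X) (t : ℕ) (ht : 1 ≤ t) :
    x ∈ {y : X | (φ x ^ t) y = y} ∧
    (∀ a ∈ {y : X | (φ x ^ t) y = y}, ∀ b ∈ {y : X | (φ x ^ t) y = y},
      op a b ∈ {y : X | (φ x ^ t) y = y}) ∧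
    (∀ y ∈ {y : X | (φ x ^ t) y = y},
      op y '' {y : X | (φ x ^ t) y = y}ᶜ = {y : X | (φ x ^ t) y = y}ᶜ) := by
  have hfix : ∀ a b : X, (φ x ^ t) a = a →
      ((φ x ^ t) (op a b) = op a b ↔ (φ x ^ t) b = b) := by
    intro a b ha
    rw [leftTranslation_pow_op hφ hsd, ha, ← hφ, ← hφ, (φ a).injective.eq_iff]
  refine ⟨?_, fun a ha b hb => (hfix a b ha).2 hb, fun y hy => ?_⟩
  · exact Equiv.Perm.pow_apply_eq_self_of_apply_eq_self ((hφ x x).trans (hq x)) t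
  · ext z
    constructor
    · rintro ⟨w, hw, rfl⟩
      exact fun h => hw ((hfix y w hy).1 h)
    · intro hz
      have hyz : op y ((φ y).symm z) = z := by rw [← hφ, Equiv.apply_symm_apply]
      exact ⟨(φ y).symm z, fun h => hz (hyz ▸ (hfix y _ hy).2 h), hyz⟩
end

section
/- In the setup below, for every y ∈ X′_{pqs} there exists z ∈ X′_{prs} such that y ◃ z ≠ z. -/
open Equiv.Perm in
theorem card_support_cycleOf_mem_cycleType {X : Type*} [Fintype X] [DecidableEq X]
    {f : Equiv.Perm X} {w : X} (hw : f w ≠ w) :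
    (f.cycleOf w).support.card ∈ f.cycleType := by
  rw [cycleType_def]
  refine Multiset.mem_map.2 ⟨f.cycleOf w, ?_, rfl⟩
  exact cycleOf_mem_cycleFactorsFinset_iff.2 (mem_support.2 hw)

open Equiv.Perm in
theorem pow_apply_eq_self_iff_card_support_cycleOf_dvd {X : Type*} [Fintype X] [DecidableEq X]
    {f : Equiv.Perm X} {w : X} (hw : f w ≠ w) (t : ℕ) :
    (f ^ t) w = w ↔ (f.cycleOf w).support.card ∣ t := by
  have hc : (f.cycleOf w).IsCycle := isCycle_cycleOf f hw
  rw [← hc.orderOf, orderOf_dvd_iff_pow_eq_one, hc.pow_eq_one_iff' (x := w) (by simpa using hw),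
    cycleOf_pow_apply_self]

open Equiv.Perm in
theorem sameCycle_of_card_support_cycleOf_eq {X : Type*} [Fintype X] [DecidableEq X]
    {f : Equiv.Perm X} {u v : X} (hu : f u ≠ u) (hv : f v ≠ v)
    (huv : (f.cycleOf u).support.card = (f.cycleOf v).support.card)
    (hcount : f.cycleType.count (f.cycleOf v).support.card ≤ 1) : f.SameCycle u v := by
  rw [sameCycle_iff_cycleOf_eq_of_mem_support (mem_support.2 hu) (mem_support.2 hv)]
  rw [cycleType_def, Multiset.count_map] at hcount
  have hcount' : (f.cycleFactorsFinset.filter fun c =>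
      (f.cycleOf v).support.card = c.support.card).card ≤ 1 := hcount
  refine Finset.card_le_one.1 hcount' _ ?_ _ ?_
  · exact Finset.mem_filter.2
      ⟨cycleOf_mem_cycleFactorsFinset_iff.2 (mem_support.2 hu), huv.symm⟩
  · exact Finset.mem_filter.2 ⟨cycleOf_mem_cycleFactorsFinset_iff.2 (mem_support.2 hv), rfl⟩

theorem Subgroup.forall_mem_of_closure_transitive {X : Type*} {S : Set (Equiv.Perm X)}
    (hS : ∀ u v : X, ∃ g ∈ Subgroup.closure S, g u = v) [Finite X] {T : Set X}
    (hT : ∀ g ∈ S, ∀ w ∈ T, g w ∈ T) {u : X} (hu : u ∈ T) (v : X) : v ∈ T := by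
  obtain ⟨g, hg, rfl⟩ := hS u v
  have key : ∀ w, g w ∈ T ↔ w ∈ T := by
    induction hg using Subgroup.closure_induction with
    | mem g hg =>
      intro w
      refine ⟨fun h => ?_, hT g hg w⟩
      have himage : g '' T = T :=
        Set.eq_of_subset_of_ncard_le (Set.image_subset_iff.2 (hT g hg))
          (Set.ncard_image_of_injective T g.injective).ge
      rw [← himage] at h
      exact (g.injective.mem_set_image).1 h
    | one => simp
    | mul a b _ _ ha hb => intro w; rw [Equiv.Perm.mul_apply, ha, hb]
    | inv a _ ha => intro w; rw [← ha]; simp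
  exact (key u).2 hu

/-- In a finite indecomposable rack, the translations by the points outside a proper subrack
generate the inner group. -/
theorem mem_closure_translations_compl_of_subrack {X : Type*} [Finite X]
    {φ : X → Equiv.Perm X} (hconj : ∀ u v, φ (φ u v) = φ u * φ v * (φ u)⁻¹)
    (hind : ∀ u v : X, ∃ g ∈ Subgroup.closure (Set.range φ), g u = v)
    {Y : Set X} (hY : ∀ u ∈ Y, ∀ v ∈ Y, φ u v ∈ Y) {a : X} (ha : a ∉ Y) (w : X) :
    φ w ∈ Subgroup.closure (φ '' Yᶜ) := by
  refine Subgroup.forall_mem_of_closure_transitive (T := {w | φ w ∈ Subgroup.closure (φ '' Yᶜ)})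
    hind ?_ (Subgroup.subset_closure ⟨a, ha, rfl⟩) w
  rintro _ ⟨u, rfl⟩ v hv
  simp only [Set.mem_ofPred_eq] at hv ⊢
  rw [hconj]
  by_cases hu : u ∈ Y
  · have hstable : ∀ v, φ u v ∈ Y → v ∈ Y := by
      intro v h
      have himage : φ u '' Y = Y :=
        Set.eq_of_subset_of_ncard_le (Set.image_subset_iff.2 (hY u hu))
          (Set.ncard_image_of_injective Y (φ u).injective).ge
      rw [← himage] at h
      exact ((φ u).injective.mem_set_image).1 h
    generalize φ v = g at hv ⊢
    induction hv using Subgroup.closure_induction with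
    | mem g hg =>
      obtain ⟨v, hv, rfl⟩ := hg
      rw [← hconj]
      exact Subgroup.subset_closure ⟨_, fun h => hv (hstable v h), rfl⟩
    | one => simp
    | mul a b _ _ ha hb => simpa [mul_assoc] using mul_mem ha hb
    | inv a _ ha => simpa [mul_assoc] using inv_mem ha
  · have hu' : φ u ∈ Subgroup.closure (φ '' Yᶜ) := Subgroup.subset_closure ⟨u, hu, rfl⟩
    exact mul_mem (mul_mem hu' hv) (inv_mem hu')


/-- The set of points of `X` fixed by `φ_x^t`. -/
def fixedPts {X : Type} (φ : X → Equiv.Perm X) (x : X) (t : ℕ) : Set X :=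
  {y : X | (φ x ^ t) y = y}

/-- In the setup (finite indecomposable crossed set whose inner
automorphisms have profile `1^{m₀}·(pqs)·(prs)·(qrs)`), for every
`y ∈ X′_{pqs}` there exists `z ∈ X′_{prs}` with `y ◃ z ≠ z`. -/
theorem stmt_7 (X : Type) [Fintype X] [DecidableEq X]
    (op : X → X → X)
    (φ : X → Equiv.Perm X)
    (hφ : ∀ x y : X, φ x y = op x y)
    (hsd : ∀ x y z : X, op x (op y z) = op (op x y) (op x z))
    (hq : ∀ x : X, op x x = x)
    (hcr : ∀ x y : X, op y x = x → op x y = y)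
    (hind : ∀ u v : X, ∃ g ∈ Subgroup.closure (Set.range φ), g u = v)
    (x : X) (p q r s : ℕ)
    (hp : 1 < p) (hq' : 1 < q) (hr : 1 < r) (hs : 0 < s)
    (hpq : Nat.Coprime p q) (hpr : Nat.Coprime p r) (hps : Nat.Coprime p s)
    (hqr : Nat.Coprime q r) (hqs : Nat.Coprime q s) (hrs : Nat.Coprime r s)
    (hcyc : (φ x).cycleType = {p * q * s, p * r * s, q * r * s}) :
    ∀ y ∈ fixedPts φ x (p * q * s) \ fixedPts φ x 1,
      ∃ z ∈ fixedPts φ x (p * r * s) \ fixedPts φ x 1, op y z ≠ z := by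
  intro y hy
  by_contra! hfix
  have hself : ∀ u v w, φ u (φ v w) = φ (φ u v) (φ u w) := fun u v w => by
    simp only [hφ]
    exact hsd u v w
  have hconj : ∀ u v, φ (φ u v) = φ u * φ v * (φ u)⁻¹ := by
    intro u v
    rw [eq_mul_inv_iff_mul_eq]
    ext w
    exact (hself u v w).symm
  have hpow : ∀ (t : ℕ) (v w : X), (φ x ^ t) (φ v w) = φ ((φ x ^ t) v) ((φ x ^ t) w) := by
    intro t v w
    induction t with
    | zero => simp
    | succ t ih => simp only [pow_succ', Equiv.Perm.mul_apply, ih, ← hself]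
  have hcomm : ∀ u v, φ u v = v → φ v u = u := by
    intro u v h
    rw [hφ] at h ⊢
    exact hcr v u h
  have hmem : ∀ t, ∀ w ∈ fixedPts φ x t, (φ x ^ t) w = w := fun _ _ h => h
  have hmoved : ∀ w, w ∉ fixedPts φ x 1 ↔ φ x w ≠ w := fun w => by
    simp [fixedPts]
  have hndvd : ∀ {a b c d : ℕ}, 1 < a → Nat.Coprime a b → Nat.Coprime a c → Nat.Coprime a d →
      ¬ a ∣ b * c * d := fun h hb hc hd hdvd =>
    h.ne' (Nat.Coprime.eq_one_of_dvd ((hb.mul_right hc).mul_right hd) hdvd)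
  have hr_ndvd : ¬ r ∣ p * q * s := hndvd hr hpr.symm hqr.symm hrs
  have hq_ndvd : ¬ q ∣ p * r * s := hndvd hq' hpq.symm hqr hqs
  have hp_ndvd : ¬ p ∣ q * r * s := hndvd hp hpq hpr hps
  have hlen : ∀ w, φ x w ≠ w → ((φ x).cycleOf w).support.card = p * q * s ∨
      ((φ x).cycleOf w).support.card = p * r * s ∨
      ((φ x).cycleOf w).support.card = q * r * s := by
    intro w hw
    have h := card_support_cycleOf_mem_cycleType hw
    rw [hcyc] at h
    simpa using h
  have hlenA : ∀ w ∈ fixedPts φ x (p * q * s) \ fixedPts φ x 1,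
      ((φ x).cycleOf w).support.card = p * q * s := by
    intro w hw
    have hw1 := (hmoved w).1 hw.2
    have hdvd := (pow_apply_eq_self_iff_card_support_cycleOf_dvd hw1 _).1 (hmem _ w hw.1)
    rcases hlen w hw1 with h | h | h
    · exact h
    · exact absurd (dvd_trans ⟨p * s, by rw [h]; ring⟩ hdvd) hr_ndvd
    · exact absurd (dvd_trans ⟨q * s, by rw [h]; ring⟩ hdvd) hr_ndvd
  have hcount : (φ x).cycleType.count (p * q * s) ≤ 1 := by
    have h1 : p * q * s ≠ p * r * s := fun h => hr_ndvd ⟨p * s, by rw [h]; ring⟩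
    have h2 : p * q * s ≠ q * r * s := fun h => hr_ndvd ⟨q * s, by rw [h]; ring⟩
    rw [hcyc]
    simp [h1, h2]
  have hAB : ∀ a ∈ fixedPts φ x (p * q * s) \ fixedPts φ x 1,
      ∀ b ∈ fixedPts φ x (p * r * s) \ fixedPts φ x 1, φ a b = b := by
    intro a ha b hb
    have hsame : (φ x).SameCycle y a := by
      refine sameCycle_of_card_support_cycleOf_eq ((hmoved y).1 hy.2) ((hmoved a).1 ha.2) ?_ ?_
      · rw [hlenA y hy, hlenA a ha]
      · rwa [hlenA a ha]
    obtain ⟨k, hk⟩ := hsame.exists_pow_eq'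
    obtain ⟨b', rfl⟩ := (φ x ^ k).surjective b
    rw [← hk.2, ← hpow]
    have hcommute : ∀ t, (φ x ^ t) ((φ x ^ k) b') = (φ x ^ k) ((φ x ^ t) b') := by
      intro t
      rw [← Equiv.Perm.mul_apply, ← Equiv.Perm.mul_apply, ← pow_add, ← pow_add, add_comm]
    have hb' : b' ∈ fixedPts φ x (p * r * s) \ fixedPts φ x 1 := by
      refine ⟨(φ x ^ k).injective ?_, fun h => hb.2 ?_⟩
      · rw [← hcommute]
        exact hb.1
      · change (φ x ^ 1) ((φ x ^ k) b') = _
        rw [hcommute, hmem 1 b' h]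
    rw [hφ, hfix b' hb']
  have hY : ∀ u ∈ fixedPts φ x (q * r * s), ∀ v ∈ fixedPts φ x (q * r * s),
      φ u v ∈ fixedPts φ x (q * r * s) := by
    intro u hu v hv
    change (φ x ^ (q * r * s)) (φ u v) = φ u v
    rw [hpow, hmem _ u hu, hmem _ v hv]
  have hcompl : ∀ w ∉ fixedPts φ x (q * r * s),
      w ∈ fixedPts φ x (p * q * s) \ fixedPts φ x 1 ∨
      w ∈ fixedPts φ x (p * r * s) \ fixedPts φ x 1 := by
    intro w hw
    have hw1 : φ x w ≠ w := fun h => hw (Equiv.Perm.pow_apply_eq_self_of_apply_eq_self h _)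
    have hiff := pow_apply_eq_self_iff_card_support_cycleOf_dvd hw1
    rcases hlen w hw1 with h | h | h
    · exact Or.inl ⟨(hiff _).2 h.dvd, (hmoved w).2 hw1⟩
    · exact Or.inr ⟨(hiff _).2 h.dvd, (hmoved w).2 hw1⟩
    · exact absurd ((hiff _).2 h.dvd) hw
  have hyY : y ∉ fixedPts φ x (q * r * s) := by
    intro h
    have hdvd := (pow_apply_eq_self_iff_card_support_cycleOf_dvd ((hmoved y).1 hy.2) _).1
      (hmem _ y h)
    rw [hlenA y hy] at hdvd
    exact hp_ndvd (dvd_trans ⟨q * s, by ring⟩ hdvd)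
  have hgen : ∀ u v : X, ∃ g ∈ Subgroup.closure (φ '' (fixedPts φ x (q * r * s))ᶜ), g u = v := by
    intro u v
    obtain ⟨g, hg, hguv⟩ := hind u v
    refine ⟨g, (Subgroup.closure_le _).2 ?_ hg, hguv⟩
    rintro _ ⟨w, rfl⟩
    exact mem_closure_translations_compl_of_subrack hconj hind hY hyY w
  obtain ⟨b, hb⟩ : (fixedPts φ x (p * r * s) \ fixedPts φ x 1).Nonempty := by
    have hB : p * r * s ∈ (φ x).cycleType := by rw [hcyc]; simp
    rw [Equiv.Perm.cycleType_def] at hB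
    obtain ⟨c, hc, hcard⟩ := Multiset.mem_map.1 hB
    have hc' : c ∈ (φ x).cycleFactorsFinset := hc
    obtain ⟨b, hb⟩ := (Equiv.Perm.mem_cycleFactorsFinset_iff.1 hc').1.nonempty_support
    have hb1 : φ x b ≠ b := by
      rw [← Equiv.Perm.mem_support]
      exact Equiv.Perm.mem_cycleFactorsFinset_support_le hc' hb
    refine ⟨b, ?_, (hmoved b).2 hb1⟩
    refine (pow_apply_eq_self_iff_card_support_cycleOf_dvd hb1 _).2 ?_
    rw [← Equiv.Perm.cycle_is_cycleOf hb hc']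
    exact dvd_of_eq hcard
  have hxT := Subgroup.forall_mem_of_closure_transitive
    (T := {w | ∀ b ∈ fixedPts φ x (p * r * s) \ fixedPts φ x 1, φ b w = w}) hgen
    (by
      rintro _ ⟨u, hu, rfl⟩ w hw b hb
      rcases hcompl u hu with h | h
      · have hcom : φ b * φ u = φ u * φ b := by
          rw [← mul_inv_eq_iff_eq_mul, ← hconj, hcomm u b (hAB u h b hb)]
        rw [← Equiv.Perm.mul_apply, hcom, Equiv.Perm.mul_apply, hw b hb]
      · rw [hw u h, hw b hb])
    (u := y) (fun b hb => hcomm y b (hAB y hy b hb)) x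
  exact (hmoved b).1 hb.2 (hcomm b x (hxT b hb))
end

section
/- In the setup below, let y ∈ X′_{pqs} and z ∈ X \ X_{pqs} with y ◃ z ≠ z, and let t be the smallest positive integer with φ_y^t(z) = z. Then t = prs or t = qrs. -/
namespace Equiv.Perm

variable {X : Type*} [Fintype X] [DecidableEq X]

theorem pow_apply_eq_self_iff_card_support_cycleOf_dvd {f : Perm X} {z : X} (hz : f z ≠ z)
    {n : ℕ} : (f ^ n) z = z ↔ (f.cycleOf z).support.card ∣ n :=
  (isCycleOn_support_cycleOf f z).pow_apply_eq
    (mem_support_cycleOf_iff.2 ⟨SameCycle.refl f z, mem_support.2 hz⟩)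

theorem card_support_cycleOf_mem_cycleType {f : Perm X} {z : X} (hz : f z ≠ z) :
    (f.cycleOf z).support.card ∈ f.cycleType := by
  rw [cycleType_def]
  exact Multiset.mem_map.2
    ⟨f.cycleOf z, cycleOf_mem_cycleFactorsFinset_iff.2 (mem_support.2 hz), rfl⟩

/-- If the cycle lengths of `f` are pairwise distinct, then each permutation commuting with `f`
preserves every cycle of `f`. -/
theorem sameCycle_apply_of_commute_of_nodup_cycleType {f g : Perm X} (hfg : Commute f g)
    (hf : f.cycleType.Nodup) {z : X} (hz : f z ≠ z) : f.SameCycle z (g z) := by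
  have hpow (n : ℕ) : (f ^ n) (g z) = g ((f ^ n) z) :=
    DFunLike.congr_fun (hfg.pow_left n).eq z
  have hgz : f (g z) ≠ g z := by
    intro h
    exact hz (g.injective ((hpow 1).symm.trans h))
  have hcard : (f.cycleOf z).support.card = (f.cycleOf (g z)).support.card := by
    refine Nat.dvd_right_iff_eq.1 fun n ↦ ?_
    rw [← pow_apply_eq_self_iff_card_support_cycleOf_dvd hz,
      ← pow_apply_eq_self_iff_card_support_cycleOf_dvd hgz, hpow, g.injective.eq_iff]
  rw [cycleType_def] at hf
  exact (sameCycle_iff_cycleOf_eq_of_mem_support (mem_support.2 hz) (mem_support.2 hgz)).2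
    (Multiset.inj_on_of_nodup_map hf _
      (cycleOf_mem_cycleFactorsFinset_iff.2 (mem_support.2 hz)) _
      (cycleOf_mem_cycleFactorsFinset_iff.2 (mem_support.2 hgz)) hcard)

/-- If `g` commutes with `f` and the cycle lengths of `f` are pairwise distinct, then the `g`-orbit
length of a point moved by `f` divides its `f`-orbit length. -/
theorem pow_card_support_cycleOf_apply_of_commute {f g : Perm X} (hfg : Commute f g)
    (hf : f.cycleType.Nodup) {z : X} (hz : f z ≠ z) :
    (g ^ (f.cycleOf z).support.card) z = z := by
  obtain ⟨i, hi⟩ := sameCycle_apply_of_commute_of_nodup_cycleType hfg hf hz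
  have hpow (n : ℕ) : (g ^ n) z = ((f ^ i) ^ n) z := by
    induction n with
    | zero => rfl
    | succ n ih =>
      rw [pow_succ, mul_apply, ← hi, pow_succ', mul_apply, ← ih]
      exact (DFunLike.congr_fun ((hfg.zpow_left i).pow_right n).eq z).symm
  rw [hpow, ← zpow_natCast, ← zpow_mul, mul_comm, zpow_mul, zpow_natCast]
  exact zpow_apply_eq_self_of_apply_eq_self
    ((pow_apply_eq_self_iff_card_support_cycleOf_dvd hz).2 dvd_rfl) i

end Equiv.Perm

/-- Left translations of a rack are equivariant under the inner group. -/
theorem leftTranslation_apply_eq_conj {X : Type*} {φ : X → Equiv.Perm X}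
    (hφ : ∀ x y, φ (φ x y) = φ x * φ y * (φ x)⁻¹) {g : Equiv.Perm X}
    (hg : g ∈ Subgroup.closure (Set.range φ)) (u : X) : φ (g u) = g * φ u * g⁻¹ := by
  induction hg using Subgroup.closure_induction generalizing u with
  | mem g hg => obtain ⟨a, rfl⟩ := hg; exact hφ a u
  | one => simp
  | mul a b _ _ ha hb => rw [Equiv.Perm.mul_apply, ha, hb]; group
  | inv a _ ha =>
    have := ha (a⁻¹ u)
    rw [← Equiv.Perm.mul_apply, mul_inv_cancel, Equiv.Perm.one_apply] at this
    rw [this]; group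

/-- In the setup, if `y ∈ X′_{pqs}`, `z ∉ X_{pqs}`, `y ◃ z ≠ z`,
and `t` is the smallest positive integer with `φ_y^t z = z`, then `t = prs`
or `t = qrs`. -/
theorem stmt_8 (X : Type) [Fintype X] [DecidableEq X]
    (op : X → X → X)
    (φ : X → Equiv.Perm X)
    (hφ : ∀ x y : X, φ x y = op x y)
    (hsd : ∀ x y z : X, op x (op y z) = op (op x y) (op x z))
    (hq : ∀ x : X, op x x = x)
    (hcr : ∀ x y : X, op y x = x → op x y = y)
    (hind : ∀ u v : X, ∃ g ∈ Subgroup.closure (Set.range φ), g u = v)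
    (x : X) (p q r s : ℕ)
    (hp : 1 < p) (hq' : 1 < q) (hr : 1 < r) (hs : 0 < s)
    (hpq : Nat.Coprime p q) (hpr : Nat.Coprime p r) (hps : Nat.Coprime p s)
    (hqr : Nat.Coprime q r) (hqs : Nat.Coprime q s) (hrs : Nat.Coprime r s)
    (hcyc : (φ x).cycleType = {p * q * s, p * r * s, q * r * s})
    (y z : X)
    (hy : y ∈ fixedPts φ x (p * q * s) \ fixedPts φ x 1)
    (hz : z ∉ fixedPts φ x (p * q * s))
    (hyz : op y z ≠ z)
    (t : ℕ) (htpos : 0 < t) (htfix : (φ y ^ t) z = z)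
    (htmin : ∀ t' : ℕ, 0 < t' → (φ y ^ t') z = z → t ≤ t') :
    t = p * r * s ∨ t = q * r * s := by
  have hconj (a b : X) : φ (φ a b) = φ a * φ b * (φ a)⁻¹ := by
    rw [eq_mul_inv_iff_mul_eq]
    ext c
    simp only [Equiv.Perm.mul_apply, hφ]
    exact (hsd a b c).symm
  have hcycy : (φ y).cycleType = {p * q * s, p * r * s, q * r * s} := by
    obtain ⟨g, hg, rfl⟩ := hind x y
    rw [leftTranslation_apply_eq_conj hconj hg, Equiv.Perm.cycleType_conj, hcyc]
  have hnodup : (φ y).cycleType.Nodup := by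
    have ne_of_coprime {a b c : ℕ} (ha : 1 < a) (hab : Nat.Coprime a b) (hc : 0 < c) :
        a * c ≠ b * c := by
      intro h
      obtain rfl := Nat.eq_of_mul_eq_mul_right hc h
      exact ha.ne' (Nat.coprime_self a |>.1 hab)
    have h₁ : p * q * s ≠ p * r * s := by
      convert ne_of_coprime hq' hqr (c := p * s) (by positivity) using 1 <;> ring
    have h₂ : p * q * s ≠ q * r * s := by
      convert ne_of_coprime hp hpr (c := q * s) (by positivity) using 1 <;> ring
    have h₃ : p * r * s ≠ q * r * s := by
      convert ne_of_coprime hp hpq (c := r * s) (by positivity) using 1 <;> ring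
    simp [hcycy, h₁, h₂, h₃]
  have hyz' : φ y z ≠ z := by rwa [hφ]
  have hcomm : Commute (φ y) (φ x ^ (p * q * s)) := by
    have h := leftTranslation_apply_eq_conj hconj
      (pow_mem (Subgroup.subset_closure (Set.mem_range_self x)) (p * q * s)) y
    rw [show (φ x ^ (p * q * s)) y = y from hy.1, eq_mul_inv_iff_mul_eq] at h
    exact h
  have ht : t = ((φ y).cycleOf z).support.card := by
    have hdvd := (Equiv.Perm.pow_apply_eq_self_iff_card_support_cycleOf_dvd hyz').1 htfix
    have hpos := Nat.pos_of_dvd_of_pos hdvd htpos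
    exact le_antisymm (htmin _ hpos
      ((Equiv.Perm.pow_apply_eq_self_iff_card_support_cycleOf_dvd hyz').2 dvd_rfl))
      (Nat.le_of_dvd htpos hdvd)
  have hmem := Equiv.Perm.card_support_cycleOf_mem_cycleType hyz'
  rw [hcycy, ← ht] at hmem
  simp only [Multiset.insert_eq_cons, Multiset.mem_cons, Multiset.mem_singleton] at hmem
  refine hmem.resolve_left fun htpqs ↦ ?_
  have hxz : φ x z ≠ z := fun h ↦ hz (Equiv.Perm.pow_apply_eq_self_of_apply_eq_self h _)
  have hdvd : ((φ x).cycleOf z).support.card ∣ p * q * s * (p * q * s) := by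
    rw [← Equiv.Perm.pow_apply_eq_self_iff_card_support_cycleOf_dvd hxz, pow_mul]
    have h := Equiv.Perm.pow_card_support_cycleOf_apply_of_commute hcomm hnodup hyz'
    rwa [← ht, htpqs] at h
  have hndvd : ¬ ((φ x).cycleOf z).support.card ∣ p * q * s := fun h ↦
    hz ((Equiv.Perm.pow_apply_eq_self_iff_card_support_cycleOf_dvd hxz).2 h)
  have hr_coprime : Nat.Coprime r (p * q * s * (p * q * s)) := by
    have h : Nat.Coprime r (p * q * s) := (hpr.symm.mul_right hqr.symm).mul_right hrs
    exact h.mul_right h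
  have hr_ndvd : ¬ r ∣ p * q * s * (p * q * s) := fun h ↦
    hr.ne' (Nat.eq_one_of_dvd_coprimes hr_coprime dvd_rfl h)
  have hmemx := Equiv.Perm.card_support_cycleOf_mem_cycleType hxz
  rw [hcyc] at hmemx
  simp only [Multiset.insert_eq_cons, Multiset.mem_cons, Multiset.mem_singleton] at hmemx
  rcases hmemx with h | h | h
  · exact hndvd h.dvd
  · exact hr_ndvd ((Dvd.intro_left p rfl).mul_right s |>.trans (h ▸ hdvd))
  · exact hr_ndvd ((Dvd.intro_left q rfl).mul_right s |>.trans (h ▸ hdvd))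
end

section
/- In the setup below, for every y ∈ X′_{pqs} there exist z ∈ X′_{prs} and f ∈ X′_{qrs} such that z ◃ f = y or f ◃ z = y. -/
namespace Equiv.Perm

variable {X : Type} [Fintype X] [DecidableEq X]

/-- The length of the nontrivial cycle of `f` through `v`, or `0` if `f` fixes `v`. -/
def cycleLength (f : Perm X) (v : X) : ℕ := (f.cycleOf v).support.card

theorem cycleLength_eq_zero {f : Perm X} {v : X} : f.cycleLength v = 0 ↔ f v = v := by
  simp [cycleLength]

theorem pow_apply_eq_self_iff_cycleLength {f : Perm X} {v : X} {n : ℕ} :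
    (f ^ n) v = v ↔ f.cycleLength v = 0 ∨ f.cycleLength v ∣ n := by
  by_cases h : f v = v
  · simp only [cycleLength_eq_zero, h, true_or, iff_true]
    exact pow_apply_eq_self_of_apply_eq_self h n
  · rw [(f.isCycleOn_support_cycleOf v).pow_apply_eq
      ((mem_support_cycleOf_iff' h).2 (SameCycle.refl f v)), cycleLength_eq_zero]
    simp [h, cycleLength]

theorem cycleLength_conj (f g : Perm X) (v : X) :
    (g * f * g⁻¹).cycleLength (g v) = f.cycleLength v := by
  have h : ((g * f * g⁻¹).cycleOf (g v)).support = (f.cycleOf v).support.map g.toEmbedding := by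
    ext w
    rw [Finset.mem_map_equiv, mem_support_cycleOf_iff, mem_support_cycleOf_iff, sameCycle_conj]
    simp
  rw [cycleLength, h, Finset.card_map, cycleLength]

theorem cycleLength_mem_cycleType {f : Perm X} {v : X} (h : f v ≠ v) :
    f.cycleLength v ∈ f.cycleType := by
  rw [cycleType_def]
  exact Multiset.mem_map_of_mem _ (cycleOf_mem_cycleFactorsFinset_iff.2 (mem_support.2 h))

theorem exists_cycleLength_eq {f : Perm X} {a : ℕ} (h : a ∈ f.cycleType) :
    ∃ v, f.cycleLength v = a := by
  rw [cycleType_def, Multiset.mem_map] at h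
  obtain ⟨c, hc, rfl⟩ := h
  obtain ⟨v, hv⟩ := (mem_cycleFactorsFinset_iff.1 hc).1.nonempty_support
  exact ⟨v, by rw [cycleLength, ← cycle_is_cycleOf hv hc]; rfl⟩

theorem SameCycle.cycleLength_eq {f : Perm X} {v w : X} (h : f.SameCycle v w) :
    f.cycleLength v = f.cycleLength w := by
  rw [cycleLength, cycleLength, h.cycleOf_eq]

theorem sameCycle_of_cycleLength_eq {f : Perm X} (hf : f.cycleType.Nodup) {v w : X}
    (h0 : f.cycleLength v ≠ 0) (h : f.cycleLength v = f.cycleLength w) : f.SameCycle v w := by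
  have hv : f v ≠ v := fun e => h0 (cycleLength_eq_zero.2 e)
  have hw : f w ≠ w := fun e => h0 (h.trans (cycleLength_eq_zero.2 e))
  rw [cycleType_def] at hf
  have := Multiset.inj_on_of_nodup_map hf _
    (cycleOf_mem_cycleFactorsFinset_iff.2 (mem_support.2 hv)) _
    (cycleOf_mem_cycleFactorsFinset_iff.2 (mem_support.2 hw)) h
  rw [← mem_support_cycleOf_iff' hv, this, mem_support_cycleOf_iff' hw]

theorem card_filter_cycleLength {f : Perm X} (hf : f.cycleType.Nodup) {a : ℕ}
    (ha : a ∈ f.cycleType) : (Finset.univ.filter fun v => f.cycleLength v = a).card = a := by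
  obtain ⟨v, rfl⟩ := exists_cycleLength_eq ha
  have h0 : f.cycleLength v ≠ 0 := by have := two_le_of_mem_cycleType ha; omega
  have hv : f v ≠ v := fun e => h0 (cycleLength_eq_zero.2 e)
  conv_rhs => rw [cycleLength]
  congr 1
  ext w
  rw [mem_support_cycleOf_iff' hv, Finset.mem_filter]
  exact ⟨fun h => sameCycle_of_cycleLength_eq hf h0 h.2.symm,
    fun h => ⟨Finset.mem_univ w, h.cycleLength_eq.symm⟩⟩

end Equiv.Perm

section Quandle

open Equiv.Perm

variable {X : Type} {φ : X → Equiv.Perm X}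

theorem apply_eq_conj_of_mem_closure (hc : ∀ u v, φ (φ u v) = φ u * φ v * (φ u)⁻¹)
    {g : Equiv.Perm X} (hg : g ∈ Subgroup.closure (Set.range φ)) (v : X) :
    φ (g v) = g * φ v * g⁻¹ := by
  induction hg using Subgroup.closure_induction generalizing v with
  | mem g h =>
    obtain ⟨u, rfl⟩ := h
    exact hc u v
  | one => simp
  | mul g k _ _ hg hk => rw [Equiv.Perm.mul_apply, hg, hk]; group
  | inv g _ hg =>
    have := hg (g⁻¹ v)
    rw [← Equiv.Perm.mul_apply, mul_inv_cancel, Equiv.Perm.one_apply] at this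
    rw [this]; group

theorem apply_apply_of_mem_closure (hc : ∀ u v, φ (φ u v) = φ u * φ v * (φ u)⁻¹)
    {g : Equiv.Perm X} (hg : g ∈ Subgroup.closure (Set.range φ)) (u v : X) :
    g (φ u v) = φ (g u) (g v) := by
  simp [apply_eq_conj_of_mem_closure hc hg]

variable [Fintype X] [DecidableEq X]

theorem cycleLength_apply_apply (hc : ∀ u v, φ (φ u v) = φ u * φ v * (φ u)⁻¹)
    {g : Equiv.Perm X} (hg : g ∈ Subgroup.closure (Set.range φ)) (u v : X) :
    (φ (g u)).cycleLength (g v) = (φ u).cycleLength v := by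
  rw [apply_eq_conj_of_mem_closure hc hg, cycleLength_conj]

theorem cycleLength_le_swap (hc : ∀ u v, φ (φ u v) = φ u * φ v * (φ u)⁻¹)
    (hq : ∀ u, φ u u = u) (hcr : ∀ u v, φ v u = u → φ u v = v)
    (hind : ∀ u v : X, ∃ g ∈ Subgroup.closure (Set.range φ), g u = v)
    (hf : ∀ u, (φ u).cycleType.Nodup) (u v : X) :
    (φ u).cycleLength v ≤ (φ v).cycleLength u := by
  by_cases h0 : φ u v = v
  · rw [cycleLength_eq_zero.2 h0]; exact Nat.zero_le _
  have h1 : φ v u ≠ u := fun h => h0 (hcr u v h)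
  have hcard (w t : X) (h : φ w t ≠ t) :
      (Finset.univ.filter fun p : X × X =>
        (φ p.1).cycleLength p.2 = (φ w).cycleLength t).card
        = Fintype.card X * (φ w).cycleLength t := by
    rw [Finset.card_filter, Fintype.sum_prod_type]
    simp_rw [← Finset.card_filter]
    rw [Finset.sum_const_nat (m := (φ w).cycleLength t), Finset.card_univ]
    intro x _
    apply card_filter_cycleLength (hf x)
    obtain ⟨g, hg, rfl⟩ := hind w x
    rw [apply_eq_conj_of_mem_closure hc hg, cycleType_conj]
    exact cycleLength_mem_cycleType h
  have hle := Finset.card_le_card_of_injOn (Prod.swap : X × X → X × X)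
    (s := Finset.univ.filter fun p : X × X => (φ p.1).cycleLength p.2 = (φ u).cycleLength v)
    (t := Finset.univ.filter fun p : X × X => (φ p.1).cycleLength p.2 = (φ v).cycleLength u)
    (by
      rintro ⟨u', v'⟩ h
      simp only [Finset.coe_filter, Finset.mem_univ, true_and, Set.mem_ofPred_eq,
        Prod.swap_prod_mk] at h ⊢
      obtain ⟨g, hg, rfl⟩ := hind u u'
      have hs : (φ (g u)).SameCycle (g v) v' := by
        apply sameCycle_of_cycleLength_eq (hf _)
        · rw [cycleLength_apply_apply hc hg, Ne, cycleLength_eq_zero]; exact h0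
        · rw [cycleLength_apply_apply hc hg, h]
      obtain ⟨n, rfl⟩ := hs.exists_nat_pow_eq
      have hk : φ (g u) ^ n ∈ Subgroup.closure (Set.range φ) :=
        Subgroup.pow_mem _ (Subgroup.subset_closure (Set.mem_range_self _)) n
      rw [← cycleLength_apply_apply hc hg v u, ← cycleLength_apply_apply hc hk (g v) (g u)]
      congr 1
      symm
      apply pow_apply_eq_self_of_apply_eq_self
      exact hq (g u))
    (Prod.swap_injective.injOn)
  rw [hcard u v h0, hcard v u h1] at hle
  exact Nat.le_of_mul_le_mul_left hle (Fintype.card_pos_iff.2 (Nonempty.intro u))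

/-- If translations by the points of the `γ`-cycle preserve the `β`-cycle, then `γ ≤ β`. -/
theorem le_of_forall_cycleLength_apply (hc : ∀ u v, φ (φ u v) = φ u * φ v * (φ u)⁻¹)
    (hsymm : ∀ u v, (φ u).cycleLength v = (φ v).cycleLength u)
    (hf : ∀ u, (φ u).cycleType.Nodup) {β γ : ℕ} {x z f : X} (hγ : γ ∈ (φ f).cycleType)
    (hβ : β ∈ (φ z).cycleType)
    (hz : (φ x).cycleLength z = β) (hxf : (φ x).cycleLength f = γ)
    (h : ∀ u w, (φ u).cycleLength w = β → (φ u).cycleLength f = γ →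
      (φ u).cycleLength (φ f w) = β) : γ ≤ β := by
  have hmem : φ f ∈ Subgroup.closure (Set.range φ) := Subgroup.subset_closure ⟨_, rfl⟩
  have hγ0 : γ ≠ 0 := by have := two_le_of_mem_cycleType hγ; omega
  have key (n : ℕ) : (φ (((φ f)⁻¹ ^ n) x)).cycleLength z = β := by
    induction n with
    | zero => simpa using hz
    | succ n ih =>
      rw [← cycleLength_apply_apply hc hmem, pow_succ', ← Equiv.Perm.mul_apply,
        mul_inv_cancel_left]
      refine h _ _ ih ?_
      rw [hsymm, ← hxf, hsymm x f]
      exact (sameCycle_inv.1 ⟨n, by simp⟩ : (φ f).SameCycle x _).cycleLength_eq.symm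
  rw [← card_filter_cycleLength (hf f) hγ, ← card_filter_cycleLength (hf z) hβ]
  apply Finset.card_le_card
  intro w hw
  simp only [Finset.mem_filter, Finset.mem_univ, true_and] at hw ⊢
  have hs : (φ f).SameCycle x w := by
    apply sameCycle_of_cycleLength_eq (hf f)
    · rwa [hsymm, hxf]
    · rw [hw, hsymm, hxf]
  obtain ⟨n, rfl⟩ := (sameCycle_inv.2 hs).exists_nat_pow_eq
  rw [hsymm, key]

end Quandle

theorem not_dvd_mul_mul_of_coprime {d k u v w : ℕ} (hd : 1 < d) (hu : d.Coprime u)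
    (hv : d.Coprime v) (hw : d.Coprime w) (hk : d ∣ k) : ¬ k ∣ u * v * w := fun h =>
  hd.ne' (Nat.Coprime.eq_one_of_dvd ((hu.mul_right hv).mul_right hw) (hk.trans h))

/-- In the setup, for every `y ∈ X′_{pqs}` there exist
`z ∈ X′_{prs}` and `f ∈ X′_{qrs}` such that `z ◃ f = y` or `f ◃ z = y`. -/
theorem stmt_9 (X : Type) [Fintype X] [DecidableEq X]
    (op : X → X → X)
    (φ : X → Equiv.Perm X)
    (hφ : ∀ x y : X, φ x y = op x y)
    (hsd : ∀ x y z : X, op x (op y z) = op (op x y) (op x z))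
    (hq : ∀ x : X, op x x = x)
    (hcr : ∀ x y : X, op y x = x → op x y = y)
    (hind : ∀ u v : X, ∃ g ∈ Subgroup.closure (Set.range φ), g u = v)
    (x : X) (p q r s : ℕ)
    (hp : 1 < p) (hq' : 1 < q) (hr : 1 < r) (hs : 0 < s)
    (hpq : Nat.Coprime p q) (hpr : Nat.Coprime p r) (hps : Nat.Coprime p s)
    (hqr : Nat.Coprime q r) (hqs : Nat.Coprime q s) (hrs : Nat.Coprime r s)
    (hcyc : (φ x).cycleType = {p * q * s, p * r * s, q * r * s}) :
    ∀ y ∈ fixedPts φ x (p * q * s) \ fixedPts φ x 1,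
      ∃ z ∈ fixedPts φ x (p * r * s) \ fixedPts φ x 1,
        ∃ f ∈ fixedPts φ x (q * r * s) \ fixedPts φ x 1,
          op z f = y ∨ op f z = y := by
  have hc (u v : X) : φ (φ u v) = φ u * φ v * (φ u)⁻¹ := by
    ext w
    have := hsd u v ((φ u)⁻¹ w)
    simp only [← hφ, ← Equiv.Perm.mul_apply, mul_inv_cancel, Equiv.Perm.one_apply] at this
    simpa only [← Equiv.Perm.mul_apply, mul_assoc] using this.symm
  have hq_φ : ∀ u, φ u u = u := fun u => (hφ u u).trans (hq u)
  have hcr_φ : ∀ u v, φ v u = u → φ u v = v := by simpa only [hφ] using hcr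
  simp only [← hφ]
  have hab : ¬ p * q * s ∣ p * r * s :=
    not_dvd_mul_mul_of_coprime hq' hpq.symm hqr hqs ⟨p * s, by ring⟩
  have hac : ¬ p * q * s ∣ q * r * s :=
    not_dvd_mul_mul_of_coprime hp hpq hpr hps ⟨q * s, by ring⟩
  have hba : ¬ p * r * s ∣ p * q * s :=
    not_dvd_mul_mul_of_coprime hr hpr.symm hqr.symm hrs ⟨p * s, by ring⟩
  have hbc : ¬ p * r * s ∣ q * r * s :=
    not_dvd_mul_mul_of_coprime hp hpq hpr hps ⟨r * s, by ring⟩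
  have hca : ¬ q * r * s ∣ p * q * s :=
    not_dvd_mul_mul_of_coprime hr hpr.symm hqr.symm hrs ⟨q * s, by ring⟩
  have hcb : ¬ q * r * s ∣ p * r * s :=
    not_dvd_mul_mul_of_coprime hq' hpq.symm hqr hqs ⟨r * s, by ring⟩
  have ha0 : p * q * s ≠ 0 := by positivity
  have hb0 : p * r * s ≠ 0 := by positivity
  have hc0 : q * r * s ≠ 0 := by positivity
  generalize p * q * s = a at *
  generalize p * r * s = b at *
  generalize q * r * s = c at *
  have hne_ab : a ≠ b := fun h => hab h.dvd
  have hne_ac : a ≠ c := fun h => hac h.dvd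
  have hne_bc : b ≠ c := fun h => hbc h.dvd
  have hct (u : X) : (φ u).cycleType = {a, b, c} := by
    obtain ⟨g, hg, rfl⟩ := hind x u
    rw [apply_eq_conj_of_mem_closure hc hg, Equiv.Perm.cycleType_conj, hcyc]
  have hnd (u : X) : (φ u).cycleType.Nodup := by
    rw [hct]; simp [hne_ab, hne_ac, hne_bc]
  have hsymm (u v : X) : (φ u).cycleLength v = (φ v).cycleLength u :=
    le_antisymm (cycleLength_le_swap hc hq_φ hcr_φ hind hnd u v)
      (cycleLength_le_swap hc hq_φ hcr_φ hind hnd v u)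
  have hval (v : X) : (φ x).cycleLength v = 0 ∨ (φ x).cycleLength v = a ∨
      (φ x).cycleLength v = b ∨ (φ x).cycleLength v = c := by
    by_cases h : φ x v = v
    · exact Or.inl (Equiv.Perm.cycleLength_eq_zero.2 h)
    · simpa [hcyc] using Or.inr (Equiv.Perm.cycleLength_mem_cycleType h)
  have hfixed (t : ℕ) (v : X) : v ∈ fixedPts φ x t \ fixedPts φ x 1 ↔
      (φ x).cycleLength v ≠ 0 ∧ (φ x).cycleLength v ∣ t := by
    have h1 : v ∈ fixedPts φ x 1 ↔ (φ x).cycleLength v = 0 := by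
      rw [Equiv.Perm.cycleLength_eq_zero]
      simp [fixedPts]
    have ht : v ∈ fixedPts φ x t ↔ _ := Equiv.Perm.pow_apply_eq_self_iff_cycleLength
    rw [Set.mem_sdiff, h1, ht]
    tauto
  intro y hy
  rw [hfixed] at hy
  have hya : (φ x).cycleLength y = a := by
    rcases hval y with h | h | h | h <;> rw [h] at hy
    · exact absurd rfl hy.1
    · exact h
    · exact absurd hy.2 hba
    · exact absurd hy.2 hca
  by_contra! H
  have hpow (n : ℕ) : φ x ^ n ∈ Subgroup.closure (Set.range φ) :=
    Subgroup.pow_mem _ (Subgroup.subset_closure (Set.mem_range_self x)) n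
  have hpowL (n : ℕ) (v : X) : (φ x).cycleLength ((φ x ^ n) v) = (φ x).cycleLength v :=
    (show (φ x).SameCycle v ((φ x ^ n) v) from ⟨n, by simp⟩).cycleLength_eq.symm
  have hreach (w : X) (hw : (φ x).cycleLength w = a) : ∃ n : ℕ, (φ x ^ n) w = y :=
    (Equiv.Perm.sameCycle_of_cycleLength_eq (hnd x) (hw ▸ ha0)
      (hw.trans hya.symm)).exists_nat_pow_eq
  have hno (z f : X) (hz : (φ x).cycleLength z = b) (hf : (φ x).cycleLength f = c) :
      (φ x).cycleLength (φ z f) ≠ a ∧ (φ x).cycleLength (φ f z) ≠ a := by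
    have hH (n : ℕ) := H ((φ x ^ n) z) ((hfixed _ _).2 (by rw [hpowL, hz]; exact ⟨hb0, dvd_rfl⟩))
      ((φ x ^ n) f) ((hfixed _ _).2 (by rw [hpowL, hf]; exact ⟨hc0, dvd_rfl⟩))
    constructor <;> intro h <;> obtain ⟨n, hn⟩ := hreach _ h <;>
      rw [apply_apply_of_mem_closure hc (hpow n)] at hn
    · exact (hH n).1 hn
    · exact (hH n).2 hn
  have hstab (z f : X) (t : ℕ) (hz : (φ x).cycleLength z ∣ t)
      (h : (φ x).cycleLength (φ z f) = 0 ∨ (φ x).cycleLength (φ z f) ∣ t) :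
      (φ x).cycleLength f = 0 ∨ (φ x).cycleLength f ∣ t := by
    rw [← Equiv.Perm.pow_apply_eq_self_iff_cycleLength] at h ⊢
    have hz' := Equiv.Perm.pow_apply_eq_self_iff_cycleLength.2 (Or.inr hz)
    rw [apply_apply_of_mem_closure hc (hpow t), hz'] at h
    exact (φ z).injective h
  have hxact (z f : X) (hz : (φ x).cycleLength z = b) (hf : (φ x).cycleLength f = c) :
      (φ x).cycleLength (φ z f) = c ∧ (φ x).cycleLength (φ f z) = b := by
    have h1 := hstab z f b hz.dvd
    have h2 := hstab f z c hf.dvd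
    rw [hf] at h1
    rw [hz] at h2
    have h3 := hno z f hz hf
    constructor
    · rcases hval (φ z f) with h | h | h | h
      · exact absurd (h1 (Or.inl h)) (by tauto)
      · exact absurd h h3.1
      · exact absurd (h1 (Or.inr h.dvd)) (by tauto)
      · exact h
    · rcases hval (φ f z) with h | h | h | h
      · exact absurd (h2 (Or.inl h)) (by tauto)
      · exact absurd h h3.2
      · exact h
      · exact absurd (h2 (Or.inr h.dvd)) (by tauto)
  have hact (u z f : X) (hz : (φ u).cycleLength z = b) (hf : (φ u).cycleLength f = c) :
      (φ u).cycleLength (φ z f) = c ∧ (φ u).cycleLength (φ f z) = b := by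
    obtain ⟨g, hg, hgu⟩ := hind u x
    have hL (v : X) : (φ u).cycleLength v = (φ x).cycleLength (g v) := by
      rw [← hgu, cycleLength_apply_apply hc hg]
    rw [hL] at hz hf
    rw [hL, hL, apply_apply_of_mem_closure hc hg, apply_apply_of_mem_closure hc hg]
    exact hxact _ _ hz hf
  have hbm (u : X) : b ∈ (φ u).cycleType := by simp [hct]
  have hcm (u : X) : c ∈ (φ u).cycleType := by simp [hct]
  obtain ⟨z, hz⟩ := Equiv.Perm.exists_cycleLength_eq (hbm x)
  obtain ⟨f, hf⟩ := Equiv.Perm.exists_cycleLength_eq (hcm x)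
  exact hne_bc (le_antisymm
    (le_of_forall_cycleLength_apply hc hsymm hnd (hbm z) (hcm f) hf hz
      fun u w h1 h2 => (hact u z w h2 h1).1)
    (le_of_forall_cycleLength_apply hc hsymm hnd (hcm f) (hbm z) hz hf
      fun u w h1 h2 => (hact u w f h1 h2).2))
end

section
/- In the setup below, for every y ∈ X′_{pqs} there exist z ∈ X′_{prs} and f ∈ X′_{qrs} such that y ◃ z ∈ X′_{qrs} and y ◃ f ∈ X′_{prs}. -/
open Equiv

/-- The points moved by `φ_x` and fixed by `φ_x^t`. -/
def movedPts {X : Type} (φ : X → Perm X) (x : X) (t : ℕ) : Set X :=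
  fixedPts φ x t \ fixedPts φ x 1

theorem mem_movedPts {X : Type} {φ : X → Perm X} {u v : X} {n : ℕ} :
    v ∈ movedPts φ u n ↔ (φ u ^ n) v = v ∧ φ u v ≠ v := by
  simp [movedPts, fixedPts]

theorem mem_fixedPts_of_apply_eq {X : Type} {φ : X → Perm X} {x u : X}
    (hu : φ x u = u) (n : ℕ) : u ∈ fixedPts φ x n :=
  Perm.pow_apply_eq_self_of_apply_eq_self hu n

theorem translation_mem_closure {X : Type} (φ : X → Perm X) (u : X) :
    φ u ∈ Subgroup.closure (Set.range φ) :=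
  Subgroup.subset_closure ⟨u, rfl⟩

theorem map_apply_of_mem_closure {X : Type} {φ : X → Perm X}
    (hconj : ∀ x y, φ (φ x y) = φ x * φ y * (φ x)⁻¹) {g : Perm X}
    (hg : g ∈ Subgroup.closure (Set.range φ)) (u : X) : φ (g u) = g * φ u * g⁻¹ := by
  induction hg using Subgroup.closure_induction generalizing u with
  | mem g hg => obtain ⟨x, rfl⟩ := hg; exact hconj x u
  | one => simp
  | mul g k _ _ hg hk => rw [Perm.mul_apply, hg, hk]; group
  | inv g _ hg =>
    have := hg (g⁻¹ u)
    rw [← Perm.mul_apply, mul_inv_cancel, Perm.one_apply] at this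
    rw [this]; group

/-- The left translations `φ` of an indecomposable crossed set, all of whose members have exactly
three nontrivial cycles, of lengths `a`, `b`, `c`, none of which divides another. -/
structure IsThreeCycleCrossedSet {X : Type} [Fintype X] [DecidableEq X]
    (φ : X → Perm X) (a b c : ℕ) : Prop where
  conj : ∀ x y, φ (φ x y) = φ x * φ y * (φ x)⁻¹
  idem : ∀ x, φ x x = x
  comm : ∀ x y, φ y x = x → φ x y = y
  trans : ∀ u v, ∃ g ∈ Subgroup.closure (Set.range φ), g u = v
  cycleType : ∀ u, (φ u).cycleType = {a, b, c}
  hab : ¬ a ∣ b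
  hac : ¬ a ∣ c
  hba : ¬ b ∣ a
  hbc : ¬ b ∣ c
  hca : ¬ c ∣ a
  hcb : ¬ c ∣ b

section Perm

variable {X : Type}

/-- If the cycle lengths of `σ` are distinct, then points on cycles of equal length lie on the
same cycle. -/
theorem sameCycle_of_nodup_cycleType [Fintype X] [DecidableEq X] {σ : Perm X}
    (h : σ.cycleType.Nodup) {v w : X}
    (hv : σ v ≠ v) (hw : σ w ≠ w)
    (hvw : (σ.cycleOf v).support.card = (σ.cycleOf w).support.card) : σ.SameCycle v w := by
  have hinj := Multiset.inj_on_of_nodup_map (Perm.cycleType_def σ ▸ h)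
  have heq : σ.cycleOf v = σ.cycleOf w :=
    hinj _ (Perm.cycleOf_mem_cycleFactorsFinset_iff.2 (Perm.mem_support.2 hv))
      _ (Perm.cycleOf_mem_cycleFactorsFinset_iff.2 (Perm.mem_support.2 hw)) hvw
  have hmem : w ∈ (σ.cycleOf w).support := by simpa using hw
  rw [← heq] at hmem
  exact (Perm.mem_support_cycleOf_iff.1 hmem).1

theorem card_support_cycleOf_mem_cycleType_s11 [Fintype X] [DecidableEq X] {σ : Perm X} {v : X}
    (hv : σ v ≠ v) :
    (σ.cycleOf v).support.card ∈ σ.cycleType := by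
  rw [Perm.cycleType_def]
  exact Multiset.mem_map.2 ⟨σ.cycleOf v,
    Perm.cycleOf_mem_cycleFactorsFinset_iff.2 (Perm.mem_support.2 hv), rfl⟩

theorem card_support_cycleOf_dvd_iff [Fintype X] [DecidableEq X] {σ : Perm X} {v : X}
    (hv : σ v ≠ v) {n : ℕ} :
    (σ.cycleOf v).support.card ∣ n ↔ (σ ^ n) v = v := by
  have hc : (σ.cycleOf v).IsCycle := Perm.isCycle_cycleOf σ hv
  rw [← hc.orderOf, orderOf_dvd_iff_pow_eq_one, hc.pow_eq_one_iff]
  constructor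
  · rintro ⟨w, hw, hw'⟩
    have := (hc.pow_eq_one_iff' (x := v) (n := n) (by simpa using hv)).1
      (hc.pow_eq_one_iff.2 ⟨w, hw, hw'⟩)
    simpa using this
  · intro h
    exact ⟨v, by simpa using hv, by simpa using h⟩

/-- Over a finite type, a set mapped into itself by `σ` is invariant under integer powers. -/
theorem zpow_apply_mem_of_mapsTo [Finite X] {σ : Perm X} {T : Set X}
    (h : ∀ t ∈ T, σ t ∈ T) (k : ℤ) {t : X}
    (ht : t ∈ T) : (σ ^ k) t ∈ T := by
  obtain ⟨m, hm⟩ : ∃ m : ℕ, σ ^ m = σ ^ k := by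
    have := (isOfFinOrder_of_finite σ).mem_powers_iff_mem_zpowers.2 ⟨k, rfl⟩
    simpa [Submonoid.mem_powers_iff] using this
  rw [← hm]
  clear hm
  induction m with
  | zero => simpa
  | succ m ih => rw [pow_succ']; exact h _ ih

theorem mem_of_apply_mem [Finite X] {σ : Perm X} {T : Set X} (h : ∀ t ∈ T, σ t ∈ T) {t : X}
    (ht : σ t ∈ T) : t ∈ T := by
  simpa using zpow_apply_mem_of_mapsTo h (-1) ht

end Perm

namespace IsThreeCycleCrossedSet

variable {X : Type} [Fintype X] [DecidableEq X] {φ : X → Perm X} {a b c : ℕ}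

theorem swap (h : IsThreeCycleCrossedSet φ a b c) : IsThreeCycleCrossedSet φ a c b where
  conj := h.conj
  idem := h.idem
  comm := h.comm
  trans := h.trans
  cycleType u := by
    rw [h.cycleType u]
    exact congrArg (a ::ₘ ·) (Multiset.pair_comm b c)
  hab := h.hac
  hac := h.hab
  hba := h.hca
  hbc := h.hcb
  hca := h.hba
  hcb := h.hbc

theorem apply_apply (h : IsThreeCycleCrossedSet φ a b c) {g : Perm X}
    (hg : g ∈ Subgroup.closure (Set.range φ)) (u v : X) : φ (g u) (g v) = g (φ u v) := by
  rw [map_apply_of_mem_closure h.conj hg]; simp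

theorem apply_mem_movedPts (h : IsThreeCycleCrossedSet φ a b c) {g : Perm X}
    (hg : g ∈ Subgroup.closure (Set.range φ)) {u v : X} {n : ℕ} :
    g v ∈ movedPts φ (g u) n ↔ v ∈ movedPts φ u n := by
  rw [mem_movedPts, mem_movedPts, map_apply_of_mem_closure h.conj hg, conj_pow]; simp

theorem nodup (h : IsThreeCycleCrossedSet φ a b c) (u : X) : (φ u).cycleType.Nodup := by
  have h1 : a ≠ b := fun e => h.hab (e ▸ dvd_rfl)
  have h2 : a ≠ c := fun e => h.hac (e ▸ dvd_rfl)
  have h3 : b ≠ c := fun e => h.hbc (e ▸ dvd_rfl)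
  rw [h.cycleType u]
  simp [h1, h2, h3]

theorem mem_movedPts_iff_card (h : IsThreeCycleCrossedSet φ a b c) {n : ℕ}
    (hn : n ∈ ({a, b, c} : Multiset ℕ)) {u v : X} (hv : φ u v ≠ v) :
    v ∈ movedPts φ u n ↔ ((φ u).cycleOf v).support.card = n := by
  have hm := card_support_cycleOf_mem_cycleType_s11 hv
  rw [mem_movedPts, ← card_support_cycleOf_dvd_iff hv]
  refine ⟨fun hd => ?_, fun e => ⟨e ▸ dvd_rfl, hv⟩⟩
  have hd := hd.1
  rw [h.cycleType u] at hm
  simp only [Multiset.insert_eq_cons, Multiset.mem_cons, Multiset.mem_singleton] at hn hm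
  obtain ⟨_, _, _, _, _, hab, hac, hba, hbc, hca, hcb⟩ := h
  rcases hn with rfl | rfl | rfl <;> rcases hm with hm | hm | hm <;> rw [hm] at hd ⊢ <;>
    contradiction

theorem exists_mem_movedPts (h : IsThreeCycleCrossedSet φ a b c) {u v : X} (hv : φ u v ≠ v) :
    ∃ n ∈ ({a, b, c} : Multiset ℕ), v ∈ movedPts φ u n := by
  have hm := card_support_cycleOf_mem_cycleType_s11 hv
  rw [h.cycleType u] at hm
  exact ⟨_, hm, (h.mem_movedPts_iff_card hm hv).2 rfl⟩

theorem cases_movedPts (h : IsThreeCycleCrossedSet φ a b c) (u v : X) :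
    φ u v = v ∨ v ∈ movedPts φ u a ∨ v ∈ movedPts φ u b ∨ v ∈ movedPts φ u c := by
  by_cases hv : φ u v = v
  · exact Or.inl hv
  · obtain ⟨n, hn, hvn⟩ := h.exists_mem_movedPts hv
    simp only [Multiset.insert_eq_cons, Multiset.mem_cons, Multiset.mem_singleton] at hn
    rcases hn with rfl | rfl | rfl <;> tauto

theorem eq_of_mem_movedPts (h : IsThreeCycleCrossedSet φ a b c) {m n : ℕ}
    (hm : m ∈ ({a, b, c} : Multiset ℕ)) (hn : n ∈ ({a, b, c} : Multiset ℕ)) {u v : X}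
    (hv : v ∈ movedPts φ u m) (hv' : v ∈ movedPts φ u n) : m = n := by
  have hne := (mem_movedPts.1 hv).2
  rw [← (h.mem_movedPts_iff_card hm hne).1 hv, ← (h.mem_movedPts_iff_card hn hne).1 hv']

theorem sameCycle (h : IsThreeCycleCrossedSet φ a b c) {n : ℕ}
    (hn : n ∈ ({a, b, c} : Multiset ℕ)) {u v w : X} (hv : v ∈ movedPts φ u n)
    (hw : w ∈ movedPts φ u n) : (φ u).SameCycle v w := by
  have hv' := (mem_movedPts.1 hv).2
  have hw' := (mem_movedPts.1 hw).2
  refine sameCycle_of_nodup_cycleType (h.nodup u) hv' hw' ?_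
  rw [(h.mem_movedPts_iff_card hn hv').1 hv, (h.mem_movedPts_iff_card hn hw').1 hw]

theorem movedPts_nonempty (h : IsThreeCycleCrossedSet φ a b c) {n : ℕ}
    (hn : n ∈ ({a, b, c} : Multiset ℕ)) (u : X) : (movedPts φ u n).Nonempty := by
  have hn' := hn
  rw [← h.cycleType u, Perm.cycleType_def] at hn'
  obtain ⟨σ, hσ, rfl⟩ := Multiset.mem_map.1 hn'
  obtain ⟨hσc, hσu⟩ := Perm.mem_cycleFactorsFinset_iff.1 hσ
  obtain ⟨v, hv⟩ := hσc.nonempty_support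
  have hv' : φ u v ≠ v := by
    rw [← hσu v hv]; exact Perm.mem_support.1 hv
  refine ⟨v, (h.mem_movedPts_iff_card hn hv').2 ?_⟩
  rw [← Perm.cycle_is_cycleOf hv hσ]; rfl

theorem ncard_movedPts (h : IsThreeCycleCrossedSet φ a b c) {n : ℕ}
    (hn : n ∈ ({a, b, c} : Multiset ℕ)) (u : X) : (movedPts φ u n).ncard = n := by
  obtain ⟨v, hv⟩ := h.movedPts_nonempty hn u
  have hv' := (mem_movedPts.1 hv).2
  have hset : movedPts φ u n = ((φ u).cycleOf v).support := by
    ext w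
    rw [Finset.mem_coe, Perm.mem_support_cycleOf_iff' hv']
    refine ⟨fun hw => h.sameCycle hn hv hw, ?_⟩
    rintro ⟨k, rfl⟩
    have hk : φ u ^ k ∈ Subgroup.closure (Set.range φ) :=
      Subgroup.zpow_mem _ (translation_mem_closure φ u) k
    have hu : (φ u ^ k) u = u := Perm.zpow_apply_eq_self_of_apply_eq_self (h.idem u) k
    have := (h.apply_mem_movedPts hk (u := u) (v := v) (n := n)).2 hv
    rwa [hu] at this
  rw [hset, Set.ncard_coe_finset, (h.mem_movedPts_iff_card hn hv').1 hv]

theorem exists_map_pair (h : IsThreeCycleCrossedSet φ a b c) {n : ℕ}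
    (hn : n ∈ ({a, b, c} : Multiset ℕ)) {u v u' v' : X} (hv : v ∈ movedPts φ u n)
    (hv' : v' ∈ movedPts φ u' n) :
    ∃ g ∈ Subgroup.closure (Set.range φ), g u = u' ∧ g v = v' := by
  obtain ⟨g, hg, rfl⟩ := h.trans u u'
  obtain ⟨k, hk⟩ := h.sameCycle hn ((h.apply_mem_movedPts hg).2 hv) hv'
  refine ⟨φ (g u) ^ k * g, mul_mem (Subgroup.zpow_mem _ (translation_mem_closure φ _) k) hg, ?_, hk⟩
  rw [Perm.mul_apply]
  exact Perm.zpow_apply_eq_self_of_apply_eq_self (h.idem _) k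

/-- The relation "`v` lies on the `n`-cycle of `φ_u`" is symmetric. -/
theorem movedPts_symm (h : IsThreeCycleCrossedSet φ a b c) {n : ℕ}
    (hn : n ∈ ({a, b, c} : Multiset ℕ)) {u v : X} (hv : v ∈ movedPts φ u n) :
    u ∈ movedPts φ v n := by
  classical
  have hne : φ v u ≠ u := fun e => (mem_movedPts.1 hv).2 (h.comm u v e)
  obtain ⟨m, hm, hu⟩ := h.exists_mem_movedPts hne
  have hiff : ∀ u' v', v' ∈ movedPts φ u' n ↔ u' ∈ movedPts φ v' m := by
    intro u' v'
    constructor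
    · intro hv'
      obtain ⟨g, hg, rfl, rfl⟩ := h.exists_map_pair hn hv hv'
      exact (h.apply_mem_movedPts hg).2 hu
    · intro hu'
      obtain ⟨g, hg, rfl, rfl⟩ := h.exists_map_pair hm hu hu'
      exact (h.apply_mem_movedPts hg).2 hv
  have hcount := Finset.sum_card_bipartiteAbove_eq_sum_card_bipartiteBelow
    (s := (Finset.univ : Finset X)) (t := (Finset.univ : Finset X))
    (fun u' v' => v' ∈ movedPts φ u' n)
  have hcard : ∀ k ∈ ({a, b, c} : Multiset ℕ), ∀ w,
      (Finset.univ.filter (fun z => z ∈ movedPts φ w k)).card = k := by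
    intro k hk w
    rw [← Set.ncard_coe_finset]
    simpa using h.ncard_movedPts hk w
  have hbelow : ∀ v', (Finset.univ.filter (fun u' => v' ∈ movedPts φ u' n)).card = m := by
    intro v'
    simp only [hiff]
    exact hcard m hm v'
  simp only [Finset.bipartiteAbove, Finset.bipartiteBelow, hcard n hn, hbelow,
    Finset.sum_const, smul_eq_mul] at hcount
  have hpos : 0 < (Finset.univ : Finset X).card := Finset.card_pos.2 ⟨u, Finset.mem_univ u⟩
  rw [Nat.eq_of_mul_eq_mul_left hpos hcount]
  exact hu

theorem apply_mem_fixedPts_iff (h : IsThreeCycleCrossedSet φ a b c) {n : ℕ} {x u v : X}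
    (hu : u ∈ fixedPts φ x n) : φ u v ∈ fixedPts φ x n ↔ v ∈ fixedPts φ x n := by
  have hg : φ x ^ n ∈ Subgroup.closure (Set.range φ) :=
    Subgroup.pow_mem _ (translation_mem_closure φ x) n
  have he := h.apply_apply hg u v
  simp only [fixedPts, Set.mem_ofPred_eq] at hu ⊢
  rw [← he, hu, (φ u).injective.eq_iff]

theorem apply_mem_movedPts_of_fixed (h : IsThreeCycleCrossedSet φ a b c) {n : ℕ} {x u v : X}
    (hu : φ x u = u) (hv : v ∈ movedPts φ x n) : φ u v ∈ movedPts φ x n :=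
  ⟨(h.apply_mem_fixedPts_iff (mem_fixedPts_of_apply_eq hu n)).2 hv.1, fun h1 =>
    hv.2 ((h.apply_mem_fixedPts_iff (mem_fixedPts_of_apply_eq hu 1)).1 h1)⟩

theorem not_mem_fixedPts (h : IsThreeCycleCrossedSet φ a b c) {m n : ℕ}
    (hm : m ∈ ({a, b, c} : Multiset ℕ)) (hn : n ∈ ({a, b, c} : Multiset ℕ)) (hmn : m ≠ n)
    {u v : X} (hv : v ∈ movedPts φ u m) : v ∉ fixedPts φ u n := fun hv' =>
  hmn (h.eq_of_mem_movedPts hm hn hv ⟨hv', hv.2⟩)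

/-- A nonempty set preserved by all translations outside it generates an indecomposable rack. -/
theorem eq_univ_of_generates (h : IsThreeCycleCrossedSet φ a b c) {B T : Set X}
    (hB : B.Nonempty) (hout : ∀ u ∉ B, ∀ v ∈ B, φ u v ∈ B) (hBT : B ⊆ T)
    (hT : ∀ u ∈ B, ∀ v ∈ T, φ u v ∈ T) : T = Set.univ := by
  let S : Set X := ⋂₀ {U | B ⊆ U ∧ ∀ u ∈ B, ∀ v ∈ U, φ u v ∈ U}
  have hBS : B ⊆ S := fun v hv U hU => hU.1 hv
  have hinS : ∀ u ∈ B, ∀ v ∈ S, φ u v ∈ S := fun u hu v hv U hU => hU.2 u hu v (hv U hU)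
  have hS : ∀ u, ∀ v ∈ S, φ u v ∈ S := by
    intro u v hv
    by_cases hu : u ∈ B
    · exact hinS u hu v hv
    · refine hv {w | φ u w ∈ S} ⟨fun w hw => hBS (hout u hu w hw), fun w hw z hz => ?_⟩
      have := h.apply_apply (translation_mem_closure φ u) w z
      rw [Set.mem_ofPred_eq, ← this]
      exact hinS _ (hout u hu w hw) _ hz
  have hclosed : ∀ g ∈ Subgroup.closure (Set.range φ), ∀ v ∈ S, g v ∈ S := by
    intro g hg
    induction hg using Subgroup.closure_induction with
    | mem g hg => obtain ⟨u, rfl⟩ := hg; exact hS u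
    | one => exact fun v hv => hv
    | mul g k _ _ hg hk => exact fun v hv => hg _ (hk v hv)
    | inv g _ hg =>
      intro v hv
      simpa using zpow_apply_mem_of_mapsTo hg (-1) hv
  obtain ⟨w, hw⟩ := hB
  refine Set.eq_univ_of_forall fun v => ?_
  obtain ⟨g, hg, rfl⟩ := h.trans w v
  exact hclosed g hg w (hBS hw) T ⟨hBT, hT⟩

/-- If the translations by points of the `a`-cycle of `φ_x` preserve its `b`-cycle, then some
translation by a point of the `c`-cycle carries a point of the `b`-cycle to the `a`-cycle. -/
theorem exists_apply_mem_movedPts (h : IsThreeCycleCrossedSet φ a b c) (x : X)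
    (hpres : ∀ y ∈ movedPts φ x a, ∀ z ∈ movedPts φ x b, φ y z ∈ movedPts φ x b) :
    ∃ u ∈ movedPts φ x c, ∃ z ∈ movedPts φ x b, φ u z ∈ movedPts φ x a := by
  have ha : a ∈ ({a, b, c} : Multiset ℕ) := by simp
  have hb : b ∈ ({a, b, c} : Multiset ℕ) := by simp
  have hc : c ∈ ({a, b, c} : Multiset ℕ) := by simp
  have hab : a ≠ b := fun e => h.hab (e ▸ dvd_rfl)
  have hbc : b ≠ c := fun e => h.hbc (e ▸ dvd_rfl)
  by_contra! hno
  have huniv : fixedPts φ x b = Set.univ := by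
    refine h.eq_univ_of_generates (h.movedPts_nonempty hb x) (fun u hu z hz => ?_)
      Set.sdiff_subset (fun u hu v hv => (h.apply_mem_fixedPts_iff hu.1).2 hv)
    rcases h.cases_movedPts x u with hu' | hu' | hu' | hu'
    · exact h.apply_mem_movedPts_of_fixed hu' hz
    · exact hpres u hu' z hz
    · exact absurd hu' hu
    · have hnot : φ u z ∉ fixedPts φ x c := fun hmem =>
        h.not_mem_fixedPts hb hc hbc hz ((h.apply_mem_fixedPts_iff hu'.1).1 hmem)
      rcases h.cases_movedPts x (φ u z) with hw | hw | hw | hw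
      · exact absurd (mem_fixedPts_of_apply_eq hw c) hnot
      · exact absurd hw (hno u hu' z hz)
      · exact hw
      · exact absurd hw.1 hnot
  obtain ⟨y, hy⟩ := h.movedPts_nonempty ha x
  exact h.not_mem_fixedPts ha hb hab hy (huniv ▸ Set.mem_univ y)

/-- If the translation by `y` preserves the `b`-cycle, it preserves the `c`-cycle. -/
theorem preserves_swap (h : IsThreeCycleCrossedSet φ a b c) {x y : X} (hy : y ∈ movedPts φ x a)
    (hpres : ∀ z ∈ movedPts φ x b, φ y z ∈ movedPts φ x b) :
    ∀ z ∈ movedPts φ x c, φ y z ∈ movedPts φ x c := by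
  have ha : a ∈ ({a, b, c} : Multiset ℕ) := by simp
  have hb : b ∈ ({a, b, c} : Multiset ℕ) := by simp
  have hc : c ∈ ({a, b, c} : Multiset ℕ) := by simp
  have hca : c ≠ a := fun e => h.hca (e ▸ dvd_rfl)
  have hbc : b ≠ c := fun e => h.hbc (e ▸ dvd_rfl)
  intro z hz
  have hnot : φ y z ∉ fixedPts φ x a := fun hmem =>
    h.not_mem_fixedPts hc ha hca hz ((h.apply_mem_fixedPts_iff hy.1).1 hmem)
  rcases h.cases_movedPts x (φ y z) with hw | hw | hw | hw
  · exact absurd (mem_fixedPts_of_apply_eq hw a) hnot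
  · exact absurd hw.1 hnot
  · exact absurd (h.eq_of_mem_movedPts hb hc (mem_of_apply_mem hpres hw) hz) hbc
  · exact hw

theorem movedPts_eq_of_not_fixed (h : IsThreeCycleCrossedSet φ a b c)
    (hpres : ∀ u, ∀ v ∈ movedPts φ u a, ∀ z ∈ movedPts φ u b, φ v z ∈ movedPts φ u b)
    {u v z : X} (hv : v ∈ movedPts φ u a) (hz : z ∈ movedPts φ u b) (hne : φ v z ≠ z) :
    movedPts φ v b = movedPts φ u b := by
  have ha : a ∈ ({a, b, c} : Multiset ℕ) := by simp
  have hb : b ∈ ({a, b, c} : Multiset ℕ) := by simp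
  have hc : c ∈ ({a, b, c} : Multiset ℕ) := by simp
  have hbc : b ≠ c := fun e => h.hbc (e ▸ dvd_rfl)
  have huv := h.movedPts_symm ha hv
  have hsub : ∀ m ∈ ({a, b, c} : Multiset ℕ), z ∈ movedPts φ v m →
      movedPts φ v m ⊆ movedPts φ u b := by
    intro m hm hzm w hw
    obtain ⟨k, rfl⟩ := h.sameCycle hm hzm hw
    exact zpow_apply_mem_of_mapsTo (hpres u v hv) k hz
  rcases h.cases_movedPts v z with hz' | hz' | hz' | hz'
  · exact absurd hz' hne
  · exact absurd (h.idem u) (mem_movedPts.1 (hsub a ha hz' huv)).2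
  · refine Set.eq_of_subset_of_ncard_le (hsub b hb hz') ?_ (Set.toFinite _)
    rw [h.ncard_movedPts hb, h.ncard_movedPts hb]
  · have hsub' : movedPts φ u b ⊆ movedPts φ v c := by
      intro w hw
      obtain ⟨k, rfl⟩ := h.sameCycle hb hz hw
      exact zpow_apply_mem_of_mapsTo (h.preserves_swap huv (hpres v u huv)) k hz'
    have heq := congrArg Set.ncard (hsub'.antisymm (hsub c hc hz'))
    rw [h.ncard_movedPts hb, h.ncard_movedPts hc] at heq
    exact absurd heq hbc

theorem exists_apply_not_mem (h : IsThreeCycleCrossedSet φ a b c) {x y : X}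
    (hy : y ∈ movedPts φ x a) : ∃ z ∈ movedPts φ x b, φ y z ∉ movedPts φ x b := by
  have ha : a ∈ ({a, b, c} : Multiset ℕ) := by simp
  have hb : b ∈ ({a, b, c} : Multiset ℕ) := by simp
  have hc : c ∈ ({a, b, c} : Multiset ℕ) := by simp
  have hac : a ≠ c := fun e => h.hac (e ▸ dvd_rfl)
  have hbc : b ≠ c := fun e => h.hbc (e ▸ dvd_rfl)
  by_contra! hcon
  have hpres : ∀ u, ∀ v ∈ movedPts φ u a, ∀ z ∈ movedPts φ u b, φ v z ∈ movedPts φ u b := by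
    intro u v hv z hz
    obtain ⟨g, hg, rfl, rfl⟩ := h.exists_map_pair ha hy hv
    obtain ⟨z, rfl⟩ := g.surjective z
    rw [h.apply_apply hg]
    rw [h.apply_mem_movedPts hg] at hz ⊢
    exact hcon z hz
  obtain ⟨u, hu, z, hz, hw⟩ := h.exists_apply_mem_movedPts x (hpres x)
  have hne : movedPts φ (φ u z) b ≠ movedPts φ x b := by
    intro heq
    have hmem : φ u x ∈ movedPts φ (φ u z) b :=
      (h.apply_mem_movedPts (translation_mem_closure φ u)).2 (h.movedPts_symm hb hz)
    rw [heq] at hmem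
    exact h.not_mem_fixedPts hb hc hbc hmem
      ((h.apply_mem_fixedPts_iff hu.1).2 (mem_fixedPts_of_apply_eq (h.idem x) c))
  have hfix : ∀ v ∈ movedPts φ x a, ∀ t ∈ movedPts φ x b, φ v t = t := by
    intro v hv t ht
    obtain ⟨g, hg, hgx, rfl⟩ := h.exists_map_pair ha hw hv
    obtain ⟨t, rfl⟩ := g.surjective t
    rw [h.apply_apply hg]
    congr 1
    by_contra hnt
    refine hne (h.movedPts_eq_of_not_fixed hpres hw (z := t) ?_ hnt)
    rw [← h.apply_mem_movedPts hg, hgx]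
    exact ht
  obtain ⟨u', hu', z', hz', hw'⟩ := h.swap.exists_apply_mem_movedPts x
    (fun v hv => h.preserves_swap hv (hpres x v hv))
  have hcomm := h.comm _ _ (hfix _ hw' u' hu')
  have heq := (φ u').injective hcomm
  rw [heq] at hw'
  exact hac (h.eq_of_mem_movedPts ha hc hw' hz')

theorem exists_apply_mem (h : IsThreeCycleCrossedSet φ a b c) {x y : X}
    (hy : y ∈ movedPts φ x a) : ∃ z ∈ movedPts φ x b, φ y z ∈ movedPts φ x c := by
  have ha : a ∈ ({a, b, c} : Multiset ℕ) := by simp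
  have hb : b ∈ ({a, b, c} : Multiset ℕ) := by simp
  have hba : b ≠ a := fun e => h.hba (e ▸ dvd_rfl)
  obtain ⟨z, hz, hw⟩ := h.exists_apply_not_mem hy
  have hnot : φ y z ∉ fixedPts φ x a := fun hmem =>
    h.not_mem_fixedPts hb ha hba hz ((h.apply_mem_fixedPts_iff hy.1).1 hmem)
  refine ⟨z, hz, ?_⟩
  rcases h.cases_movedPts x (φ y z) with hw' | hw' | hw' | hw'
  · exact absurd (mem_fixedPts_of_apply_eq hw' a) hnot
  · exact absurd hw'.1 hnot
  · exact absurd hw' hw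
  · exact hw'

end IsThreeCycleCrossedSet

theorem not_mul_dvd_of_coprime {p q r s : ℕ} (hr : 1 < r) (hs : 0 < s) (hpr : Nat.Coprime p r)
    (hqr : Nat.Coprime q r) {m : ℕ} (hm : r * s ∣ m) : ¬ m ∣ p * q * s := by
  intro hd
  have h1 : r ∣ p * q := Nat.dvd_of_mul_dvd_mul_right hs (hm.trans hd)
  have h2 := Nat.Coprime.eq_one_of_dvd (Nat.Coprime.mul_right hpr.symm hqr.symm) h1
  omega

/-- In the setup, for every `y ∈ X′_{pqs}` there exist
`z ∈ X′_{prs}` and `f ∈ X′_{qrs}` with `y ◃ z ∈ X′_{qrs}` and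
`y ◃ f ∈ X′_{prs}`. -/
theorem stmt_11 (X : Type) [Fintype X] [DecidableEq X]
    (op : X → X → X)
    (φ : X → Equiv.Perm X)
    (hφ : ∀ x y : X, φ x y = op x y)
    (hsd : ∀ x y z : X, op x (op y z) = op (op x y) (op x z))
    (hq : ∀ x : X, op x x = x)
    (hcr : ∀ x y : X, op y x = x → op x y = y)
    (hind : ∀ u v : X, ∃ g ∈ Subgroup.closure (Set.range φ), g u = v)
    (x : X) (p q r s : ℕ)
    (hp : 1 < p) (hq' : 1 < q) (hr : 1 < r) (hs : 0 < s)
    (hpq : Nat.Coprime p q) (hpr : Nat.Coprime p r) (hps : Nat.Coprime p s)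
    (hqr : Nat.Coprime q r) (hqs : Nat.Coprime q s) (hrs : Nat.Coprime r s)
    (hcyc : (φ x).cycleType = {p * q * s, p * r * s, q * r * s}) :
    ∀ y ∈ fixedPts φ x (p * q * s) \ fixedPts φ x 1,
      ∃ z ∈ fixedPts φ x (p * r * s) \ fixedPts φ x 1,
        ∃ f ∈ fixedPts φ x (q * r * s) \ fixedPts φ x 1,
          op y z ∈ fixedPts φ x (q * r * s) \ fixedPts φ x 1 ∧
          op y f ∈ fixedPts φ x (p * r * s) \ fixedPts φ x 1 := by
  have hconj : ∀ x y, φ (φ x y) = φ x * φ y * (φ x)⁻¹ := by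
    intro x y
    rw [eq_mul_inv_iff_mul_eq]
    ext z
    simp only [Equiv.Perm.mul_apply, hφ, hsd x y z]
  have h : IsThreeCycleCrossedSet φ (p * q * s) (p * r * s) (q * r * s) :=
    { conj := hconj
      idem := fun u => (hφ u u).trans (hq u)
      comm := fun u v huv => (hφ u v).trans (hcr u v ((hφ v u).symm.trans huv))
      trans := hind
      cycleType := fun u => by
        obtain ⟨g, hg, rfl⟩ := hind x u
        rw [map_apply_of_mem_closure hconj hg, Equiv.Perm.cycleType_conj, hcyc]
      hab := not_mul_dvd_of_coprime hq' hs hpq hqr.symm ⟨p, by ring⟩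
      hac := not_mul_dvd_of_coprime hp hs hpq.symm hpr.symm ⟨q, by ring⟩
      hba := not_mul_dvd_of_coprime hr hs hpr hqr ⟨p, by ring⟩
      hbc := not_mul_dvd_of_coprime hp hs hpq.symm hpr.symm ⟨r, by ring⟩
      hca := not_mul_dvd_of_coprime hr hs hpr hqr ⟨q, by ring⟩
      hcb := not_mul_dvd_of_coprime hq' hs hpq hqr.symm ⟨r, by ring⟩ }
  intro y hy
  obtain ⟨z, hz, hyz⟩ := h.exists_apply_mem hy
  obtain ⟨f, hf, hyf⟩ := h.swap.exists_apply_mem hy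
  rw [hφ] at hyz hyf
  exact ⟨z, hz, f, hf, hyz, hyf⟩
end

section
/- In the setup below, for every y ∈ X′_{pqs} one has y ◃ x ∈ X′_{pqs}. -/
namespace Equiv.Perm

variable {X : Type*} [Fintype X] [DecidableEq X]

theorem pow_apply_eq_self_iff_card_dvd {σ : Perm X} {v : X} (hv : σ v ≠ v) (n : ℕ) :
    (σ ^ n) v = v ↔ (σ.cycleOf v).support.card ∣ n := by
  have hc := isCycle_cycleOf σ hv
  rw [← hc.orderOf, orderOf_dvd_iff_pow_eq_one,
    hc.pow_eq_one_iff' (x := v) (by rwa [cycleOf_apply_self]), cycleOf_pow_apply_self]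

theorem zpow_apply_eq_self_iff_card_dvd {σ : Perm X} {v : X} (hv : σ v ≠ v) (n : ℤ) :
    (σ ^ n) v = v ↔ ((σ.cycleOf v).support.card : ℤ) ∣ n := by
  rw [← Int.dvd_natAbs, Int.natCast_dvd_natCast, ← pow_apply_eq_self_iff_card_dvd hv]
  obtain ⟨m, rfl | rfl⟩ := n.eq_nat_or_neg
  · simp
  · rw [zpow_neg, inv_eq_iff_eq]; simp [eq_comm]

theorem card_support_cycleOf_mem_cycleType_s12 {σ : Perm X} {v : X} (hv : σ v ≠ v) :
    (σ.cycleOf v).support.card ∈ σ.cycleType := by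
  rw [cycleType_def]
  exact Multiset.mem_map_of_mem _ (cycleOf_mem_cycleFactorsFinset_iff.2 (mem_support.2 hv))

/-- If all nontrivial cycles have distinct lengths, the length determines the cycle. -/
theorem sameCycle_of_card_eq {σ : Perm X} (hσ : σ.cycleType.Nodup) {u v : X}
    (hu : σ u ≠ u) (hv : σ v ≠ v)
    (h : (σ.cycleOf u).support.card = (σ.cycleOf v).support.card) : σ.SameCycle u v := by
  rw [cycleType_def] at hσ
  rw [sameCycle_iff_cycleOf_eq_of_mem_support (mem_support.2 hu) (mem_support.2 hv)]
  exact Multiset.inj_on_of_nodup_map hσ _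
    (cycleOf_mem_cycleFactorsFinset_iff.2 (mem_support.2 hu)) _
    (cycleOf_mem_cycleFactorsFinset_iff.2 (mem_support.2 hv)) h

theorem card_eq_of_zpow_iff {σ τ : Perm X} {u v : X} (hu : σ u ≠ u) (hv : τ v ≠ v)
    (h : ∀ n : ℤ, (σ ^ n) u = u ↔ (τ ^ n) v = v) :
    (σ.cycleOf u).support.card = (τ.cycleOf v).support.card := by
  simp only [zpow_apply_eq_self_iff_card_dvd hu, zpow_apply_eq_self_iff_card_dvd hv] at h
  exact Nat.dvd_antisymm (Int.natCast_dvd_natCast.1 ((h _).2 dvd_rfl))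
    (Int.natCast_dvd_natCast.1 ((h _).1 dvd_rfl))

theorem apply_comm_of_commute {Y : Type*} {σ τ : Perm Y} (h : Commute σ τ) (v : Y) :
    σ (τ v) = τ (σ v) :=
  congrArg (fun ρ : Perm Y => ρ v) h.eq

theorem sameCycle_apply_of_commute {σ τ : Perm X} (hσ : σ.cycleType.Nodup) (h : Commute σ τ)
    {v : X} (hv : σ v ≠ v) : σ.SameCycle v (τ v) := by
  have hv' : σ (τ v) ≠ τ v := by
    rw [apply_comm_of_commute h]
    exact fun e => hv (τ.injective e)
  refine sameCycle_of_card_eq hσ hv hv' (card_eq_of_zpow_iff hv hv' fun n => ?_)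
  rw [apply_comm_of_commute (h.zpow_left n), τ.injective.eq_iff]

theorem zpow_apply_of_zpow_apply_eq {Y : Type*} {σ τ : Perm Y} (h : Commute σ τ) {v : Y} {i : ℤ}
    (hi : (σ ^ i) v = τ v) (n : ℤ) : (τ ^ n) v = (σ ^ (i * n)) v := by
  have h1 : ((σ ^ i)⁻¹ * τ) v = v := by
    rw [mul_apply, ← hi]; simp
  have h2 := zpow_apply_eq_self_of_apply_eq_self h1 n
  rwa [((h.zpow_left i).inv_left).mul_zpow, inv_zpow, ← zpow_mul, mul_apply, inv_eq_iff_eq] at h2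

theorem zpow_eq_self_of_commute {σ τ : Perm X} (hσ : σ.cycleType.Nodup) (h : Commute σ τ)
    {v : X} (hv : σ v ≠ v) (n : ℤ) (hn : (σ ^ n) v = v) : (τ ^ n) v = v := by
  obtain ⟨i, hi⟩ := sameCycle_apply_of_commute hσ h hv
  rw [zpow_apply_of_zpow_apply_eq h hi, mul_comm, zpow_mul]
  exact zpow_apply_eq_self_of_apply_eq_self hn i

theorem zpow_eq_self_iff_of_commute {σ τ : Perm X} (hσ : σ.cycleType.Nodup)
    (hτ : τ.cycleType.Nodup) (h : Commute σ τ) {v : X} (hv : σ v ≠ v) (hv' : τ v ≠ v) (n : ℤ) :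
    (σ ^ n) v = v ↔ (τ ^ n) v = v :=
  ⟨zpow_eq_self_of_commute hσ h hv n, zpow_eq_self_of_commute hτ h.symm hv' n⟩

theorem conj_zpow_apply {Y : Type*} (f ψ : Perm Y) (n : ℤ) (v : Y) :
    ((ψ * f * ψ⁻¹) ^ n) (ψ v) = ψ ((f ^ n) v) := by
  simp [conj_zpow]

theorem zpow_apply_iff_of_commute_conj {f ψ : Perm X} (hf : f.cycleType.Nodup)
    (hc : Commute f (ψ * f * ψ⁻¹)) {y : X} (hy : ψ y = y) (hfy : f y ≠ y) {N : ℕ}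
    (hN : Commute ψ (f ^ N)) (hcyc : ∀ v, f v ≠ v → (f ^ N) v = v → f.SameCycle y v)
    {v : X} (hv : f v ≠ v) :
    f (ψ v) ≠ ψ v ∧ ∀ n : ℤ, (f ^ n) (ψ v) = ψ v ↔ (f ^ n) v = v := by
  have hh : (ψ * f * ψ⁻¹) (ψ v) ≠ ψ v := by
    simpa using hv
  have h1 : f (ψ v) ≠ ψ v := by
    by_cases hvN : (f ^ N) v = v
    · obtain ⟨i, rfl⟩ := hcyc v hv hvN
      rw [← conj_zpow_apply, hy, apply_comm_of_commute (hc.zpow_right i)]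
      exact fun e => hfy (Equiv.injective _ e)
    · intro e
      refine hvN (ψ.injective ?_)
      rw [apply_comm_of_commute hN]
      exact pow_apply_eq_self_of_apply_eq_self e N
  refine ⟨h1, fun n => ?_⟩
  rw [zpow_eq_self_iff_of_commute hf (by rwa [cycleType_conj]) hc h1 hh, conj_zpow_apply,
    ψ.injective.eq_iff]

theorem card_eq_or_of_cycleType {σ : Perm X} {a b c : ℕ} (h : σ.cycleType = {a, b, c}) {v : X}
    (hv : σ v ≠ v) : (σ.cycleOf v).support.card = a ∨ (σ.cycleOf v).support.card = b ∨
      (σ.cycleOf v).support.card = c := by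
  simpa [h] using card_support_cycleOf_mem_cycleType_s12 hv

theorem not_dvd_of_coprime_factor {r k m : ℕ} (hr : 1 < r) (hrk : r ∣ k) (h : Nat.Coprime r m) :
    ¬ k ∣ m := fun hk => by
  have := Nat.eq_one_of_dvd_coprimes h dvd_rfl (hrk.trans hk)
  omega

theorem pow_apply_eq_self_of_commute_conj {f ψ : Perm X} {p q r s : ℕ}
    (hp : 1 < p) (hr : 1 < r)
    (hpq : Nat.Coprime p q) (hpr : Nat.Coprime p r) (hps : Nat.Coprime p s)
    (hqr : Nat.Coprime q r) (hrs : Nat.Coprime r s)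
    (hf : f.cycleType = {p * q * s, p * r * s, q * r * s}) (hψ : ψ.cycleType = f.cycleType)
    (hnd : f.cycleType.Nodup)
    (hc : Commute f (ψ * f * ψ⁻¹)) (hN : Commute ψ (f ^ (p * q * s)))
    (hψf : ∀ v, f v ≠ v → f (ψ v) ≠ ψ v ∧ ∀ n : ℤ, (f ^ n) (ψ v) = ψ v ↔ (f ^ n) v = v)
    {b : X} (hb : f b ≠ b) (hbq : (f ^ (q * r * s)) b = b) : (ψ ^ (q * r * s)) b = b := by
  have hrpqs : Nat.Coprime r (p * q * s) :=
    Nat.Coprime.mul_right (Nat.Coprime.mul_right hpr.symm hqr.symm) hrs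
  have hpqrs : Nat.Coprime p (q * r * s) :=
    Nat.Coprime.mul_right (Nat.Coprime.mul_right hpq hpr) hps
  have len : ∀ v, f v ≠ v → (f ^ (q * r * s)) v = v →
      (f.cycleOf v).support.card = q * r * s := by
    intro v hv hvq
    rw [pow_apply_eq_self_iff_card_dvd hv] at hvq
    rcases card_eq_or_of_cycleType hf hv with h | h | h
    · rw [h] at hvq
      exact absurd hvq (not_dvd_of_coprime_factor hp ⟨q * s, by ring⟩ hpqrs)
    · rw [h] at hvq
      exact absurd hvq (not_dvd_of_coprime_factor hp ⟨r * s, by ring⟩ hpqrs)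
    · exact h
  -- `f ^ (p * q * s)` preserves every nontrivial cycle of `ψ`
  have hinv : ∀ v, ψ v ≠ v → ∃ i : ℤ, (ψ ^ i) v = (f ^ (p * q * s)) v := fun v hv =>
    sameCycle_apply_of_commute (hψ ▸ hnd) hN hv
  have hB : ∀ v, f v ≠ v → (f ^ (q * r * s)) v = v → f (ψ v) ≠ ψ v ∧
      (f ^ (q * r * s)) (ψ v) = ψ v := fun v hv hvq =>
    ⟨(hψf v hv).1, by exact_mod_cast ((hψf v hv).2 (q * r * s : ℕ)).2 (by exact_mod_cast hvq)⟩
  have hsame : ∀ u v, f u ≠ u → (f ^ (q * r * s)) u = u → f v ≠ v →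
      (f ^ (q * r * s)) v = v → f.SameCycle u v := fun u v hu huq hv hvq =>
    sameCycle_of_card_eq hnd hu hv ((len u hu huq).trans (len v hv hvq).symm)
  by_cases hfix : ∃ b₀, f b₀ ≠ b₀ ∧ (f ^ (q * r * s)) b₀ = b₀ ∧ ψ b₀ = b₀
  · -- a fixed point forces `ψ` to be trivial on this cycle of `f`
    obtain ⟨b₀, h0, h0q, h0ψ⟩ := hfix
    refine pow_apply_eq_self_of_apply_eq_self ?_ _
    obtain ⟨j, rfl⟩ := hsame b₀ b h0 h0q hb hbq
    have hh0 : ∃ a : ℤ, (f ^ a) b₀ = (ψ * f * ψ⁻¹) b₀ := sameCycle_apply_of_commute hnd hc h0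
    obtain ⟨a, ha⟩ := hh0
    have hstep : ∀ k : ℤ, ψ ((f ^ (r * k)) b₀) = (f ^ (r * (a * k))) b₀ := by
      intro k
      rw [← conj_zpow_apply, h0ψ, zpow_apply_of_zpow_apply_eq hc ha, mul_left_comm]
    have hiter : ∀ (n : ℕ) (k : ℤ), ∃ k' : ℤ, (ψ ^ n) ((f ^ (r * k)) b₀) = (f ^ (r * k')) b₀ := by
      intro n
      induction n with
      | zero => exact fun k => ⟨k, by simp⟩
      | succ n ih => exact fun k => by rw [pow_succ, mul_apply, hstep]; exact ih _
    obtain ⟨i, k, hik⟩ : ∃ i k : ℤ, j = (p * q * s : ℕ) * i + r * k := by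
      obtain ⟨u, w, huw⟩ := Nat.isCoprime_iff_coprime.2 hrpqs.symm
      exact ⟨j * u, j * w, by linear_combination (-j) * huw⟩
    have hbc : (f ^ j) b₀ = ((f ^ (p * q * s)) ^ i) ((f ^ (r * k)) b₀) := by
      rw [hik, zpow_add, mul_apply, zpow_mul, zpow_natCast]
    rw [hbc]
    rw [apply_comm_of_commute (hN.zpow_right i)]
    congr 1
    by_contra hne
    obtain ⟨n, hn⟩ := (sameCycle_apply_of_commute (hψ ▸ hnd) hN hne).exists_nat_pow_eq
    obtain ⟨k', hk'⟩ := hiter n k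
    rw [hk', ← zpow_natCast f, ← mul_apply, ← zpow_add] at hn
    have h1 : (f ^ ((p * q * s : ℕ) + r * k - r * k')) b₀ = b₀ := by
      rw [sub_eq_neg_add, zpow_add, mul_apply, ← hn, ← mul_apply, ← zpow_add]
      simp
    rw [zpow_apply_eq_self_iff_card_dvd h0, len b₀ h0 h0q] at h1
    have h2 : (r : ℤ) ∣ (p * q * s : ℕ) := by
      have h3 : (r : ℤ) ∣ (p * q * s : ℕ) + r * k - r * k' :=
        dvd_trans ⟨q * s, by push_cast; ring⟩ h1
      have h4 := dvd_add h3 (⟨k' - k, rfl⟩ : (r : ℤ) ∣ r * (k' - k))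
      rwa [show ((p * q * s : ℕ) + r * k - r * k' + r * (k' - k) : ℤ) = (p * q * s : ℕ) by ring]
        at h4
    exact not_dvd_of_coprime_factor hr dvd_rfl hrpqs (Int.natCast_dvd_natCast.1 h2)
  · push Not at hfix
    have hψlen : ∀ v, f v ≠ v → (f ^ (q * r * s)) v = v →
        (ψ.cycleOf v).support.card = p * r * s ∨ (ψ.cycleOf v).support.card = q * r * s := by
      intro v hv hvq
      have hv' := hfix v hv hvq
      refine (card_eq_or_of_cycleType (hψ.trans hf) hv').resolve_left fun h => ?_
      have h1 : (ψ ^ (p * q * s : ℤ)) v = v := by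
        rw [zpow_apply_eq_self_iff_card_dvd hv', h]
        simp
      have h2 := zpow_eq_self_of_commute (hψ ▸ hnd) hN hv' _ h1
      have h3 : (f ^ ((p * q * s) * (p * q * s))) v = v := by
        rw [pow_mul]
        exact_mod_cast h2
      rw [pow_apply_eq_self_iff_card_dvd hv, len v hv hvq] at h3
      exact not_dvd_of_coprime_factor hr ⟨q * s, by ring⟩ (hrpqs.mul_right hrpqs) h3
    have hBpow : ∀ (n : ℕ) (v), f v ≠ v → (f ^ (q * r * s)) v = v → f ((ψ ^ n) v) ≠ (ψ ^ n) v ∧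
        (f ^ (q * r * s)) ((ψ ^ n) v) = (ψ ^ n) v := by
      intro n
      induction n with
      | zero => exact fun v h h' => ⟨h, h'⟩
      | succ n ih =>
        intro v h h'
        rw [pow_succ, mul_apply]
        exact ih _ (hB v h h').1 (hB v h h').2
    have hsub : ∀ v, f v ≠ v → (f ^ (q * r * s)) v = v →
        (ψ.cycleOf v).support ⊆ (f.cycleOf v).support := by
      intro v hv hvq u hu
      rw [mem_support_cycleOf_iff' (hfix v hv hvq)] at hu
      rw [mem_support_cycleOf_iff' hv]
      obtain ⟨n, rfl⟩ := hu.exists_nat_pow_eq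
      exact hsame _ _ hv hvq (hBpow n v hv hvq).1 (hBpow n v hv hvq).2
    have hbψ := hfix b hb hbq
    rw [pow_apply_eq_self_iff_card_dvd hbψ]
    rcases hψlen b hb hbq with h | h
    · exfalso
      have hall : ∀ v, f v ≠ v → (f ^ (q * r * s)) v = v → ψ.SameCycle b v := by
        intro v hv hvq
        rcases hψlen v hv hvq with h' | h'
        · exact sameCycle_of_card_eq (hψ ▸ hnd) hbψ (hfix v hv hvq) (h.trans h'.symm)
        · have := Finset.eq_of_subset_of_card_le (hsub v hv hvq) (by rw [h', len v hv hvq])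
          rw [sameCycle_comm, ← mem_support_cycleOf_iff' (hfix v hv hvq), this,
            mem_support_cycleOf_iff' hv]
          exact hsame _ _ hv hvq hb hbq
      have heq : (ψ.cycleOf b).support = (f.cycleOf b).support := by
        refine (hsub b hb hbq).antisymm fun u hu => ?_
        rw [mem_support_cycleOf_iff' hb] at hu
        rw [mem_support_cycleOf_iff' hbψ]
        obtain ⟨n, rfl⟩ := hu
        exact hall _ (fun e => hb ((f ^ n).injective (by
          rwa [apply_comm_of_commute (Commute.self_zpow f n)] at e)))
          (by rw [apply_comm_of_commute ((Commute.refl f).pow_left _ |>.zpow_right n), hbq])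
      have h1 := congrArg Finset.card heq
      rw [h, len b hb hbq] at h1
      exact not_dvd_of_coprime_factor hp ⟨r * s, by ring⟩ hpqrs h1.dvd
    · rw [h]

end Equiv.Perm

section Rack

open Equiv.Perm
open scoped Pointwise

theorem rack_translation_apply {X : Type} {φ : X → Equiv.Perm X}
    (hconj : ∀ u v, φ (φ u v) = φ u * φ v * (φ u)⁻¹) {σ : Equiv.Perm X}
    (hσ : σ ∈ Subgroup.closure (Set.range φ)) : ∀ v, φ (σ v) = σ * φ v * σ⁻¹ := by
  induction hσ using Subgroup.closure_induction with
  | mem σ h =>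
    obtain ⟨u, rfl⟩ := h
    exact hconj u
  | one => simp
  | mul σ τ _ _ hσ hτ =>
    intro v
    rw [Equiv.Perm.mul_apply, hσ, hτ]
    group
  | inv σ _ hσ =>
    intro v
    have := hσ (σ⁻¹ v)
    rw [show σ (σ⁻¹ v) = v by simp] at this
    rw [this]
    group

/-- The inner group of a finite indecomposable rack is generated by the translations by elements
outside a proper subrack. -/
theorem rack_translation_mem_closure_compl {X : Type} [Fintype X] {φ : X → Equiv.Perm X}
    (hconj : ∀ u v, φ (φ u v) = φ u * φ v * (φ u)⁻¹)
    (hind : ∀ u v : X, ∃ g ∈ Subgroup.closure (Set.range φ), g u = v)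
    {Y : Set X} (hY : ∀ u ∈ Y, ∀ v ∈ Y, φ u v ∈ Y) {y : X} (hy : y ∉ Y) (v : X) :
    φ v ∈ Subgroup.closure (φ '' Yᶜ) := by
  classical
  set H := Subgroup.closure (φ '' Yᶜ) with hH
  have hgen : ∀ u, u ∉ Y → φ u ∈ H := fun u hu => Subgroup.subset_closure ⟨u, hu, rfl⟩
  have hnorm : Subgroup.closure (Set.range φ) ≤ Subgroup.normalizer (H : Set (Equiv.Perm X)) := by
    rw [Subgroup.closure_le]
    rintro _ ⟨u, rfl⟩
    by_cases hu : u ∈ Y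
    · have hst : φ u ∈ MulAction.stabilizer (Equiv.Perm X) Y := by
        rw [MulAction.mem_stabilizer_set' Y.toFinite]
        exact hY u hu
      rw [MulAction.mem_stabilizer_set] at hst
      refine Subgroup.mem_normalizer_fintype fun σ (hσ : σ ∈ H) => ?_
      change _ ∈ H
      induction hσ using Subgroup.closure_induction with
      | mem σ h =>
        obtain ⟨w, hw, rfl⟩ := h
        rw [← hconj]
        exact hgen _ fun h => hw ((hst w).1 h)
      | one => simp
      | mul σ τ _ _ hσ hτ =>
        have := H.mul_mem hσ hτ
        simpa [mul_assoc] using this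
      | inv σ _ hσ =>
        have := H.inv_mem hσ
        simpa [mul_assoc] using this
    · exact Subgroup.le_normalizer (hgen u hu)
  obtain ⟨σ, hσ, rfl⟩ := hind y v
  rw [rack_translation_apply hconj hσ]
  exact (Subgroup.mem_normalizer_iff.1 (hnorm hσ) _).1 (hgen y hy)


/-- If `y ◃ x` is fixed by the translation by `x`, where `y` lies on its cycle of length `pqs`, then
the `qrs`-th power of the translation by `y` fixes `x`. -/
theorem quandle_pow_apply_base_eq_self {X : Type} [Fintype X] [DecidableEq X]
    {φ : X → Equiv.Perm X}
    (hconj : ∀ u v, φ (φ u v) = φ u * φ v * (φ u)⁻¹)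
    (hq : ∀ x : X, φ x x = x)
    (hind : ∀ u v : X, ∃ g ∈ Subgroup.closure (Set.range φ), g u = v)
    {x : X} {p q r s : ℕ}
    (hp : 1 < p) (hq' : 1 < q) (hr : 1 < r)
    (hpq : Nat.Coprime p q) (hpr : Nat.Coprime p r) (hps : Nat.Coprime p s)
    (hqr : Nat.Coprime q r) (hqs : Nat.Coprime q s) (hrs : Nat.Coprime r s)
    (hcyc : (φ x).cycleType = {p * q * s, p * r * s, q * r * s})
    {y : X} (hy : φ x y ≠ y) (hyN : (φ x ^ (p * q * s)) y = y) (hz : φ x (φ y x) = φ y x) :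
    (φ y ^ (q * r * s)) x = x := by
  have hrpqs : Nat.Coprime r (p * q * s) :=
    Nat.Coprime.mul_right (Nat.Coprime.mul_right hpr.symm hqr.symm) hrs
  have hqprs : Nat.Coprime q (p * r * s) :=
    Nat.Coprime.mul_right (Nat.Coprime.mul_right hpq.symm hqr) hqs
  have hpqrs : Nat.Coprime p (q * r * s) :=
    Nat.Coprime.mul_right (Nat.Coprime.mul_right hpq hpr) hps
  have hnd : (φ x).cycleType.Nodup := by
    have h1 : p * q * s ≠ p * r * s := fun h =>
      not_dvd_of_coprime_factor hq' ⟨p * s, by ring⟩ hqprs h.dvd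
    have h2 : p * q * s ≠ q * r * s := fun h =>
      not_dvd_of_coprime_factor hp ⟨q * s, by ring⟩ hpqrs h.dvd
    have h3 : p * r * s ≠ q * r * s := fun h =>
      not_dvd_of_coprime_factor hp ⟨r * s, by ring⟩ hpqrs h.dvd
    rw [hcyc]
    simp [h1, h2, h3]
  have htrans : ∀ {σ}, σ ∈ Subgroup.closure (Set.range φ) → ∀ v, φ (σ v) = σ * φ v * σ⁻¹ :=
    rack_translation_apply hconj
  have hmem : ∀ v, φ v ∈ Subgroup.closure (Set.range φ) := fun v =>
    Subgroup.subset_closure ⟨v, rfl⟩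
  have hcomm : ∀ {σ}, σ ∈ Subgroup.closure (Set.range φ) → ∀ v, σ v = v → Commute (φ v) σ := by
    intro σ hσ v hv
    have := htrans hσ v
    rw [hv, eq_mul_inv_iff_mul_eq] at this
    exact this
  have hψ : (φ y).cycleType = (φ x).cycleType := by
    obtain ⟨σ, hσ, rfl⟩ := hind x y
    rw [htrans hσ, cycleType_conj]
  have hc : Commute (φ x) (φ y * φ x * (φ y)⁻¹) := by
    rw [← hconj]
    exact (hcomm (hmem x) _ hz).symm
  have hN : Commute (φ y) (φ x ^ (p * q * s)) := hcomm (pow_mem (hmem x) _) y hyN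
  have len : ∀ v, φ x v ≠ v → (φ x ^ (p * q * s)) v = v →
      ((φ x).cycleOf v).support.card = p * q * s := by
    intro v hv hvq
    rw [pow_apply_eq_self_iff_card_dvd hv] at hvq
    rcases card_eq_or_of_cycleType hcyc hv with h | h | h
    · exact h
    · rw [h] at hvq
      exact absurd hvq (not_dvd_of_coprime_factor hr ⟨p * s, by ring⟩ hrpqs)
    · rw [h] at hvq
      exact absurd hvq (not_dvd_of_coprime_factor hr ⟨q * s, by ring⟩ hrpqs)
  have hC : ∀ v, φ x v ≠ v → (φ x ^ (p * q * s)) v = v → (φ x).SameCycle y v := fun v hv hvq =>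
    sameCycle_of_card_eq hnd hy hv ((len y hy hyN).trans (len v hv hvq).symm)
  have hψf : ∀ v, φ x v ≠ v → φ x (φ y v) ≠ φ y v ∧
      ∀ n : ℤ, (φ x ^ n) (φ y v) = φ y v ↔ (φ x ^ n) v = v := fun v hv =>
    zpow_apply_iff_of_commute_conj hnd hc (hq y) hy hN hC hv
  have hB : ∀ b, φ x b ≠ b → (φ x ^ (q * r * s)) b = b → (φ y ^ (q * r * s)) b = b :=
    fun b hb hbq => pow_apply_eq_self_of_commute_conj hp hr hpq hpr hps hqr hrs hcyc hψ
      hnd hc hN hψf hb hbq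
  by_contra hx
  -- the complement of this set is `{v | (φ x ^ (q * r * s)) v = v ∧ (φ y ^ (q * r * s)) v ≠ v}`
  let N : Set X := {v | (φ x ^ (q * r * s)) v = v → (φ y ^ (q * r * s)) v = v}
  let S := MulAction.stabilizer (Equiv.Perm X) N
  have hnonfix : ∀ v, φ x v ≠ v → v ∈ N := hB
  have hxS : φ x ∈ S := by
    rw [MulAction.mem_stabilizer_set' N.toFinite]
    intro v hv
    by_cases hvf : φ x v = v
    · rwa [Equiv.Perm.smul_def, hvf]
    · exact hnonfix _ fun e => hvf ((φ x).injective e)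
  have hyS : φ y ∈ S := by
    rw [MulAction.mem_stabilizer_set' N.toFinite]
    intro v hv
    by_cases hvf : φ x v = v
    · intro _
      have h1 : (φ y ^ (q * r * s)) v = v := hv (pow_apply_eq_self_of_apply_eq_self hvf _)
      rw [Equiv.Perm.smul_def, apply_comm_of_commute ((Commute.refl (φ y)).pow_left _), h1]
    · exact hnonfix _ (hψf v hvf).1
  let Y : Set X := {v | (φ x ^ (p * r * s)) v = v}
  have hY : ∀ u ∈ Y, ∀ v ∈ Y, φ u v ∈ Y := by
    intro u hu v hv
    have h1 := hcomm (pow_mem (hmem x) (p * r * s)) u hu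
    change (φ x ^ (p * r * s)) (φ u v) = φ u v
    rw [← apply_comm_of_commute h1, hv]
  have hyY : y ∉ Y := fun h => by
    have h : (φ x ^ (p * r * s)) y = y := h
    rw [pow_apply_eq_self_iff_card_dvd hy, len y hy hyN] at h
    exact not_dvd_of_coprime_factor hq' ⟨p * s, by ring⟩ hqprs h
  have hS : ∀ v, φ v ∈ S := by
    intro v
    refine (Subgroup.closure_le S).2 ?_ (rack_translation_mem_closure_compl hconj hind hY hyY v)
    rintro _ ⟨w, hw, rfl⟩
    have hwf : φ x w ≠ w := fun h => hw (pow_apply_eq_self_of_apply_eq_self h _)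
    by_cases hwC : (φ x ^ (p * q * s)) w = w
    · obtain ⟨i, rfl⟩ := hC w hwf hwC
      rw [htrans (zpow_mem (hmem x) i)]
      exact S.mul_mem (S.mul_mem (S.zpow_mem hxS i) hyS) (S.inv_mem (S.zpow_mem hxS i))
    · have hwB : (φ x ^ (q * r * s)) w = w := by
        have hw' : ¬ (φ x ^ (p * r * s)) w = w := hw
        rw [pow_apply_eq_self_iff_card_dvd hwf] at hwC hw' ⊢
        rcases card_eq_or_of_cycleType hcyc hwf with h | h | h
        · exact absurd h.dvd hwC
        · exact absurd h.dvd hw'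
        · exact h.dvd
      have h1 := hcomm (pow_mem (hmem x) (q * r * s)) w hwB
      have h2 := hcomm (pow_mem (hmem y) (q * r * s)) w (hB w hwf hwB)
      refine (MulAction.mem_stabilizer_set' N.toFinite).2 fun v hv hvx => ?_
      rw [Equiv.Perm.smul_def, ← apply_comm_of_commute h1, (φ w).injective.eq_iff] at hvx
      rw [Equiv.Perm.smul_def, ← apply_comm_of_commute h2, hv hvx]
  have hle : Subgroup.closure (Set.range φ) ≤ S := by
    rw [Subgroup.closure_le]
    rintro _ ⟨v, rfl⟩
    exact hS v
  obtain ⟨σ, hσ, hσy⟩ := hind y x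
  have hxN : x ∈ N := by
    have := (MulAction.mem_stabilizer_set.1 (hle hσ) y).2 (hnonfix y hy)
    rwa [Equiv.Perm.smul_def, hσy] at this
  exact hx (hxN (pow_apply_eq_self_of_apply_eq_self (hq x) _))

end Rack

/-- In the setup, for every `y ∈ X′_{pqs}` one has
`y ◃ x ∈ X′_{pqs}`. -/
theorem stmt_12 (X : Type) [Fintype X] [DecidableEq X]
    (op : X → X → X)
    (φ : X → Equiv.Perm X)
    (hφ : ∀ x y : X, φ x y = op x y)
    (hsd : ∀ x y z : X, op x (op y z) = op (op x y) (op x z))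
    (hq : ∀ x : X, op x x = x)
    (hcr : ∀ x y : X, op y x = x → op x y = y)
    (hind : ∀ u v : X, ∃ g ∈ Subgroup.closure (Set.range φ), g u = v)
    (x : X) (p q r s : ℕ)
    (hp : 1 < p) (hq' : 1 < q) (hr : 1 < r) (hs : 0 < s)
    (hpq : Nat.Coprime p q) (hpr : Nat.Coprime p r) (hps : Nat.Coprime p s)
    (hqr : Nat.Coprime q r) (hqs : Nat.Coprime q s) (hrs : Nat.Coprime r s)
    (hcyc : (φ x).cycleType = {p * q * s, p * r * s, q * r * s}) :
    ∀ y ∈ fixedPts φ x (p * q * s) \ fixedPts φ x 1,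
      op y x ∈ fixedPts φ x (p * q * s) \ fixedPts φ x 1 := by
  rintro y ⟨hyN, hy⟩
  have hyN : (φ x ^ (p * q * s)) y = y := hyN
  have hy : φ x y ≠ y := fun h => hy (by simpa [fixedPts] using h)
  have hconj : ∀ u v, φ (φ u v) = φ u * φ v * (φ u)⁻¹ := by
    intro u v
    rw [eq_mul_inv_iff_mul_eq]
    ext w
    simp only [Equiv.Perm.mul_apply, hφ, hsd u v w]
  have hqφ : ∀ v, φ v v = v := fun v => (hφ v v).trans (hq v)
  have htrans := rack_translation_apply hconj
    (pow_mem (Subgroup.subset_closure ⟨x, rfl⟩ : φ x ∈ Subgroup.closure (Set.range φ)) (p * q * s))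
    y
  rw [hyN, eq_mul_inv_iff_mul_eq] at htrans
  rw [← hφ]
  refine ⟨?_, fun hz => ?_⟩
  · change (φ x ^ (p * q * s)) (φ y x) = φ y x
    rw [← Equiv.Perm.apply_comm_of_commute htrans,
      Equiv.Perm.pow_apply_eq_self_of_apply_eq_self (hqφ x)]
  have hz : φ x (φ y x) = φ y x := by simpa [fixedPts] using hz
  have h1 := quandle_pow_apply_base_eq_self hconj hqφ hind hp hq' hr hpq hpr hps hqr hqs hrs
    hcyc hy hyN hz
  have h2 := quandle_pow_apply_base_eq_self (p := q) (q := p) (r := r) (s := s) hconj hqφ hind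
    hq' hp hr hpq.symm hqr hqs hpr hps hrs
    (by rw [hcyc, mul_comm p q]; exact congrArg _ (Multiset.cons_swap _ _ _)) hy
    (by rwa [mul_comm q p]) hz
  have hyx : φ y x ≠ x := fun h => hy (by
    rw [hφ] at h ⊢
    exact hcr x y h)
  obtain ⟨σ, hσ, hσx⟩ := hind x y
  have hct : (φ y).cycleType = {p * q * s, p * r * s, q * r * s} := by
    rw [← hσx, rack_translation_apply hconj hσ, Equiv.Perm.cycleType_conj, hcyc]
  rw [Equiv.Perm.pow_apply_eq_self_iff_card_dvd hyx] at h1 h2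
  have hpqrs : Nat.Coprime p (q * r * s) :=
    Nat.Coprime.mul_right (Nat.Coprime.mul_right hpq hpr) hps
  have hqprs : Nat.Coprime q (p * r * s) :=
    Nat.Coprime.mul_right (Nat.Coprime.mul_right hpq.symm hqr) hqs
  rcases Equiv.Perm.card_eq_or_of_cycleType hct hyx with h | h | h
  · rw [h] at h1
    exact Equiv.Perm.not_dvd_of_coprime_factor hp ⟨q * s, by ring⟩ hpqrs h1
  · rw [h] at h1
    exact Equiv.Perm.not_dvd_of_coprime_factor hp ⟨r * s, by ring⟩ hpqrs h1
  · rw [h] at h2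
    exact Equiv.Perm.not_dvd_of_coprime_factor hq' ⟨r * s, by ring⟩ hqprs h2
end

section
/- In the setup below, let y ∈ X′_{pqs} and let φ_y = σ₁σ₂σ₃ be the decomposition of φ_y into the product of disjoint cycles of lengths pqs, prs, qrs respectively. Then every entry of σ₁ belongs to X_{pqs}, and every entry of σ₂ and of σ₃ belongs to X′_{prs} ∪ X′_{qrs}. Equivalently: every point of X whose φ_y-orbit has size pqs lies in X_{pqs}, and every point whose φ_y-orbit has size prs or qrs lies in X′_{prs} ∪ X′_{qrs}. -/
open Function in
theorem perm_pow_apply_eq_iff_minimalPeriod_dvd {X : Type} (f : Equiv.Perm X) (n : ℕ) (z : X) :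
    (f ^ n) z = z ↔ minimalPeriod f z ∣ n := by
  rw [← isPeriodicPt_iff_minimalPeriod_dvd, IsPeriodicPt, IsFixedPt, Equiv.Perm.iterate_eq_pow]

theorem perm_apply_eq_iff_minimalPeriod_eq_one {X : Type} (f : Equiv.Perm X) (z : X) :
    f z = z ↔ Function.minimalPeriod f z = 1 :=
  Function.minimalPeriod_eq_one_iff_isFixedPt.symm

theorem Commute.perm_apply_fixed_iff {X : Type} {f g : Equiv.Perm X} (h : Commute f g) (z : X) :
    g (f z) = f z ↔ g z = z := by
  rw [← Equiv.Perm.mul_apply, ← h.eq, Equiv.Perm.mul_apply, f.injective.eq_iff]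

theorem Commute.minimalPeriod_perm_apply {X : Type} {f g : Equiv.Perm X} (h : Commute f g)
    (z : X) : Function.minimalPeriod g (f z) = Function.minimalPeriod g z := by
  have key (n : ℕ) : Function.minimalPeriod g (f z) ∣ n ↔ Function.minimalPeriod g z ∣ n := by
    rw [← perm_pow_apply_eq_iff_minimalPeriod_dvd, ← perm_pow_apply_eq_iff_minimalPeriod_dvd]
    exact (h.pow_right n).perm_apply_fixed_iff z
  exact Nat.dvd_antisymm ((key _).2 dvd_rfl) ((key _).1 dvd_rfl)

theorem Commute.fixed_iff_of_sameCycle {X : Type} {f g : Equiv.Perm X} (h : Commute f g)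
    {z w : X} (hzw : f.SameCycle z w) : g w = w ↔ g z = z := by
  obtain ⟨k, rfl⟩ := hzw
  exact (h.zpow_left k).perm_apply_fixed_iff z

theorem card_support_cycleOf_eq_minimalPeriod {X : Type} [Fintype X] [DecidableEq X]
    (f : Equiv.Perm X) {z : X} (hz : f z ≠ z) :
    (f.cycleOf z).support.card = Function.minimalPeriod f z := by
  have key (n : ℕ) : (f.cycleOf z).support.card ∣ n ↔ Function.minimalPeriod f z ∣ n := by
    rw [← perm_pow_apply_eq_iff_minimalPeriod_dvd]
    refine ((f.isCycleOn_support_cycleOf z).pow_apply_eq ?_).symm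
    exact (Equiv.Perm.mem_support_cycleOf_iff' hz).2 (.refl _ _)
  exact Nat.dvd_antisymm ((key _).2 dvd_rfl) ((key _).1 dvd_rfl)

theorem minimalPeriod_mem_cycleType {X : Type} [Fintype X] [DecidableEq X]
    (f : Equiv.Perm X) {z : X} (hz : f z ≠ z) :
    Function.minimalPeriod f z ∈ f.cycleType := by
  rw [← card_support_cycleOf_eq_minimalPeriod f hz, Equiv.Perm.cycleType_def]
  exact Multiset.mem_map_of_mem _
    (Equiv.Perm.cycleOf_mem_cycleFactorsFinset_iff.2 (Equiv.Perm.mem_support.2 hz))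

theorem sameCycle_of_minimalPeriod_eq {X : Type} [Fintype X] [DecidableEq X]
    {f : Equiv.Perm X} (hf : f.cycleType.Nodup) {z w : X} (hz : f z ≠ z)
    (h : Function.minimalPeriod f w = Function.minimalPeriod f z) : f.SameCycle z w := by
  have hw : f w ≠ w := by
    rwa [Ne, perm_apply_eq_iff_minimalPeriod_eq_one, h,
      ← perm_apply_eq_iff_minimalPeriod_eq_one]
  rw [Equiv.Perm.cycleType_def] at hf
  rw [Equiv.Perm.sameCycle_iff_cycleOf_eq_of_mem_support (Equiv.Perm.mem_support.2 hz)
    (Equiv.Perm.mem_support.2 hw)]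
  refine Multiset.inj_on_of_nodup_map hf _ ?_ _ ?_ ?_
  · exact Equiv.Perm.cycleOf_mem_cycleFactorsFinset_iff.2 (Equiv.Perm.mem_support.2 hz)
  · exact Equiv.Perm.cycleOf_mem_cycleFactorsFinset_iff.2 (Equiv.Perm.mem_support.2 hw)
  · simp only [Function.comp_apply]
    rw [card_support_cycleOf_eq_minimalPeriod f hz, card_support_cycleOf_eq_minimalPeriod f hw, h]

theorem card_filter_minimalPeriod_eq {X : Type} [Fintype X] [DecidableEq X]
    {f : Equiv.Perm X} (hf : f.cycleType.Nodup) {n : ℕ} (hn : n ∈ f.cycleType) :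
    (Finset.univ.filter fun z => Function.minimalPeriod f z = n).card = n := by
  have hn' := hn
  rw [Equiv.Perm.cycleType_def] at hn'
  obtain ⟨c, hc, hcn⟩ := Multiset.mem_map.1 hn'
  have hc' : c ∈ f.cycleFactorsFinset := hc
  obtain ⟨z, hz⟩ := (Equiv.Perm.mem_cycleFactorsFinset_iff.1 hc').1.nonempty_support
  have hzf := Equiv.Perm.mem_support.1 (Equiv.Perm.mem_cycleFactorsFinset_support_le hc' hz)
  have hcz := Equiv.Perm.cycle_is_cycleOf hz hc'
  have hper : Function.minimalPeriod f z = n := by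
    rw [← card_support_cycleOf_eq_minimalPeriod f hzf, ← hcz]; exact hcn
  have : (Finset.univ.filter fun z => Function.minimalPeriod f z = n) = c.support := by
    ext w
    rw [hcz, Equiv.Perm.mem_support_cycleOf_iff' hzf, Finset.mem_filter]
    refine ⟨fun h => sameCycle_of_minimalPeriod_eq hf hzf (h.2.trans hper.symm), ?_⟩
    rintro ⟨k, rfl⟩
    exact ⟨Finset.mem_univ _,
      (((Commute.refl f).zpow_left k).minimalPeriod_perm_apply z).trans hper⟩
  rw [this]
  exact hcn

theorem map_apply_eq_conj_of_mem_closure {X : Type} {φ : X → Equiv.Perm X}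
    (hconj : ∀ a b, φ (φ a b) = φ a * φ b * (φ a)⁻¹) {g : Equiv.Perm X}
    (hg : g ∈ Subgroup.closure (Set.range φ)) : ∀ u, φ (g u) = g * φ u * g⁻¹ := by
  induction hg using Subgroup.closure_induction with
  | mem g hg => obtain ⟨a, rfl⟩ := hg; exact hconj a
  | one => simp
  | mul g h _ _ hg hh => intro u; rw [Equiv.Perm.mul_apply, hg, hh]; group
  | inv g _ hg =>
    intro u
    have := hg (g⁻¹ u)
    rw [show g (g⁻¹ u) = u from g.apply_symm_apply u] at this
    rw [this]; group

theorem commute_pow_of_pow_apply_eq {X : Type} {φ : X → Equiv.Perm X}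
    (hconj : ∀ a b, φ (φ a b) = φ a * φ b * (φ a)⁻¹) {x y : X} {t : ℕ}
    (h : (φ x ^ t) y = y) : Commute (φ x ^ t) (φ y) := by
  have := map_apply_eq_conj_of_mem_closure hconj
    (pow_mem (Subgroup.subset_closure (Set.mem_range_self x)) t) y
  rw [h, eq_mul_inv_iff_mul_eq] at this
  exact this.symm

/-- The complement of the proper subrack of points fixed by a power of `φ x` generates the inner
group, so an element that fixes it pointwise is fixed by every left translation. -/
theorem apply_eq_of_fixes_compl_fixedPts {X : Type} {φ : X → Equiv.Perm X}
    (hconj : ∀ a b, φ (φ a b) = φ a * φ b * (φ a)⁻¹)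
    (hcr : ∀ x y : X, φ y x = x → φ x y = y)
    (hind : ∀ u v : X, ∃ g ∈ Subgroup.closure (Set.range φ), g u = v)
    {x : X} {t : ℕ} (ht : ∃ w, (φ x ^ t) w ≠ w) {y : X}
    (hy : ∀ w, (φ x ^ t) w ≠ w → φ y w = w) (u : X) : φ u y = y := by
  set S : Set (Equiv.Perm X) := {h | ∃ w, (φ x ^ t) w ≠ w ∧ φ w = h} with hS
  have hnorm : Subgroup.closure (Set.range φ) ≤
      Subgroup.normalizer (Subgroup.closure S : Set (Equiv.Perm X)) := by
    rw [Subgroup.closure_le]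
    rintro _ ⟨a, rfl⟩
    by_cases ha : (φ x ^ t) a = a
    · apply Subgroup.normalizer_le_normalizer_closure
      have hc := commute_pow_of_pow_apply_eq hconj ha
      refine Subgroup.mem_set_normalizer_iff.2 fun h => ?_
      constructor
      · rintro ⟨w, hw, rfl⟩
        exact ⟨φ a w, fun h => hw ((hc.symm.perm_apply_fixed_iff w).1 h), hconj a w⟩
      · rintro ⟨w, hw, hwh⟩
        refine ⟨(φ a)⁻¹ w, fun h => hw ((hc.symm.inv_left.perm_apply_fixed_iff w).1 h), ?_⟩
        rw [map_apply_eq_conj_of_mem_closure hconj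
          (inv_mem (Subgroup.subset_closure (Set.mem_range_self a))), hwh]
        group
    · exact Subgroup.le_normalizer (Subgroup.subset_closure ⟨a, ha, rfl⟩)
  obtain ⟨w, hw⟩ := ht
  obtain ⟨g, hg, rfl⟩ := hind w u
  have hmem : φ (g w) ∈ Subgroup.closure S := by
    rw [map_apply_eq_conj_of_mem_closure hconj hg]
    exact (Subgroup.mem_normalizer_iff.1 (hnorm hg) _).1 (Subgroup.subset_closure ⟨w, hw, rfl⟩)
  have hle : Subgroup.closure S ≤ MulAction.stabilizer (Equiv.Perm X) y := by
    rw [Subgroup.closure_le]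
    rintro _ ⟨w, hw, rfl⟩
    exact hcr w y (hy w hw)
  exact hle hmem

/-- The case where `x` and `y` lie in one orbit of the group generated by their translations. -/
theorem pow_eq_pow_of_mem_closure_pair {X : Type} {φ : X → Equiv.Perm X}
    (hconj : ∀ a b, φ (φ a b) = φ a * φ b * (φ a)⁻¹) {x y : X} {n : ℕ}
    (h : (φ x ^ n) y = y) {g : Equiv.Perm X} (hg : g ∈ Subgroup.closure {φ x, φ y})
    (hgx : g x = y) : φ y ^ n = φ x ^ n := by
  have hcomm : Commute g (φ x ^ n) := by
    have hle : Subgroup.closure {φ x, φ y} ≤ Subgroup.centralizer {φ x ^ n} := by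
      rw [Subgroup.closure_le]
      rintro k (rfl | rfl) <;> rw [SetLike.mem_coe, Subgroup.mem_centralizer_singleton_iff]
      · exact ((Commute.refl _).pow_right n).eq
      · exact (commute_pow_of_pow_apply_eq hconj h).symm.eq
    exact Subgroup.mem_centralizer_singleton_iff.1 (hle hg)
  have hg' : g ∈ Subgroup.closure (Set.range φ) := by
    refine Subgroup.closure_mono ?_ hg
    rintro k (rfl | rfl) <;> exact Set.mem_range_self _
  rw [← hgx, map_apply_eq_conj_of_mem_closure hconj hg', conj_pow, hcomm.eq, mul_assoc,
    mul_inv_cancel, mul_one]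

/-- The statement for a profile `{a, b, c}` of lengths not dividing one another such that some
`r > 1` coprime to `a` divides `b` and `c`. -/
theorem orbits_of_profile {X : Type} [Fintype X] [DecidableEq X] {φ : X → Equiv.Perm X}
    (hconj : ∀ a b, φ (φ a b) = φ a * φ b * (φ a)⁻¹)
    (hidem : ∀ x, φ x x = x) (hcr : ∀ x y : X, φ y x = x → φ x y = y)
    (hind : ∀ u v : X, ∃ g ∈ Subgroup.closure (Set.range φ), g u = v)
    {a b c r : ℕ} (hab : ¬ a ∣ b) (hba : ¬ b ∣ a) (hac : ¬ a ∣ c) (hca : ¬ c ∣ a)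
    (hbc : ¬ b ∣ c) (hcb : ¬ c ∣ b) (hr : 1 < r) (hra : Nat.Coprime r a) (hrb : r ∣ b)
    (hrc : r ∣ c) {x y : X} (hcyc : (φ x).cycleType = {a, b, c})
    (hya : (φ x ^ a) y = y) (hy1 : φ x y ≠ y) :
    (∀ z, Function.minimalPeriod (φ y) z = a → (φ x ^ a) z = z) ∧
    ∀ z, (Function.minimalPeriod (φ y) z = b ∨ Function.minimalPeriod (φ y) z = c) →
      (φ x ^ a) z ≠ z := by
  have hcyc' (u : X) : (φ u).cycleType = {a, b, c} := by
    obtain ⟨g, hg, rfl⟩ := hind x u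
    rw [map_apply_eq_conj_of_mem_closure hconj hg, Equiv.Perm.cycleType_conj, hcyc]
  have hnd (u : X) : (φ u).cycleType.Nodup := by
    rw [hcyc']
    have h1 : a ≠ b := fun h => hab h.dvd
    have h2 : a ≠ c := fun h => hac h.dvd
    have h3 : b ≠ c := fun h => hbc h.dvd
    simp [h1, h2, h3]
  have hper (u z : X) (hz : φ u z ≠ z) : Function.minimalPeriod (φ u) z = a ∨
      Function.minimalPeriod (φ u) z = b ∨ Function.minimalPeriod (φ u) z = c := by
    have := minimalPeriod_mem_cycleType (φ u) hz
    rw [hcyc'] at this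
    simpa using this
  have hrper (z : X) (hz : (φ x ^ a) z ≠ z) : r ∣ Function.minimalPeriod (φ x) z := by
    rcases hper x z fun h => hz (Equiv.Perm.pow_apply_eq_self_of_apply_eq_self h a) with h | h | h
    · exact absurd ((perm_pow_apply_eq_iff_minimalPeriod_dvd _ _ _).2 h.dvd) hz
    · rwa [h]
    · rwa [h]
  have hcomm := commute_pow_of_pow_apply_eq hconj hya
  have first (z : X) (hz : Function.minimalPeriod (φ y) z = a) : (φ x ^ a) z = z := by
    by_contra hne
    have hyz : φ y z ≠ z := by
      rw [Ne, perm_apply_eq_iff_minimalPeriod_eq_one, hz]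
      rintro rfl
      exact hab (one_dvd _)
    obtain ⟨k, hk⟩ := sameCycle_of_minimalPeriod_eq (hnd y) hyz (hcomm.minimalPeriod_perm_apply z)
    have hpow (j : ℕ) : ((φ x ^ a) ^ j) z = ((φ y ^ k) ^ j) z := by
      induction j with
      | zero => rfl
      | succ j ih =>
        rw [pow_succ', Equiv.Perm.mul_apply, ih, pow_succ, Equiv.Perm.mul_apply, hk,
          ← Equiv.Perm.mul_apply, ← Equiv.Perm.mul_apply,
          ((hcomm.zpow_right k).pow_right j).eq]
    have hfix : ((φ x ^ a) ^ a) z = z := by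
      rw [hpow, ← zpow_natCast, zpow_comm, zpow_natCast]
      exact Equiv.Perm.zpow_apply_eq_self_of_apply_eq_self
        ((perm_pow_apply_eq_iff_minimalPeriod_dvd _ _ _).2 hz.dvd) k
    rw [← pow_mul, perm_pow_apply_eq_iff_minimalPeriod_dvd] at hfix
    have := Nat.Coprime.eq_one_of_dvd (hra.mul_right hra) ((hrper z hne).trans hfix)
    omega
  refine ⟨first, fun z hz hzF => ?_⟩
  have hy_fix : ∀ w, φ y w ≠ w → (φ x ^ a) w ≠ w →
      Function.minimalPeriod (φ y) w = b ∨ Function.minimalPeriod (φ y) w = c := fun w hw hwF =>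
    (hper y w hw).resolve_left fun h => hwF (first w h)
  -- The points outside `X_a` moved by `φ y` form part of a single cycle.
  obtain ⟨m, hm, hmF⟩ : ∃ m, (m = b ∨ m = c) ∧ ∀ w, φ y w ≠ w → (φ x ^ a) w ≠ w →
      Function.minimalPeriod (φ y) w = m := by
    have hne (w : X) (hw : φ y w ≠ w) (hwF : (φ x ^ a) w ≠ w) :
        Function.minimalPeriod (φ y) w ≠ Function.minimalPeriod (φ y) z := fun h =>
      hwF ((hcomm.symm.fixed_iff_of_sameCycle
        (sameCycle_of_minimalPeriod_eq (hnd y) hw h.symm)).1 hzF)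
    rcases hz with hz | hz
    · exact ⟨c, .inr rfl, fun w hw hwF =>
        (hy_fix w hw hwF).resolve_left fun h => hne w hw hwF (h.trans hz.symm)⟩
    · exact ⟨b, .inl rfl, fun w hw hwF =>
        (hy_fix w hw hwF).resolve_right fun h => hne w hw hwF (h.trans hz.symm)⟩
  have hxy : φ y x ≠ x := fun h => hy1 (hcr x y h)
  have hpx : Function.minimalPeriod (φ x) y = a := by
    have hdvd := (perm_pow_apply_eq_iff_minimalPeriod_dvd _ _ _).1 hya
    rcases hper x y hy1 with h | h | h
    · exact h
    · exact absurd (h ▸ hdvd) hba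
    · exact absurd (h ▸ hdvd) hca
  have hpyx := hper y x hxy
  set t := Function.minimalPeriod (φ y) x with ht
  have hcommt : Commute (φ y ^ t) (φ x) := commute_pow_of_pow_apply_eq hconj
    ((perm_pow_apply_eq_iff_minimalPeriod_dvd _ _ _).2 dvd_rfl)
  by_cases horb : ∃ g ∈ Subgroup.closure {φ x, φ y}, g x = y
  · obtain ⟨g, hg, hgx⟩ := horb
    rw [← pow_eq_pow_of_mem_closure_pair hconj hya hg hgx,
      perm_pow_apply_eq_iff_minimalPeriod_dvd] at hzF
    rcases hz with hz | hz <;> rw [hz] at hzF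
    exacts [hba hzF, hca hzF]
  have hA (w : X) (hw : Function.minimalPeriod (φ x) w = a) : φ y w = w := by
    by_contra hyw
    obtain ⟨k, rfl⟩ := sameCycle_of_minimalPeriod_eq (hnd x) hy1 (hw.trans hpx.symm)
    have hyt : (φ y ^ t) y = y := Equiv.Perm.pow_apply_eq_self_of_apply_eq_self (hidem y) t
    have hdvd := (perm_pow_apply_eq_iff_minimalPeriod_dvd _ _ _).1
      (((hcommt.symm.zpow_left k).perm_apply_fixed_iff y).2 hyt)
    have heq : Function.minimalPeriod (φ y) ((φ x ^ k) y) = t := by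
      rcases hper y _ hyw with h | h | h <;> rw [h] at hdvd ⊢ <;>
        rcases hpyx with h' | h' | h' <;> rw [h'] at hdvd ⊢ <;> contradiction
    obtain ⟨j, hj⟩ := sameCycle_of_minimalPeriod_eq (hnd y) hxy heq
    refine horb ⟨(φ x ^ k)⁻¹ * φ y ^ j, mul_mem (inv_mem (zpow_mem ?_ k)) (zpow_mem ?_ j), ?_⟩
    · exact Subgroup.subset_closure (by simp)
    · exact Subgroup.subset_closure (by simp)
    · rw [Equiv.Perm.mul_apply, hj]
      exact (φ x ^ k).symm_apply_apply y
  have hexists (n : ℕ) (hn : n ∈ (φ x).cycleType) : ∃ w, Function.minimalPeriod (φ x) w = n := by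
    have hcard := card_filter_minimalPeriod_eq (hnd x) hn
    have := Equiv.Perm.two_le_of_mem_cycleType hn
    obtain ⟨w, hw⟩ := Finset.card_pos.1 (by omega :
      0 < (Finset.univ.filter fun z => Function.minimalPeriod (φ x) z = n).card)
    exact ⟨w, (Finset.mem_filter.1 hw).2⟩
  have hmoved (n n' : ℕ) (hn : n ∈ (φ x).cycleType) (hn' : ¬ n ∣ n')
      (hor : ∀ w, φ x w ≠ w → Function.minimalPeriod (φ x) w = a ∨
        Function.minimalPeriod (φ x) w = n ∨ Function.minimalPeriod (φ x) w = n') :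
      ∃ w, Function.minimalPeriod (φ x) w = n ∧ φ y w ≠ w := by
    by_contra! hfix
    obtain ⟨w, hw⟩ := hexists n hn
    refine hy1 (apply_eq_of_fixes_compl_fixedPts hconj hcr hind (x := x) (t := n') ⟨w, ?_⟩ ?_ x)
    · rwa [Ne, perm_pow_apply_eq_iff_minimalPeriod_dvd, hw]
    · intro v hv
      rcases hor v fun h => hv (Equiv.Perm.pow_apply_eq_self_of_apply_eq_self h n')
        with h | h | h
      · exact hA v h
      · exact hfix v h
      · exact absurd ((perm_pow_apply_eq_iff_minimalPeriod_dvd _ _ _).2 h.dvd) hv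
  have hxF : (φ x ^ a) x = x := Equiv.Perm.pow_apply_eq_self_of_apply_eq_self (hidem x) a
  have hall (n : ℕ) (hna : ¬ n ∣ a) (hw : ∃ w, Function.minimalPeriod (φ x) w = n ∧ φ y w ≠ w)
      (v : X) (hv : Function.minimalPeriod (φ x) v = n) : Function.minimalPeriod (φ y) v = m := by
    obtain ⟨w, hw, hyw⟩ := hw
    have hF (u : X) (hu : Function.minimalPeriod (φ x) u = n) : (φ x ^ a) u ≠ u := by
      rwa [Ne, perm_pow_apply_eq_iff_minimalPeriod_dvd, hu]
    have hwm := hmF w hyw (hF w hw)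
    have htm : t ≠ m := fun h => hF w hw ((hcomm.symm.fixed_iff_of_sameCycle
      (sameCycle_of_minimalPeriod_eq (hnd y) hxy (hwm.trans h.symm))).2 hxF)
    have hmt : ¬ m ∣ t := by
      rcases hm with rfl | rfl <;> rcases hpyx with h | h | h <;> rw [h] at htm ⊢ <;>
        first | assumption | exact absurd rfl htm
    have hxw : φ x w ≠ w := fun h =>
      hF w hw (Equiv.Perm.pow_apply_eq_self_of_apply_eq_self h a)
    refine hmF v (fun h => hmt ?_) (hF v hv)
    rw [← hwm, ← perm_pow_apply_eq_iff_minimalPeriod_dvd]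
    exact (hcommt.symm.fixed_iff_of_sameCycle
      (sameCycle_of_minimalPeriod_eq (hnd x) hxw (hv.trans hw.symm))).1
      (Equiv.Perm.pow_apply_eq_self_of_apply_eq_self h t)
  have hbmem (u : X) : b ∈ (φ u).cycleType := by simp [hcyc']
  have hcmem (u : X) : c ∈ (φ u).cycleType := by simp [hcyc']
  have hB := hall b hba (hmoved b c (hbmem x) hbc (hper x))
  have hC := hall c hca (hmoved c b (hcmem x) hcb fun w hw => (hper x w hw).imp_right Or.symm)
  have hcardm := card_filter_minimalPeriod_eq (hnd y) (n := m)
    (by rcases hm with rfl | rfl; exacts [hbmem y, hcmem y])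
  have hle := Finset.card_le_card (s := (Finset.univ.filter fun z =>
      Function.minimalPeriod (φ x) z = b) ∪ Finset.univ.filter fun z =>
      Function.minimalPeriod (φ x) z = c)
    (t := Finset.univ.filter fun z => Function.minimalPeriod (φ y) z = m) (by
      intro w hw
      simp only [Finset.mem_union, Finset.mem_filter, Finset.mem_univ, true_and] at hw ⊢
      exact hw.elim (hB w) (hC w))
  rw [Finset.card_union_of_disjoint, card_filter_minimalPeriod_eq (hnd x) (hbmem x),
    card_filter_minimalPeriod_eq (hnd x) (hcmem x), hcardm] at hle
  · have := Equiv.Perm.two_le_of_mem_cycleType (hbmem x)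
    have := Equiv.Perm.two_le_of_mem_cycleType (hcmem x)
    omega
  · rw [Finset.disjoint_filter]
    rintro w - h h'
    exact hbc (h.symm.trans h').dvd


/-- In the setup, for `y ∈ X′_{pqs}`: every point of `X` whose
`φ_y`-orbit has size `pqs` lies in `X_{pqs}`, and every point whose
`φ_y`-orbit has size `prs` or `qrs` lies in `X′_{prs} ∪ X′_{qrs}`. -/
theorem stmt_13 (X : Type) [Fintype X] [DecidableEq X]
    (op : X → X → X)
    (φ : X → Equiv.Perm X)
    (hφ : ∀ x y : X, φ x y = op x y)
    (hsd : ∀ x y z : X, op x (op y z) = op (op x y) (op x z))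
    (hq : ∀ x : X, op x x = x)
    (hcr : ∀ x y : X, op y x = x → op x y = y)
    (hind : ∀ u v : X, ∃ g ∈ Subgroup.closure (Set.range φ), g u = v)
    (x : X) (p q r s : ℕ)
    (hp : 1 < p) (hq' : 1 < q) (hr : 1 < r) (hs : 0 < s)
    (hpq : Nat.Coprime p q) (hpr : Nat.Coprime p r) (hps : Nat.Coprime p s)
    (hqr : Nat.Coprime q r) (hqs : Nat.Coprime q s) (hrs : Nat.Coprime r s)
    (hcyc : (φ x).cycleType = {p * q * s, p * r * s, q * r * s})
    (y : X) (hy : y ∈ fixedPts φ x (p * q * s) \ fixedPts φ x 1) :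
    (∀ z : X, Function.minimalPeriod (⇑(φ y)) z = p * q * s →
      z ∈ fixedPts φ x (p * q * s)) ∧
    (∀ z : X, (Function.minimalPeriod (⇑(φ y)) z = p * r * s ∨
        Function.minimalPeriod (⇑(φ y)) z = q * r * s) →
      z ∈ (fixedPts φ x (p * r * s) \ fixedPts φ x 1) ∪
        (fixedPts φ x (q * r * s) \ fixedPts φ x 1)) := by
  have hconj (a b : X) : φ (φ a b) = φ a * φ b * (φ a)⁻¹ := by
    rw [eq_mul_inv_iff_mul_eq]
    ext w
    rw [Equiv.Perm.mul_apply, Equiv.Perm.mul_apply, hφ (φ a b), hφ a b, hφ a w, hφ b w,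
      hφ a (op b w), hsd a b w]
  have hya : (φ x ^ (p * q * s)) y = y := hy.1
  have hy1 : φ x y ≠ y := fun h => hy.2 (by simpa [fixedPts] using h)
  have hperx (z : X) (hz : φ x z ≠ z) : Function.minimalPeriod (φ x) z = p * q * s ∨
      Function.minimalPeriod (φ x) z = p * r * s ∨ Function.minimalPeriod (φ x) z = q * r * s := by
    have := minimalPeriod_mem_cycleType (φ x) hz
    rw [hcyc] at this
    simpa using this
  have hp_qrs : Nat.Coprime p (q * r * s) := (hpq.mul_right hpr).mul_right hps
  have hq_prs : Nat.Coprime q (p * r * s) := (hpq.symm.mul_right hqr).mul_right hqs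
  have hr_pqs : Nat.Coprime r (p * q * s) := (hpr.symm.mul_right hqr.symm).mul_right hrs
  have hdvd {k m n : ℕ} (hk : 1 < k) (h : Nat.Coprime k m) (hn : k ∣ n) : ¬ n ∣ m := fun hd =>
    hk.ne' (h.eq_one_of_dvd (hn.trans hd))
  obtain ⟨h1, h2⟩ := orbits_of_profile (a := p * q * s) (b := p * r * s) (c := q * r * s) (r := r)
    hconj (fun u => by rw [hφ, hq]) (fun u v h => by rw [hφ] at h ⊢; exact hcr u v h) hind
    (hdvd hq' hq_prs ⟨p * s, by ring⟩) (hdvd hr hr_pqs ⟨p * s, by ring⟩)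
    (hdvd hp hp_qrs ⟨q * s, by ring⟩) (hdvd hr hr_pqs ⟨q * s, by ring⟩)
    (hdvd hp hp_qrs ⟨r * s, by ring⟩) (hdvd hq' hq_prs ⟨r * s, by ring⟩)
    hr hr_pqs ⟨p * s, by ring⟩ ⟨q * s, by ring⟩ hcyc hya hy1
  refine ⟨h1, fun z hz => ?_⟩
  have hzF := h2 z hz
  have hz1 : φ x z ≠ z := fun h => hzF (Equiv.Perm.pow_apply_eq_self_of_apply_eq_self h _)
  have hz1' : z ∉ fixedPts φ x 1 := fun h => hz1 (by simpa [fixedPts] using h)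
  rcases hperx z hz1 with h | h | h
  · exact absurd ((perm_pow_apply_eq_iff_minimalPeriod_dvd _ _ _).2 h.dvd) hzF
  · exact .inl ⟨(perm_pow_apply_eq_iff_minimalPeriod_dvd _ _ _).2 h.dvd, hz1'⟩
  · exact .inr ⟨(perm_pow_apply_eq_iff_minimalPeriod_dvd _ _ _).2 h.dvd, hz1'⟩
end

section
/- Hayashi's conjecture holds for finite indecomposable crossed sets whose profile has three nontrivial cycle lengths each of multiplicity one: if X is a finite indecomposable crossed set, x ∈ X, and the permutation φ_x has exactly one cycle of each of three distinct lengths 1 < l₁ < l₂ < l₃ (all other points fixed), then l₁ divides l₃ and l₂ divides l₃. -/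
/-- `y` lies in a cycle of `σ` of length `n` (fixed points are not counted as cycles). -/
def InCycle {X : Type} [Fintype X] [DecidableEq X] (σ : Equiv.Perm X) (n : ℕ) (y : X) : Prop :=
  ∃ c ∈ σ.cycleFactorsFinset, c.support.card = n ∧ y ∈ c.support

namespace InCycle

open Equiv.Perm

variable {X : Type} [Fintype X] [DecidableEq X] {σ : Equiv.Perm X} {n : ℕ} {y z : X}

theorem conj (h : InCycle σ n y) (g : Equiv.Perm X) : InCycle (g * σ * g⁻¹) n (g y) := by
  obtain ⟨c, hc, hn, hy⟩ := h
  refine ⟨g * c * g⁻¹, (mem_cycleFactorsFinset_conj σ g c).2 hc, ?_, ?_⟩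
  · rw [card_support_conj, hn]
  · simpa using hy

theorem mem_support (h : InCycle σ n y) : y ∈ σ.support := by
  obtain ⟨c, hc, -, hy⟩ := h
  exact mem_cycleFactorsFinset_support_le hc hy

theorem apply (h : InCycle σ n y) : InCycle σ n (σ y) := by
  obtain ⟨c, hc, hn, hy⟩ := h
  refine ⟨c, hc, hn, ?_⟩
  rw [← (mem_cycleFactorsFinset_iff.1 hc).2 y hy]
  exact apply_mem_support.2 hy

theorem exists_of_mem_support (h : y ∈ σ.support) : ∃ n ∈ σ.cycleType, InCycle σ n y := by
  have hc := cycleOf_mem_cycleFactorsFinset_iff.2 h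
  refine ⟨(σ.cycleOf y).support.card, ?_, σ.cycleOf y, hc, rfl, ?_⟩
  · rw [cycleType_def]
    exact Multiset.mem_map_of_mem _ hc
  · exact mem_support_cycleOf_iff.2 ⟨SameCycle.refl _ _, h⟩

theorem cycle_unique (hσ : σ.cycleType.Nodup) {c d : Equiv.Perm X}
    (hc : c ∈ σ.cycleFactorsFinset) (hd : d ∈ σ.cycleFactorsFinset)
    (h : c.support.card = d.support.card) : c = d := by
  rw [cycleType_def] at hσ
  exact Multiset.inj_on_of_nodup_map hσ c hc d hd h

theorem sameCycle (hσ : σ.cycleType.Nodup) (hy : InCycle σ n y) (hz : InCycle σ n z) :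
    σ.SameCycle y z := by
  obtain ⟨c, hc, hn, hy⟩ := hy
  obtain ⟨d, hd, hm, hz⟩ := hz
  obtain rfl := cycle_unique hσ hc hd (hn.trans hm.symm)
  rw [cycle_is_cycleOf hy hc] at hz
  exact (mem_support_cycleOf_iff.1 hz).1

open Classical in
theorem card_filter (hσ : σ.cycleType.Nodup) (hn : n ∈ σ.cycleType) :
    (Finset.univ.filter (InCycle σ n)).card = n := by
  rw [cycleType_def, Multiset.mem_map] at hn
  obtain ⟨c, hc, hn⟩ := hn
  have hc : c ∈ σ.cycleFactorsFinset := hc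
  have hn : c.support.card = n := hn
  rw [← hn]
  congr 1
  ext y
  simp only [Finset.mem_filter, Finset.mem_univ, true_and]
  refine ⟨?_, fun hy => ⟨c, hc, rfl, hy⟩⟩
  rintro ⟨d, hd, hdn, hy⟩
  rwa [cycle_unique hσ hc hd hdn.symm]

end InCycle

section Quandle

variable {X : Type} {φ : X → Equiv.Perm X}

theorem map_inner_eq_conj (hφ : ∀ x y, φ (φ x y) = φ x * φ y * (φ x)⁻¹)
    {g : Equiv.Perm X} (hg : g ∈ Subgroup.closure (Set.range φ)) (x : X) :
    φ (g x) = g * φ x * g⁻¹ := by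
  induction hg using Subgroup.closure_induction generalizing x with
  | mem g hg =>
    obtain ⟨a, rfl⟩ := hg
    exact hφ a x
  | one => simp
  | mul a b _ _ ha hb => rw [Equiv.Perm.mul_apply, ha, hb]; group
  | inv a _ ha =>
    have h := ha (a⁻¹ x)
    rw [show a (a⁻¹ x) = x by simp] at h
    rw [h]; group

variable [Fintype X] [DecidableEq X]

theorem inCycle_map_inner (hφ : ∀ x y, φ (φ x y) = φ x * φ y * (φ x)⁻¹)
    {g : Equiv.Perm X} (hg : g ∈ Subgroup.closure (Set.range φ)) {n : ℕ} {x y : X}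
    (h : InCycle (φ x) n y) : InCycle (φ (g x)) n (g y) := by
  rw [map_inner_eq_conj hφ hg]
  exact h.conj g

/-- In an indecomposable crossed set whose cycle lengths have multiplicity one, lying in a cycle
of maximal length is a symmetric relation. -/
theorem inCycle_max_symm (hφ : ∀ x y, φ (φ x y) = φ x * φ y * (φ x)⁻¹)
    (hq : ∀ x, φ x x = x) (hcr : ∀ x y, φ y x = x → φ x y = y)
    (hind : ∀ u v : X, ∃ g ∈ Subgroup.closure (Set.range φ), g u = v)
    {s : Multiset ℕ} (hs : s.Nodup) (hcyc : ∀ x, (φ x).cycleType = s)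
    {n : ℕ} (hn : n ∈ s) (hmax : ∀ m ∈ s, m ≤ n) {x y : X} (h : InCycle (φ x) n y) :
    InCycle (φ y) n x := by
  classical
  have hx : x ∈ (φ y).support := by
    rw [Equiv.Perm.mem_support]
    exact fun hxy => Equiv.Perm.mem_support.1 h.mem_support (hcr x y hxy)
  obtain ⟨m, hm, hmx⟩ := InCycle.exists_of_mem_support hx
  rw [hcyc] at hm
  have key : ∀ u v, InCycle (φ u) n v → InCycle (φ v) m u := by
    intro u v huv
    obtain ⟨g, hg, rfl⟩ := hind x u
    obtain ⟨k, hk⟩ := InCycle.sameCycle (by rwa [hcyc]) (inCycle_map_inner hφ hg h) huv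
    have hmem : (φ (g x)) ^ k * g ∈ Subgroup.closure (Set.range φ) :=
      mul_mem (zpow_mem (Subgroup.subset_closure (Set.mem_range_self _)) k) hg
    have := inCycle_map_inner hφ hmem hmx
    rwa [Equiv.Perm.mul_apply, Equiv.Perm.mul_apply, hk,
      Equiv.Perm.zpow_apply_eq_self_of_apply_eq_self (hq _)] at this
  have hcount := Finset.sum_card_bipartiteAbove_eq_sum_card_bipartiteBelow
    (s := (Finset.univ : Finset X)) (t := (Finset.univ : Finset X))
    (fun u v => InCycle (φ u) n v)
  have h1 : ∀ u, (Finset.univ.filter fun v => InCycle (φ u) n v).card = n := fun u =>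
    InCycle.card_filter (by rwa [hcyc]) (by rwa [hcyc])
  have h2 : ∀ v, (Finset.univ.filter fun u => InCycle (φ u) n v).card ≤ m := fun v =>
    (Finset.card_le_card (Finset.monotone_filter_right _ fun u _ hu => key u v hu)).trans
      (InCycle.card_filter (by rwa [hcyc]) (by rwa [hcyc])).le
  simp only [Finset.bipartiteAbove, Finset.bipartiteBelow, h1] at hcount
  have hle := hcount.trans_le (Finset.sum_le_sum fun v _ => h2 v)
  simp only [Finset.sum_const, smul_eq_mul] at hle
  have hnm : n ≤ m := Nat.le_of_mul_le_mul_left hle (Finset.card_pos.2 ⟨x, Finset.mem_univ x⟩)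
  rwa [le_antisymm (hmax m hm) hnm] at hmx

/-- If all the left translations have a cycle of length `n`, and the points outside it that are
moved are fewer than `2 * (n + 1)`, then the graph of being in a common `n`-cycle is connected. -/
theorem eqvGen_inCycle (hφ : ∀ x y, φ (φ x y) = φ x * φ y * (φ x)⁻¹) (hq : ∀ x, φ x x = x)
    (hind : ∀ u v : X, ∃ g ∈ Subgroup.closure (Set.range φ), g u = v)
    {s : Multiset ℕ} (hs : s.Nodup) (hcyc : ∀ x, (φ x).cycleType = s)
    {n : ℕ} (hn : n ∈ s) (hsum : s.sum < n + 2 * (n + 1)) (x z : X) :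
    Relation.EqvGen (fun u v => InCycle (φ u) n v) x z := by
  classical
  set Q := Relation.EqvGen (fun u v => InCycle (φ u) n v) with hQ
  have hQe : Equivalence Q := Relation.EqvGen.is_equivalence _
  have hmap : ∀ g ∈ Subgroup.closure (Set.range φ), ∀ u v, Q u v → Q (g u) (g v) := by
    intro g hg u v huv
    induction huv with
    | rel u v h => exact .rel _ _ (inCycle_map_inner hφ hg h)
    | refl u => exact .refl _
    | symm u v _ ih => exact ih.symm
    | trans u v w _ _ ih₁ ih₂ => exact ih₁.trans _ _ _ ih₂
  have hφmem : ∀ a, φ a ∈ Subgroup.closure (Set.range φ) := fun a =>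
    Subgroup.subset_closure (Set.mem_range_self a)
  have hclass : ∀ b, n + 1 ≤ (Finset.univ.filter (Q b)).card := by
    intro b
    have hb : b ∉ Finset.univ.filter (InCycle (φ b) n) := fun h =>
      Equiv.Perm.mem_support.1 (Finset.mem_filter.1 h).2.mem_support (hq b)
    have hcard : (Finset.univ.filter (InCycle (φ b) n)).card = n :=
      InCycle.card_filter (by rwa [hcyc]) (by rwa [hcyc])
    rw [← hcard, ← Finset.card_insert_of_notMem hb]
    refine Finset.card_le_card fun v hv => ?_
    rcases Finset.mem_insert.1 hv with rfl | hv
    · simpa using hQe.refl v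
    · simpa using Relation.EqvGen.rel _ _ (Finset.mem_filter.1 hv).2
  have hpres : ∀ a b, Q b (φ a b) := by
    intro a b
    by_contra hab
    have hmoved : ∀ z, Q z b ∨ Q z (φ a b) → ¬ Q z (φ a z) := by
      rintro z (hz | hz) hza
      · exact hab (hQe.trans (hQe.symm hz) (hQe.trans hza (hmap _ (hφmem a) _ _ hz)))
      · have h := hmap _ (inv_mem (hφmem a)) _ _ (hQe.trans (hQe.symm hza) hz)
        rw [show (φ a)⁻¹ (φ a z) = z by simp, show (φ a)⁻¹ (φ a b) = b by simp] at h
        exact hab (hQe.trans (hQe.symm h) hz)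
    have hdisj : Disjoint (Finset.univ.filter (Q b)) (Finset.univ.filter (Q (φ a b))) :=
      Finset.disjoint_filter.2 fun z _ h₁ h₂ => hab (hQe.trans h₁ (hQe.symm h₂))
    have hdisj' : Disjoint (Finset.univ.filter (Q b) ∪ Finset.univ.filter (Q (φ a b)))
        (Finset.univ.filter (InCycle (φ a) n)) := by
      refine Finset.disjoint_left.2 fun z hz hz' => ?_
      simp only [Finset.mem_union, Finset.mem_filter, Finset.mem_univ, true_and] at hz hz'
      exact hmoved z (hz.imp hQe.symm hQe.symm)
        (hQe.trans (hQe.symm (.rel _ _ hz')) (.rel _ _ hz'.apply))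
    have hsub : (Finset.univ.filter (Q b) ∪ Finset.univ.filter (Q (φ a b))) ∪
        Finset.univ.filter (InCycle (φ a) n) ⊆ (φ a).support := by
      intro z hz
      simp only [Finset.mem_union, Finset.mem_filter, Finset.mem_univ, true_and] at hz
      rcases hz with hz | hz
      · refine Equiv.Perm.mem_support.2 fun h => hmoved z (hz.imp hQe.symm hQe.symm) ?_
        rw [h]
        exact hQe.refl z
      · exact hz.mem_support
    have hle := Finset.card_le_card hsub
    rw [Finset.card_union_of_disjoint hdisj', Finset.card_union_of_disjoint hdisj,
      InCycle.card_filter (by rwa [hcyc]) (by rwa [hcyc]), ← Equiv.Perm.sum_cycleType,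
      hcyc] at hle
    have h₁ := hclass b
    have h₂ := hclass (φ a b)
    omega
  obtain ⟨g, hg, rfl⟩ := hind x z
  induction hg using Subgroup.closure_induction generalizing x with
  | mem g hg =>
    obtain ⟨a, rfl⟩ := hg
    exact hpres a x
  | one => exact hQe.refl x
  | mul a b _ _ ha hb => exact hQe.trans (hb x) (ha (b x))
  | inv a _ ha => simpa using hQe.symm (ha (a⁻¹ x))

/-- If lying in an `n`-cycle is a symmetric relation whose graph is connected, then the `n`-th
power of every left translation is trivial. -/
theorem pow_eq_one_of_eqvGen (hφ : ∀ x y, φ (φ x y) = φ x * φ y * (φ x)⁻¹)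
    (hq : ∀ x, φ x x = x) {n : ℕ} (hnodup : ∀ x, (φ x).cycleType.Nodup)
    (hsymm : ∀ x y, InCycle (φ x) n y → InCycle (φ y) n x) (x : X)
    (hconn : ∀ z, Relation.EqvGen (fun u v => InCycle (φ u) n v) x z) : φ x ^ n = 1 := by
  have hmem : φ x ^ n ∈ Subgroup.closure (Set.range φ) :=
    pow_mem (Subgroup.subset_closure (Set.mem_range_self x)) n
  have hstep : ∀ u v, InCycle (φ u) n v →
      ((φ x ^ n) u = u ∧ ∀ w, InCycle (φ u) n w → (φ x ^ n) w = w) →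
      ((φ x ^ n) v = v ∧ ∀ w, InCycle (φ v) n w → (φ x ^ n) w = w) := by
    rintro u v huv ⟨hu, hfix⟩
    have hv := hfix v huv
    refine ⟨hv, fun w hw => ?_⟩
    obtain ⟨k, rfl⟩ := InCycle.sameCycle (hnodup v) (hsymm u v huv) hw
    have hcomm : Commute (φ x ^ n) (φ v) := by
      have h := map_inner_eq_conj hφ hmem v
      rw [hv] at h
      exact (eq_mul_inv_iff_mul_eq.1 h).symm
    rw [← Equiv.Perm.mul_apply, (hcomm.zpow_right k).eq, Equiv.Perm.mul_apply, hu]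
  have hall : ∀ u v, Relation.EqvGen (fun u v => InCycle (φ u) n v) u v →
      (((φ x ^ n) u = u ∧ ∀ w, InCycle (φ u) n w → (φ x ^ n) w = w) ↔
      ((φ x ^ n) v = v ∧ ∀ w, InCycle (φ v) n w → (φ x ^ n) w = w)) := by
    intro u v h
    induction h with
    | rel u v h => exact ⟨hstep u v h, hstep v u (hsymm u v h)⟩
    | refl u => exact Iff.rfl
    | symm u v _ ih => exact ih.symm
    | trans u v w _ _ ih₁ ih₂ => exact ih₁.trans ih₂
  ext z
  refine ((hall x z (hconn z)).1 ⟨Equiv.Perm.pow_apply_eq_self_of_apply_eq_self (hq x) n, ?_⟩).1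
  rintro w ⟨c, hc, hn, hw⟩
  rw [Equiv.Perm.cycle_is_cycleOf hw hc] at hn
  rw [← hn, ← Equiv.Perm.pow_mod_card_support_cycleOf_self_apply, Nat.mod_self, pow_zero,
    Equiv.Perm.one_apply]

end Quandle


/-- Hayashi's conjecture for finite indecomposable crossed sets
whose profile has three nontrivial cycle lengths, each of multiplicity one:
if `φ_x` has exactly one cycle of each of the distinct lengths
`1 < l₁ < l₂ < l₃` (all other points fixed), then `l₁ ∣ l₃` and `l₂ ∣ l₃`. -/
theorem stmt_15 (X : Type) [Fintype X] [DecidableEq X]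
    (op : X → X → X)
    (φ : X → Equiv.Perm X)
    (hφ : ∀ x y : X, φ x y = op x y)
    (hsd : ∀ x y z : X, op x (op y z) = op (op x y) (op x z))
    (hq : ∀ x : X, op x x = x)
    (hcr : ∀ x y : X, op y x = x → op x y = y)
    (hind : ∀ u v : X, ∃ g ∈ Subgroup.closure (Set.range φ), g u = v)
    (x : X) (l₁ l₂ l₃ : ℕ)
    (h1 : 1 < l₁) (h12 : l₁ < l₂) (h23 : l₂ < l₃)
    (hcyc : (φ x).cycleType = {l₁, l₂, l₃}) :
    l₁ ∣ l₃ ∧ l₂ ∣ l₃ := by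
  have hconj : ∀ a b, φ (φ a b) = φ a * φ b * (φ a)⁻¹ := by
    intro a b
    rw [eq_mul_inv_iff_mul_eq]
    ext z
    simp only [Equiv.Perm.mul_apply, hφ]
    exact (hsd a b z).symm
  have hq' : ∀ a, φ a a = a := fun a => (hφ a a).trans (hq a)
  have hcr' : ∀ a b, φ b a = a → φ a b = b := fun a b h =>
    (hφ a b).trans (hcr a b ((hφ b a).symm.trans h))
  have hcyc' : ∀ a, (φ a).cycleType = {l₁, l₂, l₃} := by
    intro a
    obtain ⟨g, hg, rfl⟩ := hind x a
    rw [map_inner_eq_conj hconj hg, Equiv.Perm.cycleType_conj, hcyc]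
  have hs : ({l₁, l₂, l₃} : Multiset ℕ).Nodup := by
    simp
    omega
  have hn : l₃ ∈ ({l₁, l₂, l₃} : Multiset ℕ) := by simp
  have hmax : ∀ m ∈ ({l₁, l₂, l₃} : Multiset ℕ), m ≤ l₃ := by
    simp
    omega
  have hsum : ({l₁, l₂, l₃} : Multiset ℕ).sum < l₃ + 2 * (l₃ + 1) := by
    simp
    omega
  have hpow : φ x ^ l₃ = 1 :=
    pow_eq_one_of_eqvGen hconj hq' (fun a => by rwa [hcyc'])
      (fun a b => inCycle_max_symm hconj hq' hcr' hind hs hcyc' hn hmax) x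
      (eqvGen_inCycle hconj hq' hind hs hcyc' hn hsum x)
  have hdvd : ∀ m ∈ (φ x).cycleType, m ∣ l₃ := fun m hm =>
    (Equiv.Perm.dvd_of_mem_cycleType hm).trans (orderOf_dvd_of_pow_eq_one hpow)
  exact ⟨hdvd l₁ (by simp [hcyc]), hdvd l₂ (by simp [hcyc])⟩
end

section
/- Hayashi's conjecture holds for finite indecomposable affine quandles: let G be a finite abelian group, α an automorphism of G, and let Aff(G, α) be the quandle on G defined by x ◃ y = (x − α(x)) + α(y). If Aff(G, α) is indecomposable, then for every x ∈ G, every cycle length of the permutation φ_x : y ↦ x ◃ y divides the largest cycle length of φ_x (which equals the order of φ_x). -/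
/-- The inner automorphism `φ_x : y ↦ (x - α x) + α y` of the affine quandle
`Aff(G, α)`. -/
def affinePhi {G : Type} [AddCommGroup G] (α : G ≃+ G) (x : G) : Equiv.Perm G :=
  α.toEquiv.trans (Equiv.addLeft (x - α x))

theorem Module.exists_isCompl_ne_top_of_not_mem_radical {R M : Type*} [CommRing R] [AddCommGroup M]
    [Module R M] [Finite M] {b : R} (hb : b ∉ (Module.annihilator R M).radical)
    (hinj : ¬ ∀ y : M, b • y = 0 → y = 0) :
    ∃ A B : Submodule R M, IsCompl A B ∧ A ≠ ⊤ ∧ B ≠ ⊤ := by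
  have hpow : ∀ (n : ℕ) (y : M), (LinearMap.lsmul R M b ^ n) y = b ^ n • y := by
    intro n y
    induction n with
    | zero => simp
    | succ n ih =>
      rw [pow_succ', Module.End.mul_apply, ih, pow_succ', mul_smul, LinearMap.lsmul_apply]
  refine ⟨_, _, (LinearMap.lsmul R M b).isCompl_iSup_ker_pow_iInf_range_pow, ?_, ?_⟩
  · intro h
    obtain ⟨n, hn⟩ := Filter.eventually_atTop.1
      (LinearMap.lsmul R M b).eventually_iSup_ker_pow_eq
    rw [hn n le_rfl] at h
    refine hb ⟨n, Module.mem_annihilator.2 fun y => ?_⟩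
    have : y ∈ LinearMap.ker (LinearMap.lsmul R M b ^ n) := h ▸ Submodule.mem_top
    rwa [LinearMap.mem_ker, hpow] at this
  · intro h
    have hsurj : Function.Surjective (LinearMap.lsmul R M b) := by
      rw [← LinearMap.range_eq_top, eq_top_iff, ← h]
      exact (iInf_le _ 1).trans (by rw [pow_one])
    refine hinj fun y hy => (Finite.injective_iff_surjective.2 hsurj) ?_
    simpa using hy

theorem Module.exists_regular_of_local {R M : Type*} [CommRing R] [AddCommGroup M]
    [Module R M] [Finite M] [Nontrivial M]
    (hloc : ∀ b : R, b ∈ (Module.annihilator R M).radical ∨ ∀ y : M, b • y = 0 → y = 0)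
    (a : R) (ha : ∃ n, 0 < n ∧ ∀ y : M, a ^ n • y = y) :
    ∃ x : M, ∀ k : ℕ, a ^ k • x = x → ∀ y : M, a ^ k • y = y := by
  classical
  set J := Module.annihilator R M with hJ
  obtain ⟨p, hp, hpdvd⟩ := Nat.exists_prime_and_dvd (Finite.one_lt_card (α := M)).ne'
  have : Fact p.Prime := ⟨hp⟩
  have hpJ : (p : R) ∈ J.radical := by
    refine (hloc p).resolve_right fun h => ?_
    obtain ⟨z, hz⟩ := exists_prime_addOrderOf_dvd_card' (G := M) p hpdvd
    have hz0 : z = 0 := h z (by rw [Nat.cast_smul_eq_nsmul, ← hz, addOrderOf_nsmul_eq_zero])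
    rw [hz0, addOrderOf_zero] at hz
    exact hp.one_lt.ne hz
  set n := Nat.find ha with hn
  obtain ⟨hn0, hn1⟩ : 0 < n ∧ ∀ y : M, a ^ n • y = y := Nat.find_spec ha
  have hmin : ∀ r, r.Prime → r ∣ n → ∃ z : M, a ^ (n / r) • z ≠ z := by
    intro r hr hrn
    by_contra! h
    exact Nat.find_min ha (Nat.div_lt_self hn0 hr.one_lt)
      ⟨Nat.div_pos (Nat.le_of_dvd hn0 hrn) hr.pos, h⟩
  obtain ⟨x, hx0, hxp⟩ : ∃ x : M, x ≠ 0 ∧ (p ∣ n → a ^ (n / p) • x ≠ x) := by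
    by_cases h : p ∣ n
    · obtain ⟨z, hz⟩ := hmin p hp h
      refine ⟨z, ?_, fun _ => hz⟩
      rintro rfl
      simp at hz
    · obtain ⟨z, hz⟩ := exists_ne (0 : M)
      exact ⟨z, hz, fun h' => absurd h' h⟩
  have hiter : ∀ (k : ℕ) (y : M), Function.IsPeriodicPt (a • ·) k y ↔ a ^ k • y = y := by
    intro k y
    rw [Function.IsPeriodicPt, Function.IsFixedPt, smul_iterate]
  have hmul : ∀ (d e : ℕ) (y : M), d ∣ e → a ^ d • y = y → a ^ e • y = y := by
    intro d e y hde h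
    exact (hiter e y).1 (((hiter d y).2 h).trans_dvd hde)
  refine ⟨x, fun k hk => ?_⟩
  have hd : a ^ (k.gcd n) • x = x :=
    (hiter _ _).1 (((hiter k x).2 hk).gcd ((hiter n x).2 (hn1 x)))
  suffices hkn : n ∣ k from fun y => hmul n k y hkn (hn1 y)
  by_contra hkn
  obtain ⟨m, hm⟩ := Nat.gcd_dvd_right k n
  have hm1 : m ≠ 1 := by
    rintro rfl
    rw [mul_one] at hm
    exact hkn (hm ▸ Nat.gcd_dvd_left k n)
  obtain ⟨r, hr, l, rfl⟩ := Nat.exists_prime_and_dvd hm1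
  have hnr : n = r * (k.gcd n * l) := by linarith
  have hrn : r ∣ n := ⟨_, hnr⟩
  have hdr : n / r = k.gcd n * l := by
    conv_lhs => rw [hnr]
    exact Nat.mul_div_cancel_left _ hr.pos
  have hxr : a ^ (n / r) • x = x := hmul _ _ x (hdr ▸ Dvd.intro _ rfl) hd
  have hpr : p ≠ r := by
    rintro rfl
    exact hxp hrn hxr
  set β := a ^ (n / r) with hβ
  have hcJ : β - 1 ∈ J.radical := by
    refine (hloc _).resolve_right fun h => hx0 (h x ?_)
    rw [sub_smul, one_smul, hxr, sub_self]
  have hsum : (∑ i ∈ Finset.range r, β ^ i) - (r : R) ∈ J.radical := by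
    have : (∑ i ∈ Finset.range r, β ^ i) - (r : R) = ∑ i ∈ Finset.range r, (β ^ i - 1) := by
      simp
    rw [this]
    refine Ideal.sum_mem _ fun i _ => Ideal.mem_of_dvd _ ?_ hcJ
    simpa using sub_dvd_pow_sub_pow β 1 i
  rcases hloc (∑ i ∈ Finset.range r, β ^ i) with h | h
  · have hrJ : (r : R) ∈ J.radical := by simpa using Ideal.sub_mem _ h hsum
    have hone : (1 : R) ∈ J.radical := by
      obtain ⟨u, v, huv⟩ := (Nat.isCoprime_iff_coprime.2
        ((Nat.coprime_primes hp hr).2 hpr)).map (Int.castRingHom R)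
      rw [← huv]
      simpa using Ideal.add_mem _ (Ideal.mul_mem_left _ u hpJ) (Ideal.mul_mem_left _ v hrJ)
    obtain ⟨N, hN⟩ := hone
    rw [one_pow] at hN
    exact hx0 (by simpa using Module.mem_annihilator.1 hN x)
  · obtain ⟨z, hz⟩ := hmin r hr hrn
    refine hz (sub_eq_zero.1 (h _ ?_))
    have : β ^ r • z = z := by
      rw [hβ, ← pow_mul, Nat.div_mul_cancel hrn]
      exact hn1 z
    calc (∑ i ∈ Finset.range r, β ^ i) • (β • z - z)
        = ((∑ i ∈ Finset.range r, β ^ i) * (β - 1)) • z := by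
          rw [mul_smul, sub_smul, one_smul]
      _ = 0 := by rw [geom_sum_mul, sub_smul, one_smul, this, sub_self]

/-- A scalar acting with finite order on a finite module has a regular orbit. -/
theorem Module.exists_regular {R : Type*} [CommRing R] (a : R) (M : Type*)
    [AddCommGroup M] [Module R M] [Finite M] (ha : ∃ n, 0 < n ∧ ∀ y : M, a ^ n • y = y) :
    ∃ x : M, ∀ k : ℕ, a ^ k • x = x → ∀ y : M, a ^ k • y = y := by
  induction hc : Nat.card M using Nat.strong_induction_on generalizing M with
  | _ c ih =>
  rcases subsingleton_or_nontrivial M with hM | hM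
  · exact ⟨0, fun _ _ _ => Subsingleton.elim _ _⟩
  by_cases hloc : ∀ b : R, b ∈ (Module.annihilator R M).radical ∨ ∀ y : M, b • y = 0 → y = 0
  · exact Module.exists_regular_of_local hloc a ha
  push Not at hloc
  obtain ⟨b, hb, y, hy, hy0⟩ := hloc
  obtain ⟨A, B, hAB, hA, hB⟩ := Module.exists_isCompl_ne_top_of_not_mem_radical hb
    fun h => hy0 (h y hy)
  have key : ∀ C : Submodule R M, C ≠ ⊤ →
      ∃ x : C, ∀ k : ℕ, a ^ k • x = x → ∀ y : C, a ^ k • y = y := by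
    intro C hC
    refine ih (Nat.card C) ?_ C ?_ rfl
    · rw [← hc, ← Nat.card_univ (α := M)]
      exact Set.Finite.card_lt_card Set.finite_univ
        (Set.ssubset_univ_iff.2 fun h => hC (SetLike.coe_injective h))
    · obtain ⟨n, hn, h⟩ := ha
      exact ⟨n, hn, fun y => Subtype.ext (h y)⟩
  obtain ⟨u, hu⟩ := key A hA
  obtain ⟨v, hv⟩ := key B hB
  refine ⟨u + v, fun k hk y => ?_⟩
  have huv : a ^ k • (u : M) - u = v - a ^ k • (v : M) := by
    rw [smul_add] at hk
    rw [sub_eq_sub_iff_add_eq_add, hk, add_comm]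
  have h0 : a ^ k • (u : M) - u = 0 := by
    refine (Submodule.disjoint_def.1 hAB.disjoint) _
      (A.sub_mem (A.smul_mem _ u.2) u.2) ?_
    rw [huv]
    exact B.sub_mem v.2 (B.smul_mem _ v.2)
  have hu' := hu k (Subtype.ext (sub_eq_zero.1 h0))
  have hv' := hv k (Subtype.ext (sub_eq_zero.1 (huv ▸ h0)).symm)
  obtain ⟨s, hs, t, ht, rfl⟩ := Submodule.mem_sup.1
    (hAB.sup_eq_top ▸ Submodule.mem_top : y ∈ A ⊔ B)
  rw [smul_add]
  exact congrArg₂ (· + ·) (congrArg Subtype.val (hu' ⟨s, hs⟩))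
    (congrArg Subtype.val (hv' ⟨t, ht⟩))

open Polynomial in
/-- An automorphism of a finite abelian group has a regular orbit. -/
theorem AddEquiv.exists_regular {G : Type*} [AddCommGroup G] [Finite G] (α : G ≃+ G) :
    ∃ x : G, ∀ k : ℕ, α^[k] x = x → ∀ y : G, α^[k] y = y := by
  let f : Module.End ℤ G := α.toAddMonoidHom.toIntLinearMap
  let e := Module.AEval'.of f
  have hX : ∀ (k : ℕ) (y : G), (X : ℤ[X]) ^ k • e y = e (α^[k] y) := by
    intro k
    induction k with
    | zero => simp
    | succ k ih =>
      intro y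
      rw [pow_succ, mul_smul, Module.AEval'.X_smul_of, Function.iterate_succ_apply]
      exact ih _
  have : Finite (Module.AEval' f) := Finite.of_equiv G e.toEquiv
  obtain ⟨n, hn, h⟩ := isOfFinOrder_iff_pow_eq_one.1
    (isOfFinOrder_of_finite (α.toEquiv : Equiv.Perm G))
  obtain ⟨x, hx⟩ := Module.exists_regular (X : ℤ[X]) (Module.AEval' f) ⟨n, hn, fun y => by
    obtain ⟨y, rfl⟩ := e.surjective y
    rw [hX]
    refine congrArg e ?_
    have := congrArg (fun σ : Equiv.Perm G => σ y) h
    simpa [← Equiv.Perm.iterate_eq_pow] using this⟩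
  obtain ⟨x, rfl⟩ := e.surjective x
  refine ⟨x, fun k hk y => e.injective ?_⟩
  rw [← hX]
  exact hx k (by rw [hX, hk]) (e y)

theorem Equiv.Perm.orderOf_mem_cycleType_of_regular {X : Type*} [Fintype X] [DecidableEq X]
    {σ : Equiv.Perm X} (hσ : σ ≠ 1) (x : X) (hx : ∀ k : ℕ, (σ ^ k) x = x → σ ^ k = 1) :
    orderOf σ ∈ σ.cycleType := by
  have hne : σ x ≠ x := fun h => hσ (by simpa using hx 1 (by simpa using h))
  have hord : orderOf (σ.cycleOf x) = orderOf σ := by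
    refine Nat.dvd_antisymm (orderOf_cycleOf_dvd_orderOf σ x)
      (orderOf_dvd_of_pow_eq_one (hx _ ?_))
    rw [← cycleOf_pow_apply_self, pow_orderOf_eq_one, one_apply]
  rw [← hord, (isCycle_cycleOf σ hne).orderOf, cycleType_def]
  exact Multiset.mem_map_of_mem _
    (cycleOf_mem_cycleFactorsFinset_iff.2 (mem_support.2 hne))

theorem affinePhi_pow_apply {G : Type} [AddCommGroup G] (α : G ≃+ G) (x z : G) (k : ℕ) :
    (affinePhi α x ^ k) (x + z) = x + α^[k] z := by
  induction k generalizing z with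
  | zero => simp
  | succ k ih =>
    have : affinePhi α x (x + z) = x + α z := by
      simp [affinePhi, ← add_assoc]
    rw [pow_succ, Equiv.Perm.mul_apply, this, ih, Function.iterate_succ_apply]

/-- Hayashi's conjecture for finite indecomposable affine
quandles `Aff(G, α)` (on a finite abelian group `G`, `x ◃ y = (x − α x) + α y`):
every cycle length of `φ_x` divides the largest cycle length, which equals the
order of `φ_x`. -/
theorem stmt_17 (G : Type) [AddCommGroup G] [Fintype G] [DecidableEq G]
    (α : G ≃+ G)
    (hind : ∀ u v : G, ∃ g ∈ Subgroup.closure (Set.range (affinePhi α)), g u = v) :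
    ∀ x : G,
      (∀ c ∈ (affinePhi α x).cycleType, c ∣ orderOf (affinePhi α x)) ∧
      ((affinePhi α x).cycleType ≠ 0 →
        orderOf (affinePhi α x) ∈ (affinePhi α x).cycleType) := by
  intro x
  refine ⟨fun c hc => Equiv.Perm.dvd_of_mem_cycleType hc, fun h => ?_⟩
  obtain ⟨z, hz⟩ := α.exists_regular
  refine Equiv.Perm.orderOf_mem_cycleType_of_regular
    (fun h1 => h (Equiv.Perm.cycleType_eq_zero.2 h1)) (x + z) fun k hk => ?_
  rw [affinePhi_pow_apply, add_right_inj] at hk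
  ext y
  obtain ⟨y, rfl⟩ : ∃ w, y = x + w := ⟨y - x, by simp⟩
  rw [affinePhi_pow_apply, hz k hk, Equiv.Perm.one_apply]
end
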